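/- There exists a constant C > 0, depending only on Ω and the interior curve C, such that for every λ > 0 and every Neumann eigenfunction φ of Ω with eigenvalue λ², the Cauchy data of φ along C control its boundary trace exponentially: (∫₀^ℓ φ(q(s))² ds)^{1/2} ≤ e^{Cλ} · ( (∫₀^L φ(c(s))² ds)^{1/2} + (∫₀^L ⟨∇φ(c(s)), n(s)⟩² ds)^{1/2} ). -/

import Mathlib

open MeasureTheory Real
open scoped RealInnerProductSpace

noncomputable section

abbrev E2 : Type := EuclideanSpace ℝ (Fin 2)

/-- The Euclidean Laplacian `∂²/∂x₁² + ∂²/∂x₂²` on `ℝ²`. -/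
def lap (φ : E2 → ℝ) (x : E2) : ℝ :=
  ∑ i : Fin 2,
    fderiv ℝ (fun y => fderiv ℝ φ y (EuclideanSpace.single i 1)) x (EuclideanSpace.single i 1)

/-- A bounded open connected planar domain. -/
structure IsPlaneDomain (Ω : Set E2) : Prop where
  isOpen : IsOpen Ω
  isBounded : Bornology.IsBounded Ω
  isConnected : IsConnected Ω

/-- An arc-length parametrization `q` of the boundary of `Ω` (periodic with period `len`,
injective on `[0, len)`, unit speed, image equal to the frontier of `Ω`), together with the
unit normal `ν` along the boundary, pointing into `Ω`. -/
structure BoundaryParam (Ω : Set E2) where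
  len : ℝ
  len_pos : 0 < len
  q : ℝ → E2
  qd : ℝ → E2
  hasDerivAt : ∀ s, HasDerivAt q (qd s) s
  periodic : Function.Periodic q len
  injOn : Set.InjOn q (Set.Ico 0 len)
  unitSpeed : ∀ s, ‖qd s‖ = 1
  range_eq : Set.range q = frontier Ω
  ν : ℝ → E2
  ν_unit : ∀ s, ‖ν s‖ = 1
  ν_orth : ∀ s, ⟪ν s, qd s⟫ = 0
  ν_inward : ∀ s, ∃ δ > 0, ∀ t ∈ Set.Ioo (0 : ℝ) δ, q s + t • ν s ∈ Ω

/-- The boundary parametrization is `C^∞`-smooth. -/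
def BoundaryParam.IsSmooth {Ω : Set E2} (B : BoundaryParam Ω) : Prop :=
  ContDiff ℝ (⊤ : ℕ∞) B.q

/-- An interior closed real-analytic curve in `Ω`: an arc-length parametrization `c`,
real-analytic, periodic with period `len`, injective on `[0, len)`, with image contained
in `Ω`, together with a unit normal `n` along the curve. -/
structure InteriorCurve (Ω : Set E2) where
  len : ℝ
  len_pos : 0 < len
  c : ℝ → E2
  cd : ℝ → E2
  hasDerivAt : ∀ s, HasDerivAt c (cd s) s
  analytic : AnalyticOnNhd ℝ c Set.univ
  periodic : Function.Periodic c len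
  injOn : Set.InjOn c (Set.Ico 0 len)
  unitSpeed : ∀ s, ‖cd s‖ = 1
  mem : ∀ s, c s ∈ Ω
  n : ℝ → E2
  n_unit : ∀ s, ‖n s‖ = 1
  n_orth : ∀ s, ⟪n s, cd s⟫ = 0

/-- `φ` is a Neumann eigenfunction of `Ω` with eigenvalue `lam²`: it is `C^∞` on an open
neighborhood of the closure of `Ω`, not identically zero on `Ω`, satisfies `Δφ = -lam² φ`
on `Ω` and has vanishing normal derivative along the boundary. -/
structure IsNeumannEigenfunction {Ω : Set E2} (B : BoundaryParam Ω) (lam : ℝ)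
    (φ : E2 → ℝ) : Prop where
  smooth : ∃ U : Set E2, IsOpen U ∧ closure Ω ⊆ U ∧ ContDiffOn ℝ (⊤ : ℕ∞) φ U
  nontrivial : ∃ x ∈ Ω, φ x ≠ 0
  eigen : ∀ x ∈ Ω, lap φ x = -lam ^ 2 * φ x
  neumann : ∀ s : ℝ, ⟪gradient φ (B.q s), B.ν s⟫ = 0

open scoped ContDiff

/-- Partial derivative in the first variable. -/
def pdS (f : ℝ × ℝ → ℝ) (p : ℝ × ℝ) : ℝ := fderiv ℝ f p (1, 0)

/-- Partial derivative in the second variable. -/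
def pdR (f : ℝ × ℝ → ℝ) (p : ℝ × ℝ) : ℝ := fderiv ℝ f p (0, 1)

lemma contDiff_pdS {f : ℝ × ℝ → ℝ} (hf : ContDiff ℝ ∞ f) : ContDiff ℝ ∞ (pdS f) :=
  (hf.fderiv_right (m := ∞) (by simp)).clm_apply contDiff_const

lemma contDiff_pdR {f : ℝ × ℝ → ℝ} (hf : ContDiff ℝ ∞ f) : ContDiff ℝ ∞ (pdR f) :=
  (hf.fderiv_right (m := ∞) (by simp)).clm_apply contDiff_const

lemma hasDerivAt_pdS {f : ℝ × ℝ → ℝ} {p : ℝ × ℝ} (hf : DifferentiableAt ℝ f p) :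
    HasDerivAt (fun t => f (t, p.2)) (pdS f p) p.1 := by
  have h1 : HasDerivAt (fun t : ℝ => (t, p.2)) ((1 : ℝ), (0 : ℝ)) p.1 :=
    (hasDerivAt_id p.1).prodMk (hasDerivAt_const p.1 p.2)
  exact HasFDerivAt.comp_hasDerivAt p.1 (f := fun t : ℝ => (t, p.2)) hf.hasFDerivAt h1

lemma hasDerivAt_pdR {f : ℝ × ℝ → ℝ} {p : ℝ × ℝ} (hf : DifferentiableAt ℝ f p) :
    HasDerivAt (fun t => f (p.1, t)) (pdR f p) p.2 := by
  have h1 : HasDerivAt (fun t : ℝ => (p.1, t)) ((0 : ℝ), (1 : ℝ)) p.2 :=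
    (hasDerivAt_const p.2 p.1).prodMk (hasDerivAt_id p.2)
  exact HasFDerivAt.comp_hasDerivAt p.2 (f := fun t : ℝ => (p.1, t)) hf.hasFDerivAt h1

lemma pdS_eq_of_hasDerivAt {f : ℝ × ℝ → ℝ} {p : ℝ × ℝ} {d : ℝ} (hf : DifferentiableAt ℝ f p)
    (h : HasDerivAt (fun t => f (t, p.2)) d p.1) : pdS f p = d :=
  (hasDerivAt_pdS hf).unique h

lemma pdR_eq_of_hasDerivAt {f : ℝ × ℝ → ℝ} {p : ℝ × ℝ} {d : ℝ} (hf : DifferentiableAt ℝ f p)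
    (h : HasDerivAt (fun t => f (p.1, t)) d p.2) : pdR f p = d :=
  (hasDerivAt_pdR hf).unique h

lemma pdS_pdR_comm {f : ℝ × ℝ → ℝ} (hf : ContDiff ℝ ∞ f) (p : ℝ × ℝ) :
    pdS (pdR f) p = pdR (pdS f) p := by
  have hd : DifferentiableAt ℝ (fderiv ℝ f) p :=
    ((hf.fderiv_right (m := ∞) (by simp)).differentiable (by simp)) p
  have h1 : ∀ u v : ℝ × ℝ, fderiv ℝ (fun y => fderiv ℝ f y v) p u
      = fderiv ℝ (fderiv ℝ f) p u v := by
    intro u v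
    rw [fderiv_clm_apply hd (differentiableAt_const v)]
    simp
  have hs : IsSymmSndFDerivAt ℝ f p :=
    hf.contDiffAt.isSymmSndFDerivAt
      (by simpa using WithTop.coe_le_coe.2 (le_top : (2 : ℕ∞) ≤ ⊤))
  change fderiv ℝ (fun y => fderiv ℝ f y (0, 1)) p (1, 0)
    = fderiv ℝ (fun y => fderiv ℝ f y (1, 0)) p (0, 1)
  rw [h1, h1, hs]

/-- Periodicity in the first variable. -/
def PerS (ℓ : ℝ) (f : ℝ × ℝ → ℝ) : Prop := ∀ s r, f (s + ℓ, r) = f (s, r)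

lemma PerS.fderiv {ℓ : ℝ} {f : ℝ × ℝ → ℝ} (h : PerS ℓ f) (s r : ℝ) :
    fderiv ℝ f (s + ℓ, r) = fderiv ℝ f (s, r) := by
  have h1 : (fun x : ℝ × ℝ => f (x + (ℓ, 0))) = f := by
    funext x
    rcases x with ⟨x, y⟩
    simpa using h x y
  have h2 := fderiv_comp_add_right (𝕜 := ℝ) (f := f) (x := (s, r)) (ℓ, 0)
  rw [h1] at h2
  simpa using h2.symm

lemma PerS.pdS {ℓ : ℝ} {f : ℝ × ℝ → ℝ} (h : PerS ℓ f) : PerS ℓ (pdS f) := by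
  intro s r
  simp only [_root_.pdS, h.fderiv]

lemma PerS.pdR {ℓ : ℝ} {f : ℝ × ℝ → ℝ} (h : PerS ℓ f) : PerS ℓ (pdR f) := by
  intro s r
  simp only [_root_.pdR, h.fderiv]

/-- The coordinate rectangle `[0, ℓ] × [r₀, r₁]`. -/
def rect (ℓ r₀ r₁ : ℝ) : Set (ℝ × ℝ) := Set.Icc (0, r₀) (ℓ, r₁)

lemma mem_rect {ℓ r₀ r₁ : ℝ} {p : ℝ × ℝ} :
    p ∈ rect ℓ r₀ r₁ ↔ (0 ≤ p.1 ∧ p.1 ≤ ℓ) ∧ (r₀ ≤ p.2 ∧ p.2 ≤ r₁) := by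
  simp only [rect, Set.mem_Icc, Prod.le_def]
  tauto

lemma isCompact_rect (ℓ r₀ r₁ : ℝ) : IsCompact (rect ℓ r₀ r₁) := isCompact_Icc

lemma measurableSet_rect (ℓ r₀ r₁ : ℝ) : MeasurableSet (rect ℓ r₀ r₁) := measurableSet_Icc

lemma rect_subset {ℓ r₀ r₁ r₂ r₃ : ℝ} (h0 : r₂ ≤ r₀) (h1 : r₁ ≤ r₃) :
    rect ℓ r₀ r₁ ⊆ rect ℓ r₂ r₃ := by
  intro p hp
  rw [mem_rect] at hp ⊢
  exact ⟨hp.1, h0.trans hp.2.1, hp.2.2.trans h1⟩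

lemma Continuous.integrableOn_rect {f : ℝ × ℝ → ℝ} (hf : Continuous f) (ℓ r₀ r₁ : ℝ) :
    IntegrableOn f (rect ℓ r₀ r₁) :=
  hf.continuousOn.integrableOn_compact (isCompact_rect ℓ r₀ r₁)

lemma integral_div_rect_of_le {ℓ r₀ R : ℝ} (hℓ : 0 ≤ ℓ) (hR : r₀ ≤ R) {F G : ℝ × ℝ → ℝ}
    (hF : ContDiff ℝ ∞ F) (hG : ContDiff ℝ ∞ G) (hper : PerS ℓ F) :
    ∫ p in rect ℓ r₀ R, (pdS F p + pdR G p)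
      = (∫ s in (0 : ℝ)..ℓ, G (s, R)) - ∫ s in (0 : ℝ)..ℓ, G (s, r₀) := by
  have h := integral_divergence_prod_Icc_of_hasFDerivAt_of_le F G (fderiv ℝ F) (fderiv ℝ G)
    (0, r₀) (ℓ, R) ⟨hℓ, hR⟩ hF.continuous.continuousOn hG.continuous.continuousOn
    (fun x _ => (hF.differentiable (by simp) x).hasFDerivAt)
    (fun x _ => (hG.differentiable (by simp) x).hasFDerivAt)
    ((((contDiff_pdS hF).continuous.add (contDiff_pdR hG).continuous)).integrableOn_rect ℓ r₀ R)
  have h2 : ∀ y, F (ℓ, y) = F (0, y) := fun y => by simpa using hper 0 y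
  simp only [h2, add_sub_cancel_right] at h
  exact h

lemma integral_div_rect {ℓ R : ℝ} (hℓ : 0 ≤ ℓ) (hR : 0 ≤ R) {F G : ℝ × ℝ → ℝ}
    (hF : ContDiff ℝ ∞ F) (hG : ContDiff ℝ ∞ G) (hper : PerS ℓ F) :
    ∫ p in rect ℓ 0 R, (pdS F p + pdR G p)
      = (∫ s in (0 : ℝ)..ℓ, G (s, R)) - ∫ s in (0 : ℝ)..ℓ, G (s, 0) :=
  integral_div_rect_of_le hℓ hR hF hG hper

/-- The first component of the flux in the Carleman identity for the weight `exp (τ e^{kr})`. -/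
def fluxS (k τ : ℝ) (a v : ℝ × ℝ → ℝ) (p : ℝ × ℝ) : ℝ :=
  -2 * τ * k * exp (k * p.2) * (a p * pdS v p * pdR v p)
    - 2 * τ * k ^ 2 * exp (k * p.2) * (a p * v p * pdS v p)

/-- The second component of the flux in the Carleman identity for the weight `exp (τ e^{kr})`. -/
def fluxR (k τ lam : ℝ) (a v : ℝ × ℝ → ℝ) (p : ℝ × ℝ) : ℝ :=
  -τ * k * exp (k * p.2) * (pdR v p) ^ 2 - 2 * τ * k ^ 2 * exp (k * p.2) * (v p * pdR v p)
    + τ * k ^ 3 * exp (k * p.2) * (v p) ^ 2 + τ * k * exp (k * p.2) * (a p * (pdS v p) ^ 2)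
    - τ * (τ ^ 2 * k ^ 3 * exp (k * p.2) ^ 3 + lam ^ 2 * k * exp (k * p.2)) * (v p) ^ 2

lemma contDiff_expk (k : ℝ) : ContDiff ℝ ∞ (fun p : ℝ × ℝ => exp (k * p.2)) :=
  (contDiff_const.mul contDiff_snd).exp

lemma contDiff_fluxS {a v : ℝ × ℝ → ℝ} (ha : ContDiff ℝ ∞ a) (hv : ContDiff ℝ ∞ v) (k τ : ℝ) :
    ContDiff ℝ ∞ (fluxS k τ a v) := by
  have h1 := contDiff_pdS hv
  have h2 := contDiff_pdR hv
  have h3 := contDiff_expk k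
  unfold fluxS
  fun_prop

lemma contDiff_fluxR {a v : ℝ × ℝ → ℝ} (ha : ContDiff ℝ ∞ a) (hv : ContDiff ℝ ∞ v)
    (k τ lam : ℝ) : ContDiff ℝ ∞ (fluxR k τ lam a v) := by
  have h1 := contDiff_pdS hv
  have h2 := contDiff_pdR hv
  have h3 := contDiff_expk k
  unfold fluxR
  fun_prop

lemma PerS.fluxS {ℓ : ℝ} {a v : ℝ × ℝ → ℝ} (ha : PerS ℓ a) (hv : PerS ℓ v) (k τ : ℝ) :
    PerS ℓ (fluxS k τ a v) := by
  intro s r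
  simp only [_root_.fluxS, ha s r, hv s r, hv.pdS s r, hv.pdR s r]

lemma carleman_identity {a v : ℝ × ℝ → ℝ} (ha : ContDiff ℝ ∞ a) (hv : ContDiff ℝ ∞ v)
    (k τ lam : ℝ) (p : ℝ × ℝ) :
    pdS (fluxS k τ a v) p + pdR (fluxR k τ lam a v) p
      + (3 * τ * k ^ 2 * exp (k * p.2) * (pdR v p) ^ 2
        + τ * exp (k * p.2) * (k ^ 2 * a p - k * pdR a p) * (pdS v p) ^ 2
        + τ * (τ ^ 2 * k ^ 4 * exp (k * p.2) ^ 3 - k ^ 2 * exp (k * p.2) * lam ^ 2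
          - k ^ 4 * exp (k * p.2)) * (v p) ^ 2)
      = (pdR (pdR v) p + (pdS a p * pdS v p + a p * pdS (pdS v) p)
          + (τ ^ 2 * k ^ 2 * exp (k * p.2) ^ 2 + lam ^ 2) * v p)
        * (-2 * τ * k * exp (k * p.2) * pdR v p - 2 * τ * k ^ 2 * exp (k * p.2) * v p) := by
  have dv := hv.differentiable (by simp) p
  have dvs := (contDiff_pdS hv).differentiable (by simp) p
  have dvr := (contDiff_pdR hv).differentiable (by simp) p
  have da := ha.differentiable (by simp) p
  have hE : HasDerivAt (fun t => exp (k * t)) (exp (k * p.2) * (k * 1)) p.2 :=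
    ((hasDerivAt_id p.2).const_mul k).exp
  have hS := pdS_eq_of_hasDerivAt ((contDiff_fluxS ha hv k τ).differentiable (by simp) p)
    (((((hasDerivAt_pdS da).mul (hasDerivAt_pdS dvs)).mul (hasDerivAt_pdS dvr)).const_mul
      (-2 * τ * k * exp (k * p.2))).sub
    ((((hasDerivAt_pdS da).mul (hasDerivAt_pdS dv)).mul (hasDerivAt_pdS dvs)).const_mul
      (2 * τ * k ^ 2 * exp (k * p.2))))
  have hR := pdR_eq_of_hasDerivAt ((contDiff_fluxR ha hv k τ lam).differentiable (by simp) p)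
    ((((((hE.const_mul (-τ * k)).mul ((hasDerivAt_pdR dvr).pow 2)).sub
      ((hE.const_mul (2 * τ * k ^ 2)).mul ((hasDerivAt_pdR dv).mul (hasDerivAt_pdR dvr)))).add
      ((hE.const_mul (τ * k ^ 3)).mul ((hasDerivAt_pdR dv).pow 2))).add
      ((hE.const_mul (τ * k)).mul ((hasDerivAt_pdR da).mul ((hasDerivAt_pdR dvs).pow 2)))).sub
      (((((hE.pow 3).const_mul (τ ^ 2 * k ^ 3)).add (hE.const_mul (lam ^ 2 * k))).const_mul
        τ).mul ((hasDerivAt_pdR dv).pow 2)))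
  rw [hS, hR, pdS_pdR_comm hv]
  simp only [Pi.mul_apply, Pi.pow_apply, Pi.add_apply]
  push_cast
  ring

/-- The conjugated function `exp (τ e^{kr}) w`. -/
def conjW (k τ : ℝ) (w : ℝ × ℝ → ℝ) (p : ℝ × ℝ) : ℝ := exp (τ * exp (k * p.2)) * w p

lemma contDiff_conjW {w : ℝ × ℝ → ℝ} (hw : ContDiff ℝ ∞ w) (k τ : ℝ) :
    ContDiff ℝ ∞ (conjW k τ w) :=
  ((contDiff_const.mul (contDiff_expk k)).exp).mul hw

lemma PerS.conjW {ℓ : ℝ} {w : ℝ × ℝ → ℝ} (hw : PerS ℓ w) (k τ : ℝ) :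
    PerS ℓ (conjW k τ w) := by
  intro s r
  simp only [_root_.conjW, hw s r]

lemma hasDerivAt_weight (k τ r : ℝ) :
    HasDerivAt (fun t => exp (τ * exp (k * t)))
      (exp (τ * exp (k * r)) * (τ * (exp (k * r) * (k * 1)))) r :=
  ((((hasDerivAt_id r).const_mul k).exp).const_mul τ).exp

lemma pdS_conjW {w : ℝ × ℝ → ℝ} (hw : ContDiff ℝ ∞ w) (k τ : ℝ) :
    pdS (conjW k τ w) = conjW k τ (pdS w) := by
  funext p
  exact pdS_eq_of_hasDerivAt ((contDiff_conjW hw k τ).differentiable (by simp) p)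
    ((hasDerivAt_pdS (hw.differentiable (by simp) p)).const_mul (exp (τ * exp (k * p.2))))

lemma pdR_conjW {w : ℝ × ℝ → ℝ} (hw : ContDiff ℝ ∞ w) (k τ : ℝ) (p : ℝ × ℝ) :
    pdR (conjW k τ w) p = exp (τ * exp (k * p.2)) * (pdR w p + τ * k * exp (k * p.2) * w p) := by
  rw [pdR_eq_of_hasDerivAt ((contDiff_conjW hw k τ).differentiable (by simp) p)
    ((hasDerivAt_weight k τ p.2).mul (hasDerivAt_pdR (hw.differentiable (by simp) p)))]
  ring

lemma pdR_pdR_conjW {w : ℝ × ℝ → ℝ} (hw : ContDiff ℝ ∞ w) (k τ : ℝ) (p : ℝ × ℝ) :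
    pdR (pdR (conjW k τ w)) p = exp (τ * exp (k * p.2)) *
      (pdR (pdR w) p + 2 * τ * k * exp (k * p.2) * pdR w p
        + (τ * k ^ 2 * exp (k * p.2) + τ ^ 2 * k ^ 2 * exp (k * p.2) ^ 2) * w p) := by
  have hE : HasDerivAt (fun t => exp (k * t)) (exp (k * p.2) * (k * 1)) p.2 :=
    ((hasDerivAt_id p.2).const_mul k).exp
  have h0 : (fun t => pdR (conjW k τ w) (p.1, t)) = fun t => exp (τ * exp (k * t)) *
      (pdR w (p.1, t) + τ * k * exp (k * t) * w (p.1, t)) := by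
    funext t
    rw [pdR_conjW hw]
  have h1 := (hasDerivAt_weight k τ p.2).fun_mul
      ((hasDerivAt_pdR ((contDiff_pdR hw).differentiable (by simp) p)).fun_add
        ((hE.const_mul (τ * k)).fun_mul (hasDerivAt_pdR (hw.differentiable (by simp) p))))
  rw [pdR_eq_of_hasDerivAt
    ((contDiff_pdR (contDiff_conjW hw k τ)).differentiable (by simp) p) (h0 ▸ h1)]
  ring

lemma sq_le_of_abs_le_three {B X Y W L z : ℝ} (hL : |L| ≤ B * (|X| + |Y| + |W|) + z) :
    L ^ 2 ≤ 4 * B ^ 2 * (X ^ 2 + Y ^ 2 + W ^ 2) + 4 * z ^ 2 := by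
  have h0 : L ^ 2 ≤ (B * |X| + B * |Y| + B * |W| + z) ^ 2 := sq_le_sq' (by
    have := neg_abs_le L; linarith) ((le_abs_self L).trans (by linarith))
  have h1 : ∀ x y u z : ℝ, (x + y + u + z) ^ 2 ≤ 4 * (x ^ 2 + y ^ 2 + u ^ 2) + 4 * z ^ 2 := by
    intro x y u z
    linarith [sq_nonneg (x - y), sq_nonneg (x - u), sq_nonneg (x - z), sq_nonneg (y - u),
      sq_nonneg (y - z), sq_nonneg (u - z)]
  have h2 := h1 (B * |X|) (B * |Y|) (B * |W|) z
  rw [mul_pow, mul_pow, mul_pow, sq_abs, sq_abs, sq_abs] at h2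
  linarith

lemma carleman_coeff {k t lam P : ℝ} (hk : 1 ≤ k ^ 2) (hP : 1 ≤ P) (ht : 10 * P ≤ t)
    (hlam : 3 * |lam| ≤ t) :
    P * (2 * t ^ 2 * k ^ 2 + 1) + t ^ 2 * k ^ 4 / 2 ≤
      t ^ 3 * k ^ 4 - k ^ 2 * t * lam ^ 2 - k ^ 4 * t := by
  have ht0 : 0 < t := by linarith
  have hk4 : k ^ 2 ≤ k ^ 4 := by
    have := mul_le_mul_of_nonneg_left hk (sq_nonneg k)
    linarith
  have hl : 9 * lam ^ 2 ≤ t ^ 2 := by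
    have := sq_le_sq' (by linarith [abs_nonneg lam]) hlam
    rw [mul_pow, sq_abs] at this
    linarith
  have ht2 : 100 ≤ t ^ 2 := by
    have : (10 : ℝ) ^ 2 ≤ t ^ 2 := by gcongr; linarith
    linarith
  have e1 : k ^ 2 * t * (9 * lam ^ 2) ≤ k ^ 4 * t * t ^ 2 := by gcongr
  have e2 : k ^ 4 * t * 100 ≤ k ^ 4 * t * t ^ 2 := by gcongr
  have e3 : t ^ 2 * k ^ 2 * (10 * P) ≤ t ^ 2 * k ^ 4 * t := by gcongr
  have e5 : t ^ 2 * k ^ 4 * 10 ≤ t ^ 2 * k ^ 4 * t := by gcongr; linarith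
  have e4 : 1 * (10 * P) ≤ k ^ 4 * t := by gcongr; linarith
  have e6 : 0 ≤ k ^ 4 * t := by positivity
  linarith

lemma carleman_algebra {k t H B a ar lam X Y W L z : ℝ} (hk : 1 ≤ k ^ 2)
    (hHB : 10 * (2 * B ^ 2 + 1) ≤ H) (ha : 2 * (2 * B ^ 2 + 1) ≤ H * a)
    (har : 2 * (k * ar) ≤ k ^ 2 * a) (ha0 : 0 < a)
    (htH : H ≤ t) (hlam : 3 * |lam| ≤ t)
    (hL : |L| ≤ B * (|X| + |Y| + |W|) + z) :
    X ^ 2 + Y ^ 2 + W ^ 2 + (L - t * k ^ 2 * W) ^ 2 / 4 ≤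
      3 * t * k ^ 2 * (X + t * k * W) ^ 2 + t * (k ^ 2 * a - k * ar) * Y ^ 2
        + (t ^ 3 * k ^ 4 - k ^ 2 * t * lam ^ 2 - k ^ 4 * t) * W ^ 2 + 2 * z ^ 2 := by
  have hL2 := sq_le_of_abs_le_three hL
  obtain ⟨P, hP⟩ : ∃ P, P = 2 * B ^ 2 + 1 := ⟨_, rfl⟩
  have hP1 : 1 ≤ P := by linarith [sq_nonneg B]
  rw [← hP] at hHB ha
  have ht0 : 0 < t := by linarith
  have hW2 := mul_le_mul_of_nonneg_right
    (carleman_coeff hk hP1 (hHB.trans htH) hlam) (sq_nonneg W)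
  obtain ⟨U, hU⟩ : ∃ U, U = X + t * k * W := ⟨_, rfl⟩
  have hX2 : X ^ 2 ≤ 2 * U ^ 2 + 2 * t ^ 2 * k ^ 2 * W ^ 2 := by
    have : X = U - t * k * W := by rw [hU]; ring
    rw [this]
    linarith [sq_nonneg (U + t * k * W)]
  have hPX := mul_le_mul_of_nonneg_left hX2 (by linarith : (0 : ℝ) ≤ P)
  have h1 : (L - t * k ^ 2 * W) ^ 2 / 4 ≤ L ^ 2 / 2 + t ^ 2 * k ^ 4 * W ^ 2 / 2 := by
    linarith [sq_nonneg (L + t * k ^ 2 * W)]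
  have hkt : t * 1 ≤ t * k ^ 2 := by gcongr
  have hU1 : 2 * P * U ^ 2 ≤ 3 * t * k ^ 2 * U ^ 2 := by
    have : 2 * P ≤ 3 * t * k ^ 2 := by linarith
    exact mul_le_mul_of_nonneg_right this (sq_nonneg U)
  have hY1 : P * Y ^ 2 ≤ t * (k ^ 2 * a - k * ar) * Y ^ 2 := by
    have h3 : t * a * 1 ≤ t * a * k ^ 2 := by gcongr
    have h4 : H * a ≤ t * a := mul_le_mul_of_nonneg_right htH ha0.le
    have h5 : t * (k ^ 2 * a / 2) ≤ t * (k ^ 2 * a - k * ar) :=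
      mul_le_mul_of_nonneg_left (by linarith) ht0.le
    have : P ≤ t * (k ^ 2 * a - k * ar) := by linarith
    exact mul_le_mul_of_nonneg_right this (sq_nonneg Y)
  have h6 : L ^ 2 / 2 ≤ (P - 1) * (X ^ 2 + Y ^ 2 + W ^ 2) + 2 * z ^ 2 := by
    rw [hP]; linarith
  rw [← hU]
  linarith

lemma carleman_pointwise {a w : ℝ × ℝ → ℝ} (ha : ContDiff ℝ ∞ a) (hw : ContDiff ℝ ∞ w)
    {k τ lam H B z : ℝ} {p : ℝ × ℝ} (hk : 1 ≤ k ^ 2)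
    (hHB : 10 * (2 * B ^ 2 + 1) ≤ H) (haH : 2 * (2 * B ^ 2 + 1) ≤ H * a p)
    (har : 2 * (k * pdR a p) ≤ k ^ 2 * a p) (ha0 : 0 < a p)
    (htH : H ≤ τ * exp (k * p.2)) (hlam : 3 * |lam| ≤ τ * exp (k * p.2))
    (hL : |pdR (pdR w) p + (pdS a p * pdS w p + a p * pdS (pdS w) p) + lam ^ 2 * w p|
      ≤ B * (|pdR w p| + |pdS w p| + |w p|) + z) :
    exp (τ * exp (k * p.2)) ^ 2 * (pdR w p ^ 2 + pdS w p ^ 2 + w p ^ 2)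
      + (pdS (fluxS k τ a (conjW k τ w)) p + pdR (fluxR k τ lam a (conjW k τ w)) p)
      ≤ 2 * (exp (τ * exp (k * p.2)) ^ 2 * z ^ 2) := by
  have hid := carleman_identity ha (contDiff_conjW hw k τ) k τ lam p
  have halg := carleman_algebra hk hHB haH har ha0 htH hlam hL
  rw [pdR_pdR_conjW hw, pdR_conjW hw, pdS_conjW hw, pdS_conjW (contDiff_pdS hw)] at hid
  simp only [conjW] at hid ⊢
  set E := exp (τ * exp (k * p.2)) with hE
  set Ψ := exp (k * p.2) with hΨ
  set D := pdS (fluxS k τ a (fun q => exp (τ * exp (k * q.2)) * w q)) p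
    + pdR (fluxR k τ lam a (fun q => exp (τ * exp (k * q.2)) * w q)) p with hD
  set L := pdR (pdR w) p + (pdS a p * pdS w p + a p * pdS (pdS w) p) + lam ^ 2 * w p with hLdef
  have hE0 : 0 ≤ E ^ 2 := sq_nonneg E
  have hamgm : ∀ x y : ℝ, x * y ≤ (x + y) ^ 2 / 4 := fun x y => by nlinarith [sq_nonneg (x - y)]
  have h2 := hid.le.trans (hamgm _ _)
  have h3 := mul_le_mul_of_nonneg_left halg hE0
  have h4 : D + (3 * τ * k ^ 2 * Ψ * (E * (pdR w p + τ * k * Ψ * w p)) ^ 2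
        + τ * Ψ * (k ^ 2 * a p - k * pdR a p) * (E * pdS w p) ^ 2
        + τ * (τ ^ 2 * k ^ 4 * Ψ ^ 3 - k ^ 2 * Ψ * lam ^ 2
          - k ^ 4 * Ψ) * (E * w p) ^ 2) ≤ E ^ 2 * ((L - (τ * Ψ) * k ^ 2 * w p) ^ 2 / 4) := by
    refine h2.trans (le_of_eq ?_)
    rw [hLdef]
    ring
  linarith [h3, h4]

/-- The energy density of a function in strip coordinates. -/
def den (f : ℝ × ℝ → ℝ) (p : ℝ × ℝ) : ℝ := pdR f p ^ 2 + pdS f p ^ 2 + f p ^ 2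

lemma den_nonneg (f : ℝ × ℝ → ℝ) (p : ℝ × ℝ) : 0 ≤ den f p := by unfold den; positivity

lemma continuous_den {f : ℝ × ℝ → ℝ} (hf : ContDiff ℝ ∞ f) : Continuous (den f) := by
  have h1 := (contDiff_pdS hf).continuous
  have h2 := (contDiff_pdR hf).continuous
  have h3 := hf.continuous
  unfold den
  fun_prop

/-- The operator `∂ᵣ² + ∂ₛ a ∂ₛ + λ²`. -/
def opL (a : ℝ × ℝ → ℝ) (lam : ℝ) (f : ℝ × ℝ → ℝ) (p : ℝ × ℝ) : ℝ :=
  pdR (pdR f) p + (pdS a p * pdS f p + a p * pdS (pdS f) p) + lam ^ 2 * f p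

/-- The square of the Carleman weight. -/
def wgt (k τ : ℝ) (r : ℝ) : ℝ := exp (τ * exp (k * r)) ^ 2

lemma wgt_pos (k τ r : ℝ) : 0 < wgt k τ r := by unfold wgt; positivity

lemma continuous_wgt (k τ : ℝ) : Continuous (fun p : ℝ × ℝ => wgt k τ p.2) := by
  unfold wgt
  fun_prop

lemma wgt_zero (k τ : ℝ) : wgt k τ 0 = exp (2 * τ) := by
  unfold wgt
  rw [mul_zero, exp_zero, mul_one, ← exp_nat_mul]
  norm_num

lemma wgt_eq (k τ r : ℝ) : wgt k τ r = exp (2 * (τ * exp (k * r))) := by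
  unfold wgt
  rw [← exp_nat_mul]
  norm_num

lemma wgt_anti {γ τ : ℝ} (hγ : 0 ≤ γ) (hτ : 0 ≤ τ) {r r' : ℝ} (h : r ≤ r') :
    wgt (-γ) τ r' ≤ wgt (-γ) τ r := by
  rw [wgt_eq, wgt_eq]
  have : γ * r ≤ γ * r' := by gcongr
  have : -γ * r' ≤ -γ * r := by linarith
  gcongr

lemma one_le_wgt {k τ : ℝ} (hτ : 0 ≤ τ) (r : ℝ) : 1 ≤ wgt k τ r := by
  rw [wgt_eq]
  exact one_le_exp (by positivity)

/-- Coefficients for which the Carleman estimate holds for both weights `exp (τ e^{± γ r})`. -/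
structure StripCoef (ℓ R : ℝ) (a : ℝ × ℝ → ℝ) (B γ τ₀ : ℝ) : Prop where
  one_le_γ : 1 ≤ γ
  one_le_τ₀ : 1 ≤ τ₀
  est : ∀ k, (k = γ ∨ k = -γ) → ∀ lam τ : ℝ, τ₀ * (1 + |lam|) ≤ τ →
    ∀ w z : ℝ × ℝ → ℝ, ContDiff ℝ ∞ w → PerS ℓ w → Continuous z →
      (∀ s, w (s, R) = 0 ∧ pdR w (s, R) = 0 ∧ pdS w (s, R) = 0) →
      (∀ p ∈ rect ℓ 0 R, |opL a lam w p| ≤ B * (|pdR w p| + |pdS w p| + |w p|) + z p) →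
      ∫ p in rect ℓ 0 R, wgt k τ p.2 * den w p ≤
        2 * (∫ p in rect ℓ 0 R, wgt k τ p.2 * z p ^ 2)
          + ∫ s in (0 : ℝ)..ℓ, fluxR k τ lam a (conjW k τ w) (s, 0)

lemma exists_stripCoef {ℓ R : ℝ} (hℓ : 0 < ℓ) (hR : 0 < R) {a : ℝ × ℝ → ℝ}
    (ha : ContDiff ℝ ∞ a) (hpa : PerS ℓ a) (hpos : ∀ p, 0 < a p) (B : ℝ) :
    ∃ γ τ₀, StripCoef ℓ R a B γ τ₀ := by
  have hne : (rect ℓ 0 R).Nonempty := ⟨(0, 0), mem_rect.2 ⟨⟨le_rfl, hℓ.le⟩, le_rfl, hR.le⟩⟩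
  obtain ⟨p₀, -, hp₀⟩ := (isCompact_rect ℓ 0 R).exists_isMinOn hne ha.continuous.continuousOn
  obtain ⟨M, hM⟩ := (isCompact_rect ℓ 0 R).exists_bound_of_continuousOn
    (contDiff_pdR ha).continuous.continuousOn
  have hm := hpos p₀
  have hM0 : 0 ≤ M := (norm_nonneg _).trans (hM _ hne.choose_spec)
  obtain ⟨γ, hγ⟩ : ∃ γ, γ = 1 + 2 * M / a p₀ := ⟨_, rfl⟩
  obtain ⟨H, hH⟩ : ∃ H, H = 10 * (2 * B ^ 2 + 1) + 2 * (2 * B ^ 2 + 1) / a p₀ := ⟨_, rfl⟩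
  have hB : 0 ≤ 2 * (2 * B ^ 2 + 1) / a p₀ := by positivity
  have hγ1 : 1 ≤ γ := by
    have : 0 ≤ 2 * M / a p₀ := by positivity
    linarith
  have hH1 : 10 ≤ H := by
    have : 0 ≤ B ^ 2 := sq_nonneg B
    linarith
  have heR : 1 ≤ exp (γ * R) := one_le_exp (by positivity)
  refine ⟨γ, (H + 3) * exp (γ * R), hγ1, by nlinarith, ?_⟩
  intro k hk lam τ hτ w z hw hpw hz hend hL
  have hk2 : k ^ 2 = γ ^ 2 := by rcases hk with rfl | rfl <;> ring
  have hkabs : |k| = γ := by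
    rcases hk with rfl | rfl
    · exact abs_of_nonneg (by linarith)
    · rw [abs_neg]; exact abs_of_nonneg (by linarith)
  have key : ∀ p ∈ rect ℓ 0 R, wgt k τ p.2 * den w p
      + (pdS (fluxS k τ a (conjW k τ w)) p + pdR (fluxR k τ lam a (conjW k τ w)) p)
      ≤ 2 * (wgt k τ p.2 * z p ^ 2) := by
    intro p hp
    have hap : a p₀ ≤ a p := hp₀ hp
    have hw1 : H + 3 + (H + 3) * |lam| ≤ τ * exp (k * p.2) := by
      have h1 : exp (-(γ * R)) ≤ exp (k * p.2) := by
        rw [exp_le_exp]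
        have h2 := (mem_rect.1 hp).2
        have h3 : |k * p.2| ≤ γ * R := by
          rw [abs_mul, hkabs, abs_of_nonneg h2.1]
          have := h2.2
          gcongr
        linarith [neg_abs_le (k * p.2)]
      calc H + 3 + (H + 3) * |lam|
          = (H + 3) * exp (γ * R) * (1 + |lam|) * exp (-(γ * R)) := by
            rw [exp_neg]; field_simp
        _ ≤ τ * exp (k * p.2) := by
            gcongr
            exact le_trans (by positivity) hτ
    have hl0 := abs_nonneg lam
    have hHl : 0 ≤ H * |lam| := by positivity
    refine carleman_pointwise ha hw (by nlinarith) (B := B) (H := H) (by linarith) ?_ ?_ (hpos p)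
      (by linarith) (by linarith) (hL p hp)
    · calc 2 * (2 * B ^ 2 + 1) = 2 * (2 * B ^ 2 + 1) / a p₀ * a p₀ := by field_simp
        _ ≤ H * a p := by
            gcongr
            have : 0 ≤ B ^ 2 := sq_nonneg B
            linarith
    · have h1 : k * pdR a p ≤ γ * M := by
        calc k * pdR a p ≤ |k * pdR a p| := le_abs_self _
          _ = γ * |pdR a p| := by rw [abs_mul, hkabs]
          _ ≤ γ * M := by gcongr; exact hM p hp
      have h2 : 2 * M ≤ γ * a p₀ := by rw [hγ, add_mul, div_mul_cancel₀ _ hm.ne']; linarith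
      rw [hk2]
      calc 2 * (k * pdR a p) ≤ γ * (2 * M) := by linarith
        _ ≤ γ * (γ * a p) := mul_le_mul_of_nonneg_left
            (h2.trans (mul_le_mul_of_nonneg_left hap (by linarith))) (by linarith)
        _ = γ ^ 2 * a p := by ring
  have hv := contDiff_conjW hw k τ
  have hpv := hpw.conjW k τ
  have hFS := contDiff_fluxS ha hv k τ
  have hFR := contDiff_fluxR ha hv k τ lam
  have hdiv := integral_div_rect hℓ.le hR.le hFS hFR (hpa.fluxS hpv k τ)
  have c1 : Continuous (fun p : ℝ × ℝ => wgt k τ p.2 * den w p) :=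
    (continuous_wgt k τ).mul (continuous_den hw)
  have c2 : Continuous (fun p => pdS (fluxS k τ a (conjW k τ w)) p
      + pdR (fluxR k τ lam a (conjW k τ w)) p) :=
    (contDiff_pdS hFS).continuous.add (contDiff_pdR hFR).continuous
  have c3 : Continuous (fun p : ℝ × ℝ => wgt k τ p.2 * z p ^ 2) :=
    (continuous_wgt k τ).mul (hz.pow 2)
  have hint := setIntegral_mono_on (Continuous.integrableOn_rect (c1.add c2) ℓ 0 R)
    (Continuous.integrableOn_rect (c3.const_mul 2) ℓ 0 R) (measurableSet_rect ℓ 0 R) key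
  rw [integral_const_mul] at hint
  simp only [Pi.add_apply] at hint
  have hadd := integral_add (c1.integrableOn_rect ℓ 0 R) (c2.integrableOn_rect ℓ 0 R)
  have hzero : ∀ s, fluxR k τ lam a (conjW k τ w) (s, R) = 0 := by
    intro s
    obtain ⟨h1, h2, h3⟩ := hend s
    simp [fluxR, pdR_conjW hw, pdS_conjW hw, conjW, h1, h2, h3]
  simp only [hzero, intervalIntegral.integral_zero] at hdiv
  linarith

/-- Multiplication by a cutoff depending on the transversal variable. -/
def cutF (χ : ℝ → ℝ) (f : ℝ × ℝ → ℝ) (p : ℝ × ℝ) : ℝ := χ p.2 * f p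

section cut
variable {χ : ℝ → ℝ} {f : ℝ × ℝ → ℝ}

lemma contDiff_cutF (hχ : ContDiff ℝ ∞ χ) (hf : ContDiff ℝ ∞ f) : ContDiff ℝ ∞ (cutF χ f) :=
  (hχ.comp contDiff_snd).mul hf

lemma PerS.cutF {ℓ : ℝ} (hf : PerS ℓ f) : PerS ℓ (cutF χ f) := by
  intro s r
  simp only [_root_.cutF, hf s r]

lemma pdS_cutF (hχ : ContDiff ℝ ∞ χ) (hf : ContDiff ℝ ∞ f) :
    pdS (cutF χ f) = cutF χ (pdS f) := by
  funext p
  exact pdS_eq_of_hasDerivAt ((contDiff_cutF hχ hf).differentiable (by simp) p)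
    ((hasDerivAt_pdS (hf.differentiable (by simp) p)).const_mul (χ p.2))

lemma pdR_cutF (hχ : ContDiff ℝ ∞ χ) (hf : ContDiff ℝ ∞ f) (p : ℝ × ℝ) :
    pdR (cutF χ f) p = deriv χ p.2 * f p + χ p.2 * pdR f p :=
  pdR_eq_of_hasDerivAt ((contDiff_cutF hχ hf).differentiable (by simp) p)
    ((hχ.differentiable (by simp) p.2).hasDerivAt.mul
      (hasDerivAt_pdR (hf.differentiable (by simp) p)))

lemma contDiff_deriv_infty (hχ : ContDiff ℝ ∞ χ) : ContDiff ℝ ∞ (deriv χ) :=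
  (contDiff_infty_iff_deriv.1 hχ).2

lemma pdR_pdR_cutF (hχ : ContDiff ℝ ∞ χ) (hf : ContDiff ℝ ∞ f) (p : ℝ × ℝ) :
    pdR (pdR (cutF χ f)) p =
      deriv (deriv χ) p.2 * f p + 2 * (deriv χ p.2 * pdR f p) + χ p.2 * pdR (pdR f) p := by
  have h : pdR (cutF χ f) = fun p => cutF (deriv χ) f p + cutF χ (pdR f) p := by
    funext p
    rw [pdR_cutF hχ hf]
    rfl
  have h1 := contDiff_cutF (contDiff_deriv_infty hχ) hf
  have h2 := contDiff_cutF hχ (contDiff_pdR hf)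
  rw [h, pdR_eq_of_hasDerivAt ((h1.add h2).differentiable (by simp) p)
    ((hasDerivAt_pdR (h1.differentiable (by simp) p)).add
      (hasDerivAt_pdR (h2.differentiable (by simp) p))),
    pdR_cutF (contDiff_deriv_infty hχ) hf, pdR_cutF hχ (contDiff_pdR hf)]
  ring

lemma den_cutF_of_eq_one (hχ : ContDiff ℝ ∞ χ) (hf : ContDiff ℝ ∞ f) {p : ℝ × ℝ}
    (h1 : χ p.2 = 1) (h2 : deriv χ p.2 = 0) : den (cutF χ f) p = den f p := by
  simp [den, pdR_cutF hχ hf, pdS_cutF hχ hf, cutF, h1, h2]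

/-- The error term produced by the cutoff. -/
def cutErr (B : ℝ) (χ : ℝ → ℝ) (f : ℝ × ℝ → ℝ) (p : ℝ × ℝ) : ℝ :=
  |deriv χ p.2| * (B * |f p| + 2 * |pdR f p|) + |deriv (deriv χ) p.2| * |f p|

lemma continuous_cutErr (B : ℝ) (hχ : ContDiff ℝ ∞ χ) (hf : ContDiff ℝ ∞ f) :
    Continuous (cutErr B χ f) := by
  have h1 := (contDiff_deriv_infty hχ).continuous
  have h2 := (contDiff_deriv_infty (contDiff_deriv_infty hχ)).continuous
  have h3 := hf.continuous
  have h4 := (contDiff_pdR hf).continuous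
  unfold cutErr
  fun_prop

lemma opL_cutF (hχ : ContDiff ℝ ∞ χ) (hf : ContDiff ℝ ∞ f) {a : ℝ × ℝ → ℝ} {lam B : ℝ}
    (hB : 0 ≤ B) {p : ℝ × ℝ} (hL : |opL a lam f p| ≤ B * (|pdR f p| + |pdS f p| + |f p|)) :
    |opL a lam (cutF χ f) p| ≤
      B * (|pdR (cutF χ f) p| + |pdS (cutF χ f) p| + |cutF χ f p|) + cutErr B χ f p := by
  have e : opL a lam (cutF χ f) p = χ p.2 * opL a lam f p
      + (2 * (deriv χ p.2 * pdR f p) + deriv (deriv χ) p.2 * f p) := by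
    unfold opL
    rw [pdR_pdR_cutF hχ hf, pdS_cutF hχ hf, pdS_cutF hχ (contDiff_pdS hf)]
    unfold cutF
    ring
  have e1 : |χ p.2| * |pdR f p| ≤ |pdR (cutF χ f) p| + |deriv χ p.2| * |f p| := by
    rw [← abs_mul, ← abs_mul]
    have : χ p.2 * pdR f p = pdR (cutF χ f) p - deriv χ p.2 * f p := by
      rw [pdR_cutF hχ hf]; ring
    rw [this]
    exact abs_sub _ _
  have e2 : |pdS (cutF χ f) p| = |χ p.2| * |pdS f p| := by
    rw [pdS_cutF hχ hf, ← abs_mul]; rfl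
  have e3 : |cutF χ f p| = |χ p.2| * |f p| := abs_mul _ _
  have e4 : |opL a lam (cutF χ f) p| ≤ |χ p.2| * |opL a lam f p|
      + (2 * (|deriv χ p.2| * |pdR f p|) + |deriv (deriv χ) p.2| * |f p|) := by
    rw [e]
    refine (abs_add_le _ _).trans ?_
    rw [abs_mul]
    gcongr
    refine (abs_add_le _ _).trans ?_
    rw [abs_mul, abs_mul, abs_mul, abs_two]
  have e5 := mul_le_mul_of_nonneg_left hL (abs_nonneg (χ p.2))
  have e6 := mul_le_mul_of_nonneg_left e1 hB
  unfold cutErr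
  rw [e2, e3]
  linarith

end cut

lemma two_cutErr_sq_le {B Q : ℝ} (hB : 0 ≤ B) {χ : ℝ → ℝ} {f : ℝ × ℝ → ℝ} {p : ℝ × ℝ}
    (h1 : |deriv χ p.2| ≤ Q) (h2 : |deriv (deriv χ) p.2| ≤ Q) :
    2 * cutErr B χ f p ^ 2 ≤ (4 * Q ^ 2 * ((B + 1) ^ 2 + 4)) * den f p := by
  have hQ : 0 ≤ Q := (abs_nonneg _).trans h1
  have e1 : cutErr B χ f p ≤ Q * (B * |f p| + 2 * |pdR f p|) + Q * |f p| := by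
    unfold cutErr
    gcongr
  have e0 : 0 ≤ cutErr B χ f p := by unfold cutErr; positivity
  have e2 : cutErr B χ f p ^ 2 ≤ (Q * ((B + 1) * |f p| + 2 * |pdR f p|)) ^ 2 := by
    gcongr
    linarith
  have e3 : ((B + 1) * |f p| + 2 * |pdR f p|) ^ 2 ≤ 2 * ((B + 1) ^ 2 * f p ^ 2 + 4 * pdR f p ^ 2) := by
    have := sq_nonneg ((B + 1) * |f p| - 2 * |pdR f p|)
    rw [← sq_abs (f p), ← sq_abs (pdR f p)]
    linarith
  have e4 : (B + 1) ^ 2 * f p ^ 2 + 4 * pdR f p ^ 2 ≤ ((B + 1) ^ 2 + 4) * den f p := by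
    unfold den
    have : 0 ≤ ((B + 1) ^ 2 + 4) * pdS f p ^ 2 + 4 * f p ^ 2 + (B + 1) ^ 2 * pdR f p ^ 2 := by
      positivity
    linarith
  rw [mul_pow] at e2
  have e5 := mul_le_mul_of_nonneg_left (e3.trans (mul_le_mul_of_nonneg_left e4 (by norm_num)))
    (sq_nonneg Q)
  linarith

lemma StripCoef.cut {ℓ R B γ τ₀ : ℝ} {a : ℝ × ℝ → ℝ} (h : StripCoef ℓ R a B γ τ₀) (hB : 0 ≤ B)
    {χ : ℝ → ℝ} (hχ : ContDiff ℝ ∞ χ) (h0 : χ R = 0) (h1 : deriv χ R = 0)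
    {T : Set (ℝ × ℝ)} (hT : MeasurableSet T) (hTR : T ⊆ rect ℓ 0 R)
    (hχT : ∀ p ∈ rect ℓ 0 R, p ∉ T → deriv χ p.2 = 0 ∧ deriv (deriv χ) p.2 = 0) :
    ∃ K, 0 ≤ K ∧ ∀ k, (k = γ ∨ k = -γ) → ∀ lam τ : ℝ, τ₀ * (1 + |lam|) ≤ τ →
      ∀ f : ℝ × ℝ → ℝ, ContDiff ℝ ∞ f → PerS ℓ f →
      (∀ p ∈ rect ℓ 0 R, |opL a lam f p| ≤ B * (|pdR f p| + |pdS f p| + |f p|)) →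
      ∫ p in rect ℓ 0 R, wgt k τ p.2 * den (cutF χ f) p ≤
        K * (∫ p in T, wgt k τ p.2 * den f p)
          + ∫ s in (0 : ℝ)..ℓ, fluxR k τ lam a (conjW k τ (cutF χ f)) (s, 0) := by
  obtain ⟨Q₁, hQ₁⟩ := isCompact_Icc.exists_bound_of_continuousOn (s := Set.Icc 0 R)
    (contDiff_deriv_infty hχ).continuous.continuousOn
  obtain ⟨Q₂, hQ₂⟩ := isCompact_Icc.exists_bound_of_continuousOn (s := Set.Icc 0 R)
    (contDiff_deriv_infty (contDiff_deriv_infty hχ)).continuous.continuousOn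
  refine ⟨4 * (max Q₁ Q₂) ^ 2 * ((B + 1) ^ 2 + 4), by positivity, ?_⟩
  intro k hk lam τ hτ f hf hpf hL
  have hc : Continuous (fun p : ℝ × ℝ => 2 * (wgt k τ p.2 * cutErr B χ f p ^ 2)) :=
    (((continuous_wgt k τ).mul ((continuous_cutErr B hχ hf).pow 2)).const_mul 2)
  have hcd : Continuous (fun p : ℝ × ℝ => wgt k τ p.2 * den f p) :=
    (continuous_wgt k τ).mul (continuous_den hf)
  refine (h.est k hk lam τ hτ (cutF χ f) (cutErr B χ f) (contDiff_cutF hχ hf) hpf.cutF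
    (continuous_cutErr B hχ hf) ?_ ?_).trans ?_
  · intro s
    refine ⟨by simp [cutF, h0], by simp [pdR_cutF hχ hf, h0, h1], ?_⟩
    rw [pdS_cutF hχ hf]
    simp [cutF, h0]
  · intro p hp
    exact opL_cutF hχ hf hB (hL p hp)
  · refine add_le_add ?_ le_rfl
    rw [← integral_const_mul, ← integral_const_mul]
    have hsub := setIntegral_eq_of_subset_of_forall_sdiff_eq_zero (measurableSet_rect ℓ 0 R) hTR
      (μ := volume) (f := fun p : ℝ × ℝ => 2 * (wgt k τ p.2 * cutErr B χ f p ^ 2)) (by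
        intro p hp
        obtain ⟨h3, h4⟩ := hχT p hp.1 hp.2
        simp [cutErr, h3, h4])
    rw [hsub]
    · refine setIntegral_mono_on ((hc.integrableOn_rect ℓ 0 R).mono_set hTR)
        (((hcd.const_mul _).integrableOn_rect ℓ 0 R).mono_set hTR) hT ?_
      intro p hp
      have hp2 := (mem_rect.1 (hTR hp)).2
      have := two_cutErr_sq_le hB (f := f) ((hQ₁ p.2 hp2).trans (le_max_left Q₁ Q₂))
        ((hQ₂ p.2 hp2).trans (le_max_right Q₁ Q₂))
      have := mul_le_mul_of_nonneg_left this (wgt_pos k τ p.2).le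
      linarith

lemma deriv_eq_zero_of_const_on {χ : ℝ → ℝ} {U : Set ℝ} (hU : IsOpen U) {c : ℝ}
    (h : ∀ r ∈ U, χ r = c) : ∀ r ∈ U, deriv χ r = 0 ∧ deriv (deriv χ) r = 0 := by
  have h1 : ∀ r ∈ U, deriv χ r = 0 := by
    intro r hr
    have : χ =ᶠ[nhds r] fun _ => c := by
      filter_upwards [hU.mem_nhds hr] with t ht using h t ht
    rw [this.deriv_eq, deriv_const]
  intro r hr
  refine ⟨h1 r hr, ?_⟩
  have : deriv χ =ᶠ[nhds r] fun _ => 0 := by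
    filter_upwards [hU.mem_nhds hr] with t ht using h1 t ht
  rw [this.deriv_eq, deriv_const]

/-- A smooth cutoff equal to `1` below `b` and to `0` above `b'`. -/
def cutOut (b b' : ℝ) (r : ℝ) : ℝ := smoothTransition ((b' - r) / (b' - b))

section cutOut
variable {b b' : ℝ}

lemma contDiff_cutOut (b b' : ℝ) : ContDiff ℝ ∞ (cutOut b b') :=
  Real.smoothTransition.contDiff.comp ((contDiff_const.sub contDiff_id).div_const _)

lemma cutOut_eq_one (h : b < b') {r : ℝ} (hr : r ≤ b) : cutOut b b' r = 1 :=
  Real.smoothTransition.one_of_one_le (by rw [le_div_iff₀ (by linarith)]; linarith)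

lemma cutOut_eq_zero (h : b < b') {r : ℝ} (hr : b' ≤ r) : cutOut b b' r = 0 :=
  Real.smoothTransition.zero_of_nonpos (div_nonpos_of_nonpos_of_nonneg (by linarith) (by linarith))

lemma deriv_cutOut_below (h : b < b') {r : ℝ} (hr : r < b) :
    deriv (cutOut b b') r = 0 ∧ deriv (deriv (cutOut b b')) r = 0 :=
  deriv_eq_zero_of_const_on (U := Set.Iio b) isOpen_Iio (c := 1)
    (fun t (ht : t < b) => cutOut_eq_one h ht.le) r hr

lemma deriv_cutOut_above (h : b < b') {r : ℝ} (hr : b' < r) :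
    deriv (cutOut b b') r = 0 ∧ deriv (deriv (cutOut b b')) r = 0 :=
  deriv_eq_zero_of_const_on (U := Set.Ioi b') isOpen_Ioi (c := 0)
    (fun t (ht : b' < t) => cutOut_eq_zero h ht.le) r hr

end cutOut

/-- A smooth periodic function on the strip satisfying the differential inequality to which
Carleman estimates apply. -/
structure StripSol (ℓ R : ℝ) (a : ℝ × ℝ → ℝ) (B lam : ℝ) (f : ℝ × ℝ → ℝ) : Prop where
  smooth : ContDiff ℝ ∞ f
  per : PerS ℓ f
  ineq : ∀ p ∈ rect ℓ 0 R, |opL a lam f p| ≤ B * (|pdR f p| + |pdS f p| + |f p|)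

lemma fluxR_data_le {γ τ lam : ℝ} (hγ : 1 ≤ γ) (hτ : 1 ≤ τ) (hlam : |lam| ≤ τ)
    {a w : ℝ × ℝ → ℝ} (hw : ContDiff ℝ ∞ w) {s : ℝ} (ha : 0 ≤ a (s, 0)) :
    fluxR (-γ) τ lam a (conjW (-γ) τ w) (s, 0) ≤
      840 * γ ^ 5 * exp (3 * τ) * (w (s, 0) ^ 2 + pdR w (s, 0) ^ 2) := by
  have hl2 : lam ^ 2 ≤ τ ^ 2 := by rw [← sq_abs]; gcongr
  have hE : exp τ ^ 2 * τ ^ 5 ≤ 120 * exp (3 * τ) := by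
    have h1 := Real.pow_div_factorial_le_exp τ (by linarith) 5
    have h2 : τ ^ 5 ≤ 120 * exp τ := by
      rw [div_le_iff₀ (by positivity)] at h1
      norm_num [Nat.factorial] at h1
      linarith
    have h3 : exp (3 * τ) = exp τ ^ 2 * exp τ := by
      rw [← pow_succ, ← exp_nat_mul]; norm_num
    rw [h3]
    nlinarith [sq_nonneg (exp τ)]
  have h0 : fluxR (-γ) τ lam a (conjW (-γ) τ w) (s, 0) = exp τ ^ 2 *
      (τ * γ * (pdR w (s, 0) - τ * γ * w (s, 0)) ^ 2
      - 2 * τ * γ ^ 2 * (w (s, 0) * (pdR w (s, 0) - τ * γ * w (s, 0)))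
      - τ * γ ^ 3 * w (s, 0) ^ 2 - τ * γ * (a (s, 0) * pdS w (s, 0) ^ 2)
      + τ * (τ ^ 2 * γ ^ 3 + lam ^ 2 * γ) * w (s, 0) ^ 2) := by
    unfold fluxR
    rw [pdR_conjW hw, pdS_conjW hw]
    simp only [conjW, mul_zero, exp_zero, mul_one]
    ring
  rw [h0]
  generalize pdR w (s, 0) = x
  generalize w (s, 0) = y
  generalize pdS w (s, 0) = u
  have hu : 0 ≤ τ * γ * (a (s, 0) * u ^ 2) := by positivity
  obtain ⟨v, hv⟩ : ∃ v, v = x - τ * γ * y := ⟨_, rfl⟩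
  rw [← hv]
  have g2 : γ ≤ γ ^ 2 := by nlinarith
  have g3 : γ ^ 2 ≤ γ ^ 3 := by nlinarith [sq_nonneg γ]
  have t3 : τ ≤ τ ^ 3 := by nlinarith [sq_nonneg τ]
  have hv2 : v ^ 2 ≤ 2 * x ^ 2 + 2 * (τ ^ 2 * γ ^ 2) * y ^ 2 := by
    rw [hv]; linarith [sq_nonneg (x + τ * γ * y)]
  have m1 : τ * γ * v ^ 2 ≤ τ ^ 3 * γ ^ 3 * v ^ 2 := by
    have : γ ≤ γ ^ 3 := g2.trans g3
    gcongr
  have m2 : -(2 * τ * γ ^ 2 * (y * v)) ≤ τ ^ 3 * γ ^ 3 * (y ^ 2 + v ^ 2) := by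
    have h1 : τ * γ ^ 2 * (y ^ 2 + v ^ 2) ≤ τ ^ 3 * γ ^ 3 * (y ^ 2 + v ^ 2) := by gcongr
    have h2 : 0 ≤ τ * γ ^ 2 * (y + v) ^ 2 := by positivity
    linarith
  have m3 : τ * (τ ^ 2 * γ ^ 3 + lam ^ 2 * γ) * y ^ 2 ≤ 2 * (τ ^ 3 * γ ^ 3) * y ^ 2 := by
    have h1 : τ * lam ^ 2 * γ ≤ τ * τ ^ 2 * γ ^ 3 := by
      have : γ ≤ γ ^ 3 := g2.trans g3
      gcongr
    have h2 := mul_le_mul_of_nonneg_right h1 (sq_nonneg y)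
    linarith
  have m4 : 0 ≤ τ * γ ^ 3 * y ^ 2 := by positivity
  have m5 : τ ^ 3 * γ ^ 3 * 1 ≤ τ ^ 3 * γ ^ 3 * (τ ^ 2 * γ ^ 2) := by
    gcongr
    nlinarith
  have m6 : τ ^ 3 * γ ^ 3 * v ^ 2 ≤ τ ^ 3 * γ ^ 3 * (2 * x ^ 2 + 2 * (τ ^ 2 * γ ^ 2) * y ^ 2) := by
    gcongr
  have m7 := mul_le_mul_of_nonneg_right m5 (sq_nonneg x)
  have m8 := mul_le_mul_of_nonneg_right m5 (sq_nonneg y)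
  have m9 : 0 ≤ τ ^ 3 * γ ^ 3 * (τ ^ 2 * γ ^ 2) * x ^ 2 := by positivity
  calc exp τ ^ 2 * _ ≤ exp τ ^ 2 * (7 * (τ ^ 5 * γ ^ 5) * (y ^ 2 + x ^ 2)) := by
        apply mul_le_mul_of_nonneg_left _ (sq_nonneg _)
        linarith
    _ = (exp τ ^ 2 * τ ^ 5) * (7 * γ ^ 5 * (y ^ 2 + x ^ 2)) := by ring
    _ ≤ (120 * exp (3 * τ)) * (7 * γ ^ 5 * (y ^ 2 + x ^ 2)) := by gcongr
    _ = _ := by ring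

lemma integral_wgt_le {T : Set (ℝ × ℝ)} (hT : IsCompact T) {k τ W : ℝ}
    (h : ∀ p ∈ T, wgt k τ p.2 ≤ W) {f : ℝ × ℝ → ℝ} (hf : ContDiff ℝ ∞ f) :
    ∫ p in T, wgt k τ p.2 * den f p ≤ W * ∫ p in T, den f p := by
  have hd := continuous_den hf
  rw [← integral_const_mul]
  refine setIntegral_mono_on
    (((continuous_wgt k τ).mul hd).continuousOn.integrableOn_compact hT)
    ((hd.const_mul W).continuousOn.integrableOn_compact hT) hT.measurableSet ?_
  intro p hp
  exact mul_le_mul_of_nonneg_right (h p hp) (den_nonneg f p)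

lemma le_integral_wgt {S T : Set (ℝ × ℝ)} (hS : IsCompact S) (hT : IsCompact T) (hST : S ⊆ T)
    {k τ W : ℝ} (h : ∀ p ∈ S, W ≤ wgt k τ p.2) {f w : ℝ × ℝ → ℝ} (hf : ContDiff ℝ ∞ f)
    (hw : ContDiff ℝ ∞ w) (hfw : ∀ p ∈ S, den w p = den f p) :
    W * ∫ p in S, den f p ≤ ∫ p in T, wgt k τ p.2 * den w p := by
  have hd := continuous_den hf
  have hc := (continuous_wgt k τ).mul (continuous_den hw)
  rw [← integral_const_mul]
  calc ∫ p in S, W * den f p ≤ ∫ p in S, wgt k τ p.2 * den w p := by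
        refine setIntegral_mono_on ((hd.const_mul W).continuousOn.integrableOn_compact hS)
          (hc.continuousOn.integrableOn_compact hS) hS.measurableSet ?_
        intro p hp
        rw [hfw p hp]
        exact mul_le_mul_of_nonneg_right (h p hp) (den_nonneg f p)
    _ ≤ _ := by
        refine setIntegral_mono_set (hc.continuousOn.integrableOn_compact hT) ?_ hST.eventuallyLE
        exact Filter.Eventually.of_forall fun p => mul_nonneg (wgt_pos _ _ _).le (den_nonneg w p)

lemma integral_den_mono {S T : Set (ℝ × ℝ)} (hT : IsCompact T) (hST : S ⊆ T) {f : ℝ × ℝ → ℝ}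
    (hf : ContDiff ℝ ∞ f) : ∫ p in S, den f p ≤ ∫ p in T, den f p :=
  setIntegral_mono_set ((continuous_den hf).continuousOn.integrableOn_compact hT)
    (Filter.Eventually.of_forall (den_nonneg f)) hST.eventuallyLE

lemma integral_den_nonneg (T : Set (ℝ × ℝ)) (f : ℝ × ℝ → ℝ) : 0 ≤ ∫ p in T, den f p :=
  integral_nonneg (den_nonneg f)

section estimates
variable {ℓ R B γ τ₀ : ℝ} {a : ℝ × ℝ → ℝ}

lemma StripCoef.one_le_tau (h : StripCoef ℓ R a B γ τ₀) {lam τ : ℝ}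
    (hτ : τ₀ * (1 + |lam|) ≤ τ) : 1 + |lam| ≤ τ := by
  have := h.one_le_τ₀
  nlinarith [abs_nonneg lam]

lemma StripCoef.data (h : StripCoef ℓ R a B γ τ₀) (hℓ : 0 < ℓ) (hR : 0 < R) (hB : 0 ≤ B)
    (ha : ∀ p, 0 < a p) :
    ∃ δ > 0, ∃ C, 0 ≤ C ∧ ∀ lam τ : ℝ, τ₀ * (1 + |lam|) ≤ τ → ∀ f, StripSol ℓ R a B lam f →
      ∫ p in rect ℓ 0 (R / 4), den f p ≤ C * exp (-(δ * τ)) * (∫ p in rect ℓ 0 R, den f p)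
        + C * exp (3 * τ) * ∫ s in (0 : ℝ)..ℓ, (f (s, 0) ^ 2 + pdR f (s, 0) ^ 2) := by
  have hb : R / 2 < 3 * R / 4 := by linarith
  have hχ := contDiff_cutOut (R / 2) (3 * R / 4)
  have hTR : rect ℓ (R / 2) (3 * R / 4) ⊆ rect ℓ 0 R := rect_subset (by linarith) (by linarith)
  obtain ⟨K, hK, hcut⟩ := h.cut hB hχ (cutOut_eq_zero hb (by linarith))
    (deriv_cutOut_above hb (by linarith)).1 (measurableSet_rect _ _ _) hTR (by
      intro p hp hpT
      rw [mem_rect] at hp hpT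
      by_cases h1 : p.2 < R / 2
      · exact deriv_cutOut_below hb h1
      · refine deriv_cutOut_above hb ?_
        by_contra h2
        exact hpT ⟨hp.1, not_lt.1 h1, not_lt.1 h2⟩)
  have hγ := h.one_le_γ
  obtain ⟨δ, hδ⟩ : ∃ δ, δ = 2 * exp (-γ * (R / 4)) - 2 * exp (-γ * (R / 2)) := ⟨_, rfl⟩
  refine ⟨δ, ?_, max K (840 * γ ^ 5), le_max_of_le_left hK, ?_⟩
  · have : exp (-γ * (R / 2)) < exp (-γ * (R / 4)) := by
      rw [exp_lt_exp]; nlinarith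
    simp only [gt_iff_lt]
    linarith
  intro lam τ hτ f hf
  have hτ1 := h.one_le_tau hτ
  have hl0 := abs_nonneg lam
  have h1 := hcut (-γ) (Or.inr rfl) lam τ hτ f hf.smooth hf.per hf.ineq
  have hw := contDiff_cutF hχ hf.smooth
  have h2 := integral_wgt_le (isCompact_rect ℓ (R / 2) (3 * R / 4)) (k := -γ) (τ := τ)
    (W := wgt (-γ) τ (R / 2)) (fun p hp => wgt_anti (by linarith) (by linarith)
      (mem_rect.1 hp).2.1) hf.smooth
  have h3 := le_integral_wgt (isCompact_rect ℓ 0 (R / 4)) (isCompact_rect ℓ 0 R)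
    (rect_subset le_rfl (by linarith)) (k := -γ) (τ := τ)
    (W := wgt (-γ) τ (R / 4)) (fun p hp => wgt_anti (by linarith) (by linarith)
      (mem_rect.1 hp).2.2) hf.smooth hw (fun p hp => by
        have := (mem_rect.1 hp).2.2
        exact den_cutF_of_eq_one hχ hf.smooth (cutOut_eq_one hb (by linarith))
          (deriv_cutOut_below hb (by linarith)).1)
  have c0 : Continuous fun s : ℝ => (s, (0 : ℝ)) := by fun_prop
  have hcf := hf.smooth.continuous.comp c0
  have hcr := (contDiff_pdR hf.smooth).continuous.comp c0
  have h4 : ∫ s in (0 : ℝ)..ℓ, fluxR (-γ) τ lam a (conjW (-γ) τ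
      (cutF (cutOut (R / 2) (3 * R / 4)) f)) (s, 0) ≤
      840 * γ ^ 5 * exp (3 * τ) * ∫ s in (0 : ℝ)..ℓ, (f (s, 0) ^ 2 + pdR f (s, 0) ^ 2) := by
    rw [← intervalIntegral.integral_const_mul]
    have hpt : ∀ s, fluxR (-γ) τ lam a (conjW (-γ) τ
        (cutF (cutOut (R / 2) (3 * R / 4)) f)) (s, 0) ≤
        840 * γ ^ 5 * exp (3 * τ) * (f (s, 0) ^ 2 + pdR f (s, 0) ^ 2) := by
      intro s
      have := fluxR_data_le hγ (by linarith) (by linarith : |lam| ≤ τ) hw (ha (s, 0)).le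
      rw [pdR_cutF hχ hf.smooth] at this
      simpa [cutF, cutOut_eq_one hb (by linarith : 0 ≤ R / 2),
        (deriv_cutOut_below hb (by linarith : 0 < R / 2)).1] using this
    by_cases hint : IntervalIntegrable (fun s => fluxR (-γ) τ lam a (conjW (-γ) τ
      (cutF (cutOut (R / 2) (3 * R / 4)) f)) (s, 0)) volume 0 ℓ
    · exact intervalIntegral.integral_mono_on hℓ.le hint
        ((((hcf.pow 2).add (hcr.pow 2)).const_mul _).intervalIntegrable _ _) (fun s _ => hpt s)
    · rw [intervalIntegral.integral_undef hint]
      exact intervalIntegral.integral_nonneg hℓ.le fun s _ => by positivity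
  have hW : wgt (-γ) τ (R / 2) = wgt (-γ) τ (R / 4) * exp (-(δ * τ)) := by
    rw [wgt_eq, wgt_eq, ← exp_add, hδ]
    congr 1
    ring
  have hW1 : 1 ≤ wgt (-γ) τ (R / 4) := one_le_wgt (by linarith) _
  have hD : 0 ≤ ∫ s in (0 : ℝ)..ℓ, (f (s, 0) ^ 2 + pdR f (s, 0) ^ 2) :=
    intervalIntegral.integral_nonneg hℓ.le fun s _ => by positivity
  have h5 := integral_den_mono (isCompact_rect ℓ 0 R) hTR hf.smooth
  have h6 := integral_den_nonneg (rect ℓ 0 R) f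
  refine le_of_mul_le_mul_left (a := wgt (-γ) τ (R / 4)) ?_ (by linarith)
  calc _ ≤ K * (wgt (-γ) τ (R / 2) * ∫ p in rect ℓ (R / 2) (3 * R / 4), den f p)
        + 840 * γ ^ 5 * exp (3 * τ) * ∫ s in (0 : ℝ)..ℓ, (f (s, 0) ^ 2 + pdR f (s, 0) ^ 2) :=
        h3.trans (h1.trans (add_le_add (mul_le_mul_of_nonneg_left h2 hK) h4))
    _ ≤ max K (840 * γ ^ 5) * (wgt (-γ) τ (R / 2) * ∫ p in rect ℓ 0 R, den f p)
        + wgt (-γ) τ (R / 4) * (max K (840 * γ ^ 5) * exp (3 * τ) *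
          ∫ s in (0 : ℝ)..ℓ, (f (s, 0) ^ 2 + pdR f (s, 0) ^ 2)) := by
        refine add_le_add ?_ ?_
        · have := (wgt_pos (-γ) τ (R / 2)).le
          have := le_max_left K (840 * γ ^ 5)
          have := integral_den_nonneg (rect ℓ (R / 2) (3 * R / 4)) f
          gcongr
        · refine le_trans ?_ (le_mul_of_one_le_left (by positivity) hW1)
          gcongr
          exact le_max_right _ _
    _ = _ := by rw [hW]; ring

lemma StripCoef.annulus (h : StripCoef ℓ R a B γ τ₀) (hB : 0 ≤ B)
    {r₂ r₃ : ℝ} (h2 : 0 < r₂) (h23 : r₂ < r₃) (h3R : r₃ < R) :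
    ∃ δ > 0, ∃ C, 0 ≤ C ∧ ∀ lam τ : ℝ, τ₀ * (1 + |lam|) ≤ τ → ∀ f, StripSol ℓ R a B lam f →
      ∫ p in rect ℓ r₂ r₃, den f p ≤ C * exp (-(δ * τ)) * (∫ p in rect ℓ 0 R, den f p)
        + C * exp (2 * τ) * ∫ p in rect ℓ 0 r₂, den f p := by
  obtain ⟨b, hbd⟩ : ∃ b, b = r₃ + (R - r₃) / 3 := ⟨_, rfl⟩
  obtain ⟨b', hbd'⟩ : ∃ b', b' = r₃ + 2 * (R - r₃) / 3 := ⟨_, rfl⟩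
  have hb : b < b' := by linarith
  have hi : r₂ / 3 < 2 * r₂ / 3 := by linarith
  obtain ⟨χ, hχd⟩ : ∃ χ : ℝ → ℝ, χ = fun r => cutOut b b' r - cutOut (r₂ / 3) (2 * r₂ / 3) r :=
    ⟨_, rfl⟩
  have hχ : ContDiff ℝ ∞ χ := hχd ▸ (contDiff_cutOut b b').sub (contDiff_cutOut _ _)
  have hlow : ∀ r, r ≤ r₂ / 3 → χ r = 0 := fun r hr => by
    rw [hχd]
    simp only [cutOut_eq_one hb (by linarith : r ≤ b), cutOut_eq_one hi hr, sub_self]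
  have hmid : ∀ r, 2 * r₂ / 3 ≤ r → r ≤ b → χ r = 1 := fun r hr hr' => by
    rw [hχd]
    simp only [cutOut_eq_one hb hr', cutOut_eq_zero hi hr, sub_zero]
  have htop : ∀ r, b' ≤ r → χ r = 0 := fun r hr => by
    rw [hχd]
    simp only [cutOut_eq_zero hb hr, cutOut_eq_zero hi (by linarith : 2 * r₂ / 3 ≤ r), sub_zero]
  have dlow := deriv_eq_zero_of_const_on (U := Set.Iio (r₂ / 3)) isOpen_Iio
    (fun r (hr : r < r₂ / 3) => hlow r hr.le)
  have dmid := deriv_eq_zero_of_const_on (U := Set.Ioo (2 * r₂ / 3) b) isOpen_Ioo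
    (fun r hr => hmid r hr.1.le hr.2.le)
  have dtop := deriv_eq_zero_of_const_on (U := Set.Ioi b') isOpen_Ioi
    (fun r (hr : b' < r) => htop r hr.le)
  have hT1 : rect ℓ (r₂ / 3) (2 * r₂ / 3) ⊆ rect ℓ 0 r₂ := rect_subset (by linarith) (by linarith)
  have hT1' : rect ℓ 0 r₂ ⊆ rect ℓ 0 R := rect_subset (by linarith) (by linarith)
  have hT2 : rect ℓ b b' ⊆ rect ℓ 0 R := rect_subset (by linarith) (by linarith)
  have hdis : Disjoint (rect ℓ (r₂ / 3) (2 * r₂ / 3)) (rect ℓ b b') := by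
    rw [Set.disjoint_left]
    intro p hp hp'
    have h5 := (mem_rect.1 hp).2.2
    have h6 := (mem_rect.1 hp').2.1
    linarith
  obtain ⟨K, hK, hcut⟩ := h.cut hB hχ (htop R (by linarith))
    (dtop R (show b' < R by linarith)).1
    ((measurableSet_rect ℓ (r₂ / 3) (2 * r₂ / 3)).union (measurableSet_rect ℓ b b'))
    (Set.union_subset (hT1.trans hT1') hT2) (by
      intro p hp hpT
      rw [Set.mem_union, not_or, mem_rect, mem_rect] at hpT
      rw [mem_rect] at hp
      by_cases h1 : p.2 < r₂ / 3
      · exact dlow _ h1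
      by_cases h5 : b' < p.2
      · exact dtop _ h5
      refine dmid _ ⟨?_, ?_⟩
      · by_contra h6
        exact hpT.1 ⟨hp.1, not_lt.1 h1, not_lt.1 h6⟩
      · by_contra h6
        exact hpT.2 ⟨hp.1, not_lt.1 h6, not_lt.1 h5⟩)
  have hγ := h.one_le_γ
  obtain ⟨δ, hδ⟩ : ∃ δ, δ = 2 * exp (-γ * r₃) - 2 * exp (-γ * b) := ⟨_, rfl⟩
  refine ⟨δ, ?_, K, hK, ?_⟩
  · have : exp (-γ * b) < exp (-γ * r₃) := by
      rw [exp_lt_exp]; nlinarith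
    simp only [gt_iff_lt]
    linarith
  intro lam τ hτ f hf
  have hτ1 := h.one_le_tau hτ
  have hl0 := abs_nonneg lam
  have h1 := hcut (-γ) (Or.inr rfl) lam τ hτ f hf.smooth hf.per hf.ineq
  have hw := contDiff_cutF hχ hf.smooth
  have hflux : ∀ s, fluxR (-γ) τ lam a (conjW (-γ) τ (cutF χ f)) (s, 0) = 0 := by
    intro s
    have e1 : χ 0 = 0 := hlow 0 (by linarith)
    have e2 : deriv χ 0 = 0 := (dlow 0 (show 0 < r₂ / 3 by linarith)).1
    simp [fluxR, pdR_conjW hw, pdS_conjW hw, conjW, pdR_cutF hχ hf.smooth, pdS_cutF hχ hf.smooth,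
      cutF, e1, e2]
  simp only [hflux, intervalIntegral.integral_zero, add_zero] at h1
  have hcd : Continuous (fun p : ℝ × ℝ => wgt (-γ) τ p.2 * den f p) :=
    (continuous_wgt (-γ) τ).mul (continuous_den hf.smooth)
  rw [setIntegral_union hdis (measurableSet_rect _ _ _) (hcd.integrableOn_rect _ _ _)
    (hcd.integrableOn_rect _ _ _)] at h1
  have k1 := integral_wgt_le (isCompact_rect ℓ (r₂ / 3) (2 * r₂ / 3)) (k := -γ) (τ := τ)
    (W := exp (2 * τ)) (fun p hp => by
      rw [← wgt_zero (-γ)]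
      exact wgt_anti (by linarith) (by linarith) (le_trans (by linarith) (mem_rect.1 hp).2.1))
    hf.smooth
  have k2 := integral_wgt_le (isCompact_rect ℓ b b') (k := -γ) (τ := τ)
    (W := wgt (-γ) τ b) (fun p hp => wgt_anti (by linarith) (by linarith)
      (mem_rect.1 hp).2.1) hf.smooth
  have k3 := le_integral_wgt (isCompact_rect ℓ r₂ r₃) (isCompact_rect ℓ 0 R)
    (rect_subset (by linarith) (by linarith)) (k := -γ) (τ := τ)
    (W := wgt (-γ) τ r₃) (fun p hp => wgt_anti (by linarith) (by linarith)
      (mem_rect.1 hp).2.2) hf.smooth hw (fun p hp => by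
        obtain ⟨e1, e2⟩ := (mem_rect.1 hp).2
        exact den_cutF_of_eq_one hχ hf.smooth (hmid _ (by linarith) (by linarith))
          (dmid _ ⟨by linarith, by linarith⟩).1)
  have hW : wgt (-γ) τ b = wgt (-γ) τ r₃ * exp (-(δ * τ)) := by
    rw [wgt_eq, wgt_eq, ← exp_add, hδ]
    congr 1
    ring
  have hW1 : 1 ≤ wgt (-γ) τ r₃ := one_le_wgt (by linarith) _
  have m1 := integral_den_mono (isCompact_rect ℓ 0 r₂) hT1 hf.smooth
  have m2 := integral_den_mono (isCompact_rect ℓ 0 R) hT2 hf.smooth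
  have m3 := integral_den_nonneg (rect ℓ 0 r₂) f
  have hWb := (wgt_pos (-γ) τ b).le
  refine le_of_mul_le_mul_left (a := wgt (-γ) τ r₃) ?_ (by linarith)
  calc _ ≤ K * (exp (2 * τ) * (∫ p in rect ℓ (r₂ / 3) (2 * r₂ / 3), den f p)
        + wgt (-γ) τ b * ∫ p in rect ℓ b b', den f p) :=
        k3.trans (h1.trans (mul_le_mul_of_nonneg_left (add_le_add k1 k2) hK))
    _ ≤ K * (exp (2 * τ) * (∫ p in rect ℓ 0 r₂, den f p)
        + wgt (-γ) τ b * ∫ p in rect ℓ 0 R, den f p) := by gcongr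
    _ = K * (wgt (-γ) τ b * ∫ p in rect ℓ 0 R, den f p)
        + 1 * (K * exp (2 * τ) * ∫ p in rect ℓ 0 r₂, den f p) := by ring
    _ ≤ K * (wgt (-γ) τ b * ∫ p in rect ℓ 0 R, den f p)
        + wgt (-γ) τ r₃ * (K * exp (2 * τ) * ∫ p in rect ℓ 0 r₂, den f p) := by gcongr
    _ = _ := by rw [hW]; ring

lemma StripCoef.neumann (h : StripCoef ℓ R a B γ τ₀) (hR : 0 < R) (hB : 0 ≤ B)
    (hac : ContDiff ℝ ∞ a) :
    ∃ C, 0 ≤ C ∧ ∀ lam : ℝ, ∀ f, StripSol ℓ R a B lam f → (∀ s, pdR f (s, 0) = 0) →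
      ∫ p in rect ℓ 0 (R / 4), den f p ≤
        C * exp (C * (1 + |lam|)) * ∫ p in rect ℓ (R / 4) R, den f p := by
  have hb : R / 2 < 3 * R / 4 := by linarith
  have hχ := contDiff_cutOut (R / 2) (3 * R / 4)
  have hTR : rect ℓ (R / 2) (3 * R / 4) ⊆ rect ℓ 0 R := rect_subset (by linarith) (by linarith)
  have hTR' : rect ℓ (R / 2) (3 * R / 4) ⊆ rect ℓ (R / 4) R :=
    rect_subset (by linarith) (by linarith)
  obtain ⟨K, hK, hcut⟩ := h.cut hB hχ (cutOut_eq_zero hb (by linarith))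
    (deriv_cutOut_above hb (by linarith)).1 (measurableSet_rect _ _ _) hTR (by
      intro p hp hpT
      rw [mem_rect] at hp hpT
      by_cases h1 : p.2 < R / 2
      · exact deriv_cutOut_below hb h1
      · refine deriv_cutOut_above hb ?_
        by_contra h2
        exact hpT ⟨hp.1, not_lt.1 h1, not_lt.1 h2⟩)
  have hγ := h.one_le_γ
  obtain ⟨c, hc⟩ : ∃ c, c = 2 * exp (γ * R) * τ₀ := ⟨_, rfl⟩
  have hτ₀ := h.one_le_τ₀
  have hc0 : 0 ≤ c := by rw [hc]; positivity
  refine ⟨max (K + 1) c, le_max_of_le_right hc0, ?_⟩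
  intro lam f hf hN
  obtain ⟨τ, hτd⟩ : ∃ τ, τ = τ₀ * (1 + |lam|) := ⟨_, rfl⟩
  have hτ1 := h.one_le_tau hτd.ge
  have hl0 := abs_nonneg lam
  have h1 := hcut γ (Or.inl rfl) lam τ hτd.ge f hf.smooth hf.per hf.ineq
  have h2 := hcut (-γ) (Or.inr rfl) lam τ hτd.ge f hf.smooth hf.per hf.ineq
  have hw := contDiff_cutF hχ hf.smooth
  have hWle : ∀ k, (k = γ ∨ k = -γ) → ∀ p ∈ rect ℓ (R / 2) (3 * R / 4),
      wgt k τ p.2 ≤ exp (c * (1 + |lam|)) := by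
    intro k hk p hp
    obtain ⟨e1, e2⟩ := (mem_rect.1 hp).2
    rw [wgt_eq, exp_le_exp, hc]
    have : k * p.2 ≤ γ * R := by
      rcases hk with rfl | rfl
      · nlinarith
      · nlinarith
    calc 2 * (τ * exp (k * p.2)) ≤ 2 * (τ * exp (γ * R)) := by
          have : 0 ≤ τ := by linarith
          gcongr
      _ = _ := by rw [hτd]; ring
  have hden : ∀ p ∈ rect ℓ 0 (R / 4), den (cutF (cutOut (R / 2) (3 * R / 4)) f) p
      = den f p := by
    intro p hp
    have := (mem_rect.1 hp).2.2
    exact den_cutF_of_eq_one hχ hf.smooth (cutOut_eq_one hb (by linarith))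
      (deriv_cutOut_below hb (by linarith)).1
  have k1 := integral_wgt_le (isCompact_rect ℓ (R / 2) (3 * R / 4)) (hWle γ (Or.inl rfl)) hf.smooth
  have k2 := integral_wgt_le (isCompact_rect ℓ (R / 2) (3 * R / 4)) (hWle (-γ) (Or.inr rfl))
    hf.smooth
  have l1 := le_integral_wgt (isCompact_rect ℓ 0 (R / 4)) (isCompact_rect ℓ 0 R)
    (rect_subset le_rfl (by linarith)) (k := γ) (τ := τ)
    (W := 1) (fun p hp => one_le_wgt (by linarith) _) hf.smooth hw hden
  have l2 := le_integral_wgt (isCompact_rect ℓ 0 (R / 4)) (isCompact_rect ℓ 0 R)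
    (rect_subset le_rfl (by linarith)) (k := -γ) (τ := τ)
    (W := 1) (fun p hp => one_le_wgt (by linarith) _) hf.smooth hw hden
  have c0 : Continuous fun s : ℝ => (s, (0 : ℝ)) := by fun_prop
  have hfl : ∀ k, IntervalIntegrable (fun s => fluxR k τ lam a (conjW k τ
      (cutF (cutOut (R / 2) (3 * R / 4)) f)) (s, 0)) volume 0 ℓ := fun k =>
    ((contDiff_fluxR hac (contDiff_conjW hw k τ) k τ lam).continuous.comp
      c0).intervalIntegrable _ _
  have hcancel : (∫ s in (0 : ℝ)..ℓ, fluxR γ τ lam a (conjW γ τ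
      (cutF (cutOut (R / 2) (3 * R / 4)) f)) (s, 0)) + ∫ s in (0 : ℝ)..ℓ, fluxR (-γ) τ lam a
      (conjW (-γ) τ (cutF (cutOut (R / 2) (3 * R / 4)) f)) (s, 0) = 0 := by
    rw [← intervalIntegral.integral_add (hfl γ) (hfl (-γ))]
    refine (intervalIntegral.integral_congr (g := fun _ => 0) fun s _ => ?_).trans
      intervalIntegral.integral_zero
    have e2 := (deriv_cutOut_below hb (by linarith : 0 < R / 2)).1
    simp only [fluxR, pdR_conjW hw, pdS_conjW hw, conjW, pdR_cutF hχ hf.smooth,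
      pdS_cutF hχ hf.smooth, cutF, e2, hN s, mul_zero, exp_zero]
    ring
  have m1 := integral_den_mono (isCompact_rect ℓ (R / 4) R) hTR' hf.smooth
  have m2 := integral_den_nonneg (rect ℓ (R / 4) R) f
  have m3 : exp (c * (1 + |lam|)) ≤ exp (max (K + 1) c * (1 + |lam|)) := by
    gcongr
    exact le_max_right _ _
  calc ∫ p in rect ℓ 0 (R / 4), den f p
      ≤ K * (exp (c * (1 + |lam|)) * ∫ p in rect ℓ (R / 2) (3 * R / 4), den f p) := by
        have j1 := mul_le_mul_of_nonneg_left k1 hK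
        have j2 := mul_le_mul_of_nonneg_left k2 hK
        linarith
    _ ≤ max (K + 1) c * (exp (max (K + 1) c * (1 + |lam|)) * ∫ p in rect ℓ (R / 4) R, den f p) := by
        have : K ≤ max (K + 1) c := le_trans (by linarith) (le_max_left _ _)
        have := integral_den_nonneg (rect ℓ (R / 2) (3 * R / 4)) f
        gcongr
    _ = _ := by ring

end estimates

/-- The first standard basis vector of the plane. -/
def ee (i : Fin 2) : E2 := EuclideanSpace.single i 1

lemma eq_sum_ee (u : E2) : u = u 0 • ee 0 + u 1 • ee 1 := by
  ext i
  fin_cases i <;> simp [ee]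

/-- The energy density of a function on the plane. -/
def eng (φ : E2 → ℝ) (x : E2) : ℝ :=
  fderiv ℝ φ x (ee 0) ^ 2 + fderiv ℝ φ x (ee 1) ^ 2 + φ x ^ 2

lemma eng_nonneg (φ : E2 → ℝ) (x : E2) : 0 ≤ eng φ x := by unfold eng; positivity

lemma continuous_eng {φ : E2 → ℝ} (hφ : ContDiff ℝ ∞ φ) : Continuous (eng φ) := by
  have h := hφ.continuous
  have h1 : ∀ i, Continuous fun x => fderiv ℝ φ x (ee i) := fun i =>
    ((hφ.fderiv_right (m := ∞) (by simp)).clm_apply contDiff_const).continuous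
  have h2 := h1 0
  have h3 := h1 1
  unfold eng
  fun_prop

/-- A smooth periodic moving frame along a unit speed plane curve. -/
structure Frame where
  ℓ : ℝ
  q : ℝ → E2
  T : ℝ → E2
  N : ℝ → E2
  κ : ℝ → ℝ
  σ : ℝ
  ℓ_pos : 0 < ℓ
  q_smooth : ContDiff ℝ ∞ q
  T_smooth : ContDiff ℝ ∞ T
  N_smooth : ContDiff ℝ ∞ N
  κ_smooth : ContDiff ℝ ∞ κ
  q_deriv : ∀ s, HasDerivAt q (T s) s
  T_deriv : ∀ s, HasDerivAt T (κ s • N s) s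
  N_deriv : ∀ s, HasDerivAt N (-(κ s) • T s) s
  q_per : ∀ s, q (s + ℓ) = q s
  N_per : ∀ s, N (s + ℓ) = N s
  κ_per : ∀ s, κ (s + ℓ) = κ s
  T_unit : ∀ s, T s 0 ^ 2 + T s 1 ^ 2 = 1
  σ_sq : σ ^ 2 = 1
  N_zero : ∀ s, N s 0 = -(σ * T s 1)
  N_one : ∀ s, N s 1 = σ * T s 0

namespace Frame
variable (F : Frame)

/-- Fermi coordinates along the curve. -/
def X (p : ℝ × ℝ) : E2 := F.q p.1 + p.2 • F.N p.1

/-- The metric factor in Fermi coordinates. -/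
def g (p : ℝ × ℝ) : ℝ := 1 - F.κ p.1 * p.2

/-- A globally smooth positive function equal to `1 / g²` where `g ≥ 1 / 2`. -/
def a (p : ℝ × ℝ) : ℝ := 1 / (F.g p ^ 2 + 1 - smoothTransition (2 * F.g p))

lemma contDiff_X : ContDiff ℝ ∞ F.X := by
  have h1 := F.q_smooth
  have h2 := F.N_smooth
  exact (h1.comp contDiff_fst).add (contDiff_snd.smul (h2.comp contDiff_fst))

lemma contDiff_g : ContDiff ℝ ∞ F.g :=
  contDiff_const.sub ((F.κ_smooth.comp contDiff_fst).mul contDiff_snd)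

lemma a_denom_pos (p : ℝ × ℝ) : 0 < F.g p ^ 2 + 1 - smoothTransition (2 * F.g p) := by
  rcases eq_or_ne (F.g p) 0 with h | h
  · rw [h, mul_zero, smoothTransition.zero]
    norm_num
  · have h1 : 0 < F.g p ^ 2 := by positivity
    have h2 := smoothTransition.le_one (2 * F.g p)
    linarith

lemma a_pos (p : ℝ × ℝ) : 0 < F.a p := one_div_pos.2 (F.a_denom_pos p)

lemma contDiff_a : ContDiff ℝ ∞ F.a := by
  have h := F.contDiff_g
  refine contDiff_const.div (((h.pow 2).add contDiff_const).sub
    (smoothTransition.contDiff.comp (contDiff_const.mul h))) fun p => (F.a_denom_pos p).ne'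

lemma per_X (s r : ℝ) : F.X (s + F.ℓ, r) = F.X (s, r) := by
  simp only [X, F.q_per, F.N_per]

lemma per_a : PerS F.ℓ F.a := by
  intro s r
  simp only [a, g, F.κ_per]

lemma a_eq {p : ℝ × ℝ} (h : 1 / 2 ≤ F.g p) : F.a p = 1 / F.g p ^ 2 := by
  rw [a, smoothTransition.one_of_one_le (by linarith)]
  ring_nf

lemma orth_aux (s : ℝ) : F.T s 0 ^ 2 + F.N s 0 ^ 2 = 1 ∧ F.T s 1 ^ 2 + F.N s 1 ^ 2 = 1 ∧
    F.T s 0 * F.T s 1 + F.N s 0 * F.N s 1 = 0 := by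
  have h := F.T_unit s
  have h2 := F.σ_sq
  rw [F.N_zero, F.N_one]
  refine ⟨?_, ?_, ?_⟩
  · rw [neg_sq, mul_pow, h2]; linarith
  · rw [mul_pow, h2]; linarith
  · linear_combination -(F.T s 0 * F.T s 1) * h2

lemma sum_sq_clm (A : E2 →L[ℝ] ℝ) (s : ℝ) :
    A (F.T s) ^ 2 + A (F.N s) ^ 2 = A (ee 0) ^ 2 + A (ee 1) ^ 2 := by
  obtain ⟨h0, h1, h2⟩ := F.orth_aux s
  rw [eq_sum_ee (F.T s), eq_sum_ee (F.N s)]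
  simp only [map_add, map_smul, smul_eq_mul]
  linear_combination (A (ee 0)) ^ 2 * h0 + (A (ee 1)) ^ 2 * h1 + 2 * A (ee 0) * A (ee 1) * h2

lemma trace_bilin (A : E2 →L[ℝ] E2 →L[ℝ] ℝ) (s : ℝ) :
    A (F.T s) (F.T s) + A (F.N s) (F.N s) = A (ee 0) (ee 0) + A (ee 1) (ee 1) := by
  obtain ⟨h0, h1, h2⟩ := F.orth_aux s
  rw [eq_sum_ee (F.T s), eq_sum_ee (F.N s)]
  simp only [map_add, map_smul, smul_eq_mul, add_apply, smul_apply]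
  linear_combination (A (ee 0) (ee 0)) * h0 + (A (ee 1) (ee 1)) * h1
    + (A (ee 0) (ee 1) + A (ee 1) (ee 0)) * h2

lemma hasDerivAt_X_fst (p : ℝ × ℝ) :
    HasDerivAt (fun t => F.X (t, p.2)) (F.g p • F.T p.1) p.1 := by
  have h := (F.q_deriv p.1).add ((F.N_deriv p.1).const_smul p.2)
  have e : F.g p • F.T p.1 = F.T p.1 + p.2 • -(F.κ p.1) • F.T p.1 := by
    simp only [g]
    module
  rw [e]
  exact h

lemma hasDerivAt_X_snd (p : ℝ × ℝ) : HasDerivAt (fun t => F.X (p.1, t)) (F.N p.1) p.2 := by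
  have h := ((hasDerivAt_id p.2).smul_const (F.N p.1)).const_add (F.q p.1)
  rw [one_smul] at h
  exact h

/-- A function on the plane in Fermi coordinates. -/
def pull (φ : E2 → ℝ) (p : ℝ × ℝ) : ℝ := φ (F.X p)

section pull
variable {φ : E2 → ℝ}

lemma contDiff_pull (hφ : ContDiff ℝ ∞ φ) : ContDiff ℝ ∞ (F.pull φ) := hφ.comp F.contDiff_X

lemma per_pull (φ : E2 → ℝ) : PerS F.ℓ (F.pull φ) := by
  intro s r
  simp only [pull, F.per_X]

lemma pdR_pull (hφ : ContDiff ℝ ∞ φ) (p : ℝ × ℝ) :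
    pdR (F.pull φ) p = fderiv ℝ φ (F.X p) (F.N p.1) :=
  pdR_eq_of_hasDerivAt ((F.contDiff_pull hφ).differentiable (by simp) p)
    (HasFDerivAt.comp_hasDerivAt p.2 (f := fun t => F.X (p.1, t))
      (hφ.differentiable (by simp) (F.X p)).hasFDerivAt (F.hasDerivAt_X_snd p))

lemma pdS_pull (hφ : ContDiff ℝ ∞ φ) (p : ℝ × ℝ) :
    pdS (F.pull φ) p = F.g p * fderiv ℝ φ (F.X p) (F.T p.1) := by
  rw [pdS_eq_of_hasDerivAt ((F.contDiff_pull hφ).differentiable (by simp) p)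
    (HasFDerivAt.comp_hasDerivAt p.1 (f := fun t => F.X (t, p.2))
      (hφ.differentiable (by simp) (F.X p)).hasFDerivAt (F.hasDerivAt_X_fst p)), map_smul,
    smul_eq_mul]

lemma hasFDerivAt_fderiv (hφ : ContDiff ℝ ∞ φ) (x : E2) :
    HasFDerivAt (fderiv ℝ φ) (fderiv ℝ (fderiv ℝ φ) x) x :=
  ((hφ.fderiv_right (m := ∞) (by simp)).differentiable (by simp) x).hasFDerivAt

lemma pdR_pdR_pull (hφ : ContDiff ℝ ∞ φ) (p : ℝ × ℝ) :
    pdR (pdR (F.pull φ)) p = fderiv ℝ (fderiv ℝ φ) (F.X p) (F.N p.1) (F.N p.1) := by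
  refine pdR_eq_of_hasDerivAt
    ((contDiff_pdR (F.contDiff_pull hφ)).differentiable (by simp) p) ?_
  simp only [F.pdR_pull hφ]
  have h := (HasFDerivAt.comp_hasDerivAt p.2 (f := fun t => F.X (p.1, t))
    (hasFDerivAt_fderiv hφ (F.X p)) (F.hasDerivAt_X_snd p)).clm_apply
    (hasDerivAt_const p.2 (F.N p.1))
  simpa using h

lemma pdS_pdS_pull (hφ : ContDiff ℝ ∞ φ) (p : ℝ × ℝ) :
    pdS (pdS (F.pull φ)) p = -(deriv F.κ p.1 * p.2) * fderiv ℝ φ (F.X p) (F.T p.1)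
      + F.g p * (F.g p * fderiv ℝ (fderiv ℝ φ) (F.X p) (F.T p.1) (F.T p.1)
        + F.κ p.1 * fderiv ℝ φ (F.X p) (F.N p.1)) := by
  refine pdS_eq_of_hasDerivAt
    ((contDiff_pdS (F.contDiff_pull hφ)).differentiable (by simp) p) ?_
  simp only [F.pdS_pull hφ]
  have h := (HasFDerivAt.comp_hasDerivAt p.1 (f := fun t => F.X (t, p.2))
    (hasFDerivAt_fderiv hφ (F.X p)) (F.hasDerivAt_X_fst p)).clm_apply (F.T_deriv p.1)
  have hg : HasDerivAt (fun t => F.g (t, p.2)) (-(deriv F.κ p.1 * p.2)) p.1 :=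
    (((F.κ_smooth.differentiable (by simp) p.1).hasDerivAt.mul_const p.2).const_sub 1)
  have h2 := hg.fun_mul h
  simpa [mul_add, mul_assoc] using h2

lemma lap_eq (hφ : ContDiff ℝ ∞ φ) (x : E2) :
    lap φ x = fderiv ℝ (fderiv ℝ φ) x (ee 0) (ee 0) + fderiv ℝ (fderiv ℝ φ) x (ee 1) (ee 1) := by
  have h : ∀ u v : E2, fderiv ℝ (fun y => fderiv ℝ φ y v) x u
      = fderiv ℝ (fderiv ℝ φ) x u v := by
    intro u v
    have := ((hasFDerivAt_fderiv hφ x).clm_apply (hasFDerivAt_const v x)).fderiv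
    rw [this]
    simp
  simp only [lap, Fin.sum_univ_two, h, ee]

lemma opL_pull (hφ : ContDiff ℝ ∞ φ) {p : ℝ × ℝ} (hg : 1 / 2 ≤ F.g p) (lam : ℝ) :
    opL F.a lam (F.pull φ) p = lap φ (F.X p) + lam ^ 2 * φ (F.X p)
      + F.κ p.1 / F.g p * pdR (F.pull φ) p
      + (pdS F.a p - deriv F.κ p.1 * p.2 / F.g p ^ 3) * pdS (F.pull φ) p := by
  have hg0 : F.g p ≠ 0 := by linarith
  have htr := F.trace_bilin (fderiv ℝ (fderiv ℝ φ) (F.X p)) p.1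
  rw [lap_eq hφ, ← htr, opL, F.pdR_pdR_pull hφ, F.pdS_pdS_pull hφ, F.pdR_pull hφ, F.pdS_pull hφ,
    F.a_eq hg, pull]
  field_simp
  ring

/-- The constant in the differential inequality satisfied by eigenfunctions in Fermi coordinates. -/
lemma exists_stripSol {R : ℝ} (hg : ∀ p ∈ rect F.ℓ 0 R, 1 / 2 ≤ F.g p) :
    ∃ B, 0 ≤ B ∧ ∀ lam : ℝ, ∀ φ : E2 → ℝ, ContDiff ℝ ∞ φ →
      (∀ p ∈ rect F.ℓ 0 R, lap φ (F.X p) = -lam ^ 2 * φ (F.X p)) →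
      StripSol F.ℓ R F.a B lam (F.pull φ) := by
  have hgc := F.contDiff_g.continuous
  have hκ := F.κ_smooth.continuous
  have hκ' := (contDiff_deriv_infty F.κ_smooth).continuous
  have ha' := (contDiff_pdS F.contDiff_a).continuous
  have hne : ∀ p ∈ rect F.ℓ 0 R, F.g p ≠ 0 := fun p hp => by
    have := hg p hp
    linarith
  have c1 : ContinuousOn (fun p : ℝ × ℝ => F.κ p.1 / F.g p) (rect F.ℓ 0 R) :=
    (hκ.comp continuous_fst).continuousOn.div hgc.continuousOn hne
  have c2 : ContinuousOn (fun p : ℝ × ℝ => pdS F.a p - deriv F.κ p.1 * p.2 / F.g p ^ 3)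
      (rect F.ℓ 0 R) :=
    ha'.continuousOn.sub (((hκ'.comp continuous_fst).mul continuous_snd).continuousOn.div
      (hgc.pow 3).continuousOn fun p hp => pow_ne_zero 3 (hne p hp))
  obtain ⟨B₁, hB₁⟩ := (isCompact_rect F.ℓ 0 R).exists_bound_of_continuousOn c1
  obtain ⟨B₂, hB₂⟩ := (isCompact_rect F.ℓ 0 R).exists_bound_of_continuousOn c2
  refine ⟨max 0 (max B₁ B₂), le_max_left _ _, fun lam φ hφ hl =>
    ⟨F.contDiff_pull hφ, F.per_pull φ, fun p hp => ?_⟩⟩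
  rw [F.opL_pull hφ (hg p hp), hl p hp]
  have e1 : |F.κ p.1 / F.g p| ≤ max 0 (max B₁ B₂) :=
    (hB₁ p hp).trans ((le_max_left _ _).trans (le_max_right _ _))
  have e2 : |pdS F.a p - deriv F.κ p.1 * p.2 / F.g p ^ 3| ≤ max 0 (max B₁ B₂) :=
    (hB₂ p hp).trans ((le_max_right _ _).trans (le_max_right _ _))
  have e3 : -lam ^ 2 * φ (F.X p) + lam ^ 2 * φ (F.X p) = 0 := by ring
  rw [e3, zero_add]
  refine (abs_add_le _ _).trans ?_
  rw [abs_mul, abs_mul]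
  have e4 := mul_le_mul_of_nonneg_right e1 (abs_nonneg (pdR (F.pull φ) p))
  have e5 := mul_le_mul_of_nonneg_right e2 (abs_nonneg (pdS (F.pull φ) p))
  have e6 : 0 ≤ max 0 (max B₁ B₂) * |F.pull φ p| := by positivity
  linarith

lemma den_pull (hφ : ContDiff ℝ ∞ φ) (p : ℝ × ℝ) :
    den (F.pull φ) p = fderiv ℝ φ (F.X p) (F.N p.1) ^ 2
      + F.g p ^ 2 * fderiv ℝ φ (F.X p) (F.T p.1) ^ 2 + φ (F.X p) ^ 2 := by
  rw [den, F.pdR_pull hφ, F.pdS_pull hφ, pull]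
  ring

lemma eng_eq (φ : E2 → ℝ) (p : ℝ × ℝ) :
    eng φ (F.X p) = fderiv ℝ φ (F.X p) (F.N p.1) ^ 2
      + fderiv ℝ φ (F.X p) (F.T p.1) ^ 2 + φ (F.X p) ^ 2 := by
  have := F.sum_sq_clm (fderiv ℝ φ (F.X p)) p.1
  rw [eng]
  linarith

lemma eng_le_den (hφ : ContDiff ℝ ∞ φ) {p : ℝ × ℝ} (hg : 1 / 2 ≤ F.g p) :
    eng φ (F.X p) ≤ 4 * den (F.pull φ) p := by
  rw [F.eng_eq, F.den_pull hφ]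
  have h1 : 1 ≤ 4 * F.g p ^ 2 := by nlinarith
  have := mul_le_mul_of_nonneg_right h1 (sq_nonneg (fderiv ℝ φ (F.X p) (F.T p.1)))
  have := sq_nonneg (fderiv ℝ φ (F.X p) (F.N p.1))
  have := sq_nonneg (φ (F.X p))
  linarith

lemma exists_den_le (R : ℝ) : ∃ G, 0 ≤ G ∧ ∀ φ : E2 → ℝ, ContDiff ℝ ∞ φ → ∀ p ∈ rect F.ℓ 0 R,
    den (F.pull φ) p ≤ G * eng φ (F.X p) := by
  obtain ⟨G, hG⟩ := (isCompact_rect F.ℓ 0 R).exists_bound_of_continuousOn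
    (F.contDiff_g.continuous.pow 2).continuousOn
  refine ⟨max 1 G, by positivity, fun φ hφ p hp => ?_⟩
  rw [F.eng_eq, F.den_pull hφ]
  have h1 : F.g p ^ 2 ≤ max 1 G := (le_abs_self _).trans ((hG p hp).trans (le_max_right _ _))
  have h2 : 1 ≤ max 1 G := le_max_left _ _
  have := mul_le_mul_of_nonneg_right h1 (sq_nonneg (fderiv ℝ φ (F.X p) (F.T p.1)))
  have := mul_le_mul_of_nonneg_right h2 (sq_nonneg (fderiv ℝ φ (F.X p) (F.N p.1)))
  have := mul_le_mul_of_nonneg_right h2 (sq_nonneg (φ (F.X p)))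
  linarith

end pull

end Frame

/-- The plane as a product. -/
def toProd : E2 ≃L[ℝ] ℝ × ℝ :=
  (EuclideanSpace.equiv (Fin 2) ℝ).trans (ContinuousLinearEquiv.finTwoArrow ℝ ℝ)

lemma measurePreserving_toProd : MeasurePreserving toProd :=
  (volume_preserving_finTwoArrow ℝ).comp (PiLp.volume_preserving_ofLp (Fin 2))

lemma exists_lintegral_comp {Y : ℝ × ℝ → ℝ × ℝ} (hY : ContDiff ℝ ∞ Y) {K : Set (ℝ × ℝ)}
    (hK : IsCompact K) (hdet : ∀ p ∈ K, (fderiv ℝ Y p).det ≠ 0) :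
    ∃ C : NNReal, ∀ h : ℝ × ℝ → ENNReal,
      ∫⁻ p in K, h (Y p) ≤ C * ∫⁻ x in Y '' K, h x ∧
      ∫⁻ x in Y '' K, h x ≤ C * ∫⁻ p in K, h (Y p) := by
  have key : ∃ C : NNReal, ∀ h : ℝ × ℝ → ENNReal,
      ∫⁻ p in K ∩ K, h (Y p) ≤ C * ∫⁻ x in Y '' K, h x ∧
      ∫⁻ x in Y '' (K ∩ K), h x ≤ C * ∫⁻ p in K, h (Y p) := by
    refine hK.induction_on (p := fun S => ∃ C : NNReal, ∀ h : ℝ × ℝ → ENNReal,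
      ∫⁻ p in S ∩ K, h (Y p) ≤ C * ∫⁻ x in Y '' K, h x ∧
      ∫⁻ x in Y '' (S ∩ K), h x ≤ C * ∫⁻ p in K, h (Y p)) ⟨0, fun h => by simp⟩ ?_ ?_ ?_
    · rintro S T hST ⟨C, hC⟩
      refine ⟨C, fun h => ⟨?_, ?_⟩⟩
      · exact (lintegral_mono_set (Set.inter_subset_inter_left _ hST)).trans (hC h).1
      · exact (lintegral_mono_set (Set.image_mono (Set.inter_subset_inter_left _ hST))).trans
          (hC h).2
    · rintro S T ⟨C, hC⟩ ⟨D, hD⟩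
      refine ⟨C + D, fun h => ⟨?_, ?_⟩⟩
      · rw [Set.union_inter_distrib_right, ENNReal.coe_add, add_mul]
        exact (lintegral_union_le _ _ _).trans (add_le_add (hC h).1 (hD h).1)
      · rw [Set.union_inter_distrib_right, Set.image_union, ENNReal.coe_add, add_mul]
        exact (lintegral_union_le _ _ _).trans (add_le_add (hC h).2 (hD h).2)
    · intro p hp
      have hd0 := hdet p hp
      set d := |(fderiv ℝ Y p).det| with hd
      have hdpos : 0 < d := abs_pos.2 hd0
      have hcont : Continuous fun z => |(fderiv ℝ Y z).det| :=
        (ContinuousLinearMap.continuous_det.comp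
          (hY.fderiv_right (m := ∞) (by simp)).continuous).abs
      have hs := (hY.contDiffAt (x := p)).hasStrictFDerivAt (by simp)
      have hs' : HasStrictFDerivAt Y
          (((fderiv ℝ Y p).toContinuousLinearEquivOfDetNeZero hd0 : (ℝ × ℝ) ≃L[ℝ] ℝ × ℝ) :
            ℝ × ℝ →L[ℝ] ℝ × ℝ) p := by
        rw [ContinuousLinearMap.coe_toContinuousLinearEquivOfDetNeZero]
        exact hs
      set V := (hs'.toOpenPartialHomeomorph Y).source ∩
        (fun z => |(fderiv ℝ Y z).det|) ⁻¹' Set.Ioo (d / 2) (2 * d) with hV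
      have hVo : IsOpen V :=
        (hs'.toOpenPartialHomeomorph Y).open_source.inter (isOpen_Ioo.preimage hcont)
      have hpV : p ∈ V := ⟨hs'.mem_toOpenPartialHomeomorph_source,
        ⟨by simp only [← hd]; linarith, by simp only [← hd]; linarith⟩⟩
      have hinj : Set.InjOn Y (V ∩ K) :=
        (hs'.toOpenPartialHomeomorph Y).injOn.mono fun z hz => hz.1.1
      refine ⟨V, mem_nhdsWithin_of_mem_nhds (hVo.mem_nhds hpV),
        Real.toNNReal (2 / d) + Real.toNNReal (2 * d), fun h => ?_⟩
      have hm : MeasurableSet (V ∩ K) := hVo.measurableSet.inter hK.measurableSet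
      have hcv := lintegral_image_eq_lintegral_abs_det_fderiv_mul volume hm
        (f := Y) (f' := fderiv ℝ Y) (fun x _ =>
        ((hY.differentiable (by simp) x).hasFDerivAt).hasFDerivWithinAt) hinj h
      rw [ENNReal.coe_add]
      constructor
      · calc ∫⁻ p in V ∩ K, h (Y p)
            ≤ ∫⁻ z in V ∩ K, ENNReal.ofReal (2 / d) *
                (ENNReal.ofReal |(fderiv ℝ Y z).det| * h (Y z)) := by
              refine setLIntegral_mono' hm fun z hz => ?_
              rw [← mul_assoc, ← ENNReal.ofReal_mul (by positivity)]
              refine le_mul_of_one_le_left zero_le ?_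
              rw [ENNReal.one_le_ofReal]
              have h1 : d / 2 < |(fderiv ℝ Y z).det| := hz.1.2.1
              rw [div_mul_eq_mul_div, le_div_iff₀ hdpos]
              linarith
          _ = ENNReal.ofReal (2 / d) * ∫⁻ x in Y '' (V ∩ K), h x := by
              rw [lintegral_const_mul' _ _ ENNReal.ofReal_ne_top, hcv]
          _ ≤ _ := by
              refine mul_le_mul' le_self_add
                (lintegral_mono_set (Set.image_mono Set.inter_subset_right))
      · rw [hcv]
        calc ∫⁻ z in V ∩ K, ENNReal.ofReal |(fderiv ℝ Y z).det| * h (Y z)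
            ≤ ∫⁻ z in V ∩ K, ENNReal.ofReal (2 * d) * h (Y z) := by
              refine setLIntegral_mono' hm fun z hz => ?_
              gcongr
              exact hz.1.2.2.le
          _ = ENNReal.ofReal (2 * d) * ∫⁻ z in V ∩ K, h (Y z) :=
              lintegral_const_mul' _ _ ENNReal.ofReal_ne_top
          _ ≤ _ := mul_le_mul' le_add_self (lintegral_mono_set Set.inter_subset_right)
  rwa [Set.inter_self] at key

lemma exists_integral_comp {X : ℝ × ℝ → E2} (hX : ContDiff ℝ ∞ X) {K : Set (ℝ × ℝ)}
    (hK : IsCompact K) (hinj : ∀ p ∈ K, Function.Injective (fderiv ℝ X p)) :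
    ∃ C : ℝ, 0 ≤ C ∧ ∀ h : E2 → ℝ, Continuous h → (∀ x, 0 ≤ h x) →
      ∫ p in K, h (X p) ≤ C * ∫ x in X '' K, h x ∧
      ∫ x in X '' K, h x ≤ C * ∫ p in K, h (X p) := by
  have hY : ContDiff ℝ ∞ fun p => toProd (X p) := toProd.contDiff.comp hX
  have hdet : ∀ p ∈ K, (fderiv ℝ (fun p => toProd (X p)) p).det ≠ 0 := by
    intro p hp
    have h1 : fderiv ℝ (fun p => toProd (X p)) p
        = (toProd : E2 →L[ℝ] ℝ × ℝ).comp (fderiv ℝ X p) :=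
      ((toProd : E2 →L[ℝ] ℝ × ℝ).hasFDerivAt.comp p
        (hX.differentiable (by simp) p).hasFDerivAt).fderiv
    rw [h1]
    have h2 : Function.Injective (((toProd : E2 →L[ℝ] ℝ × ℝ).comp (fderiv ℝ X p) :
        ℝ × ℝ →L[ℝ] ℝ × ℝ) : ℝ × ℝ →ₗ[ℝ] ℝ × ℝ) :=
      toProd.injective.comp (hinj p hp)
    have h3 := (LinearMap.isUnit_iff_ker_eq_bot _).2 (LinearMap.ker_eq_bot.2 h2)
    exact ((LinearMap.isUnit_iff_isUnit_det _).1 h3).ne_zero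
  obtain ⟨C, hC⟩ := exists_lintegral_comp hY hK hdet
  refine ⟨C, C.2, fun h hh h0 => ?_⟩
  have hKX : IsCompact (X '' K) := hK.image hX.continuous
  have i1 : IntegrableOn (fun p => h (X p)) K :=
    (hh.comp hX.continuous).continuousOn.integrableOn_compact hK
  have i2 : IntegrableOn h (X '' K) := hh.continuousOn.integrableOn_compact hKX
  have e1 := ofReal_integral_eq_lintegral_ofReal i1 (Filter.Eventually.of_forall fun p => h0 (X p))
  have e2 := ofReal_integral_eq_lintegral_ofReal i2 (Filter.Eventually.of_forall h0)
  have n1 : 0 ≤ ∫ p in K, h (X p) := integral_nonneg fun p => h0 (X p)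
  have n2 : 0 ≤ ∫ x in X '' K, h x := integral_nonneg h0
  have himg : (fun p => toProd (X p)) '' K = toProd.symm ⁻¹' (X '' K) := by
    rw [← Set.image_image toProd X]
    exact toProd.toEquiv.image_eq_preimage_symm _
  have hmp : MeasurePreserving toProd.symm :=
    MeasurePreserving.symm (toProd.toHomeomorph.toMeasurableEquiv) measurePreserving_toProd
  have e3 : ∫⁻ x in (fun p => toProd (X p)) '' K, ENNReal.ofReal (h (toProd.symm x))
      = ∫⁻ x in X '' K, ENNReal.ofReal (h x) := by
    rw [himg]
    exact hmp.setLIntegral_comp_preimage hKX.measurableSet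
      (ENNReal.measurable_ofReal.comp hh.measurable)
  have hC' := hC fun x => ENNReal.ofReal (h (toProd.symm x))
  rw [e3] at hC'
  simp only [ContinuousLinearEquiv.symm_apply_apply] at hC'
  rw [← e1, ← e2] at hC'
  have eC : (C : ENNReal) = ENNReal.ofReal (C : ℝ) := by simp
  rw [eC, ← ENNReal.ofReal_mul C.coe_nonneg, ← ENNReal.ofReal_mul C.coe_nonneg] at hC'
  exact ⟨(ENNReal.ofReal_le_ofReal_iff (mul_nonneg C.2 n2)).1 hC'.1,
    (ENNReal.ofReal_le_ofReal_iff (mul_nonneg C.2 n1)).1 hC'.2⟩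

/-- A smooth function on the plane solving the Helmholtz equation on the closure of `Ω`. -/
structure IsSol (Ω : Set E2) (lam : ℝ) (φ : E2 → ℝ) : Prop where
  smooth : ContDiff ℝ ∞ φ
  eq : ∀ x ∈ closure Ω, lap φ x = -lam ^ 2 * φ x

/-- The energy on `S` is controlled by a quantity `D`, up to an arbitrarily small exponential
factor times the total energy. -/
def Ctrl (Ω : Set E2) (D : (E2 → ℝ) → ℝ) (S : Set E2) : Prop :=
  ∀ A : ℝ, ∃ B : ℝ, 0 ≤ B ∧ ∀ lam : ℝ, 0 ≤ lam → ∀ φ, IsSol Ω lam φ →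
    ∫ x in S, eng φ x ≤ exp (-(A * (1 + lam))) * (∫ x in closure Ω, eng φ x)
      + exp (B * (1 + lam)) * D φ

lemma setIntegral_eng_nonneg (S : Set E2) (φ : E2 → ℝ) : 0 ≤ ∫ x in S, eng φ x :=
  integral_nonneg fun x => eng_nonneg φ x

lemma integrableOn_eng {φ : E2 → ℝ} (hφ : ContDiff ℝ ∞ φ) {S : Set E2} (hS : IsCompact S) :
    IntegrableOn (eng φ) S :=
  (continuous_eng hφ).continuousOn.integrableOn_compact hS

lemma setIntegral_eng_mono {φ : E2 → ℝ} (hφ : ContDiff ℝ ∞ φ) {S T : Set E2} (hT : IsCompact T)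
    (h : S ⊆ T) : ∫ x in S, eng φ x ≤ ∫ x in T, eng φ x :=
  setIntegral_mono_set (integrableOn_eng hφ hT)
    (Filter.Eventually.of_forall fun x => eng_nonneg φ x) h.eventuallyLE

lemma Ctrl.mono {Ω : Set E2} {D : (E2 → ℝ) → ℝ} {S T : Set E2} (h : Ctrl Ω D T)
    (hT : IsCompact T) (hST : S ⊆ T) : Ctrl Ω D S := by
  intro A
  obtain ⟨B, hB, h⟩ := h A
  exact ⟨B, hB, fun lam hl φ hφ => (setIntegral_eng_mono hφ.smooth hT hST).trans (h lam hl φ hφ)⟩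

lemma exp_log_absorb {C : ℝ} (hC : 0 ≤ C) {lam : ℝ} (hl : 0 ≤ lam) :
    C ≤ exp (log (C + 1) * (1 + lam)) := by
  have h1 : 0 ≤ log (C + 1) := log_nonneg (by linarith)
  have h2 : C + 1 = exp (log (C + 1)) := (exp_log (by linarith)).symm
  have h3 : exp (log (C + 1)) ≤ exp (log (C + 1) * (1 + lam)) := exp_le_exp.2 (by nlinarith)
  linarith

lemma Ctrl.of_le {Ω : Set E2} {D : (E2 → ℝ) → ℝ} (hD : ∀ φ, 0 ≤ D φ) {S : Set E2}
    (h : ∃ C : ℝ, 0 ≤ C ∧ ∀ A : ℝ, ∃ B : ℝ, 0 ≤ B ∧ ∀ lam : ℝ, 0 ≤ lam → ∀ φ, IsSol Ω lam φ →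
      ∫ x in S, eng φ x ≤ C * (exp (-(A * (1 + lam))) * (∫ x in closure Ω, eng φ x)
        + exp (B * (1 + lam)) * D φ)) : Ctrl Ω D S := by
  obtain ⟨C, hC, h⟩ := h
  intro A
  obtain ⟨B, hB, h⟩ := h (A + log (C + 1))
  have h0 : 0 ≤ log (C + 1) := log_nonneg (by linarith)
  refine ⟨B + log (C + 1), by positivity, fun lam hl φ hφ => (h lam hl φ hφ).trans ?_⟩
  have h1 := exp_log_absorb hC hl
  have hM := setIntegral_eng_nonneg (closure Ω) φ
  have hDφ := hD φ
  rw [mul_add, ← mul_assoc, ← mul_assoc]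
  have e1 : C * exp (-((A + log (C + 1)) * (1 + lam))) ≤ exp (-(A * (1 + lam))) := by
    refine (mul_le_mul_of_nonneg_right h1 (exp_pos _).le).trans ?_
    rw [← exp_add]
    exact exp_le_exp.2 (by ring_nf; rfl)
  have e2 : C * exp (B * (1 + lam)) ≤ exp ((B + log (C + 1)) * (1 + lam)) := by
    refine (mul_le_mul_of_nonneg_right h1 (exp_pos _).le).trans ?_
    rw [← exp_add]
    exact exp_le_exp.2 (by ring_nf; rfl)
  gcongr

lemma Ctrl.union {Ω : Set E2} {D : (E2 → ℝ) → ℝ} (hD : ∀ φ, 0 ≤ D φ) {S T : Set E2}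
    (hS : IsCompact S) (hT : IsCompact T) (h : Ctrl Ω D S) (h' : Ctrl Ω D T) :
    Ctrl Ω D (S ∪ T) := by
  refine Ctrl.of_le hD ⟨2, by norm_num, fun A => ?_⟩
  obtain ⟨B, hB, h⟩ := h A
  obtain ⟨B', hB', h'⟩ := h' A
  refine ⟨max B B', by positivity, fun lam hl φ hφ => ?_⟩
  have e : ∫ x in S ∪ T, eng φ x ≤ (∫ x in S, eng φ x) + ∫ x in T, eng φ x := by
    have h1 : S ∪ T = S ∪ (T \ S) := by simp
    have h2 := setIntegral_eng_mono hφ.smooth hT (Set.sdiff_subset : T \ S ⊆ T)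
    rw [h1, setIntegral_union Set.disjoint_sdiff_right
      (hT.measurableSet.diff hS.measurableSet) (integrableOn_eng hφ.smooth hS)
      ((integrableOn_eng hφ.smooth hT).mono_set Set.sdiff_subset)]
    linarith
  have h1 := h lam hl φ hφ
  have h2 := h' lam hl φ hφ
  have hDφ := hD φ
  have h3 : exp (B * (1 + lam)) * D φ ≤ exp (max B B' * (1 + lam)) * D φ := by
    have := le_max_left B B'
    gcongr
  have h4 : exp (B' * (1 + lam)) * D φ ≤ exp (max B B' * (1 + lam)) * D φ := by
    have := le_max_right B B'
    gcongr
  linarith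

lemma Ctrl.of_locally {Ω : Set E2} {D : (E2 → ℝ) → ℝ} (hD : ∀ φ, 0 ≤ D φ) {K : Set E2}
    (hK : IsCompact K) (h : ∀ x ∈ K, ∃ ρ > 0, Ctrl Ω D (Metric.closedBall x ρ)) :
    Ctrl Ω D K := by
  have key : ∃ S, K ⊆ S ∧ IsCompact S ∧ Ctrl Ω D S := by
    refine hK.induction_on (p := fun K => ∃ S, K ⊆ S ∧ IsCompact S ∧ Ctrl Ω D S) ?_ ?_ ?_ ?_
    · refine ⟨∅, subset_rfl, isCompact_empty, fun A => ⟨0, le_rfl, fun lam _ φ _ => ?_⟩⟩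
      have h1 := setIntegral_eng_nonneg (closure Ω) φ
      have h2 := hD φ
      simp only [Measure.restrict_empty, integral_zero_measure]
      positivity
    · rintro s t hst ⟨S, h1, h2⟩
      exact ⟨S, hst.trans h1, h2⟩
    · rintro s t ⟨S, h1, h2, h3⟩ ⟨T, h4, h5, h6⟩
      exact ⟨S ∪ T, Set.union_subset_union h1 h4, h2.union h5, h3.union hD h2 h5 h6⟩
    · intro x hx
      obtain ⟨ρ, hρ, h⟩ := h x hx
      exact ⟨Metric.closedBall x ρ, mem_nhdsWithin_of_mem_nhds (Metric.closedBall_mem_nhds x hρ),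
        Metric.closedBall x ρ, subset_rfl, isCompact_closedBall x ρ, h⟩
  obtain ⟨S, h1, h2, h3⟩ := key
  exact h3.mono h2 h1

lemma exists_tau {δ C τ₀ : ℝ} (c : ℝ) (hδ : 0 < δ) (hC : 0 ≤ C) (hc : 0 ≤ c) (A : ℝ) :
    ∃ B : ℝ, 0 ≤ B ∧ ∀ lam : ℝ, 0 ≤ lam → ∃ τ, τ₀ * (1 + |lam|) ≤ τ ∧
      C * exp (-(δ * τ)) ≤ exp (-(A * (1 + lam))) ∧ C * exp (c * τ) ≤ exp (B * (1 + lam)) := by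
  set t := max (max τ₀ 0) ((A + log (C + 1)) / δ) with ht
  have ht0 : 0 ≤ t := (le_max_right _ _).trans (le_max_left _ _)
  have ht1 : τ₀ ≤ t := (le_max_left _ _).trans (le_max_left _ _)
  have ht2 : A + log (C + 1) ≤ δ * t := by
    have := le_max_right (max τ₀ 0) ((A + log (C + 1)) / δ)
    rw [div_le_iff₀ hδ] at this
    linarith
  have h0 : 0 ≤ log (C + 1) := log_nonneg (by linarith)
  refine ⟨c * t + log (C + 1), by positivity, fun lam hl => ⟨t * (1 + lam), ?_, ?_, ?_⟩⟩
  · rw [abs_of_nonneg hl]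
    gcongr
  · refine (mul_le_mul_of_nonneg_right (exp_log_absorb hC hl) (exp_pos _).le).trans ?_
    rw [← exp_add]
    refine exp_le_exp.2 ?_
    nlinarith [mul_le_mul_of_nonneg_right ht2 (by linarith : 0 ≤ 1 + lam)]
  · refine (mul_le_mul_of_nonneg_right (exp_log_absorb hC hl) (exp_pos _).le).trans ?_
    rw [← exp_add]
    refine exp_le_exp.2 ?_
    ring_nf
    rfl

namespace Frame
variable (F : Frame)

lemma fderiv_X (p v : ℝ × ℝ) :
    fderiv ℝ F.X p v = (v.1 * F.g p) • F.T p.1 + v.2 • F.N p.1 := by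
  have hd := (F.contDiff_X.differentiable (by simp) p).hasFDerivAt
  have h1 : fderiv ℝ F.X p (1, 0) = F.g p • F.T p.1 := by
    have h := HasFDerivAt.comp_hasDerivAt p.1 (f := fun t => ((t, p.2) : ℝ × ℝ)) hd
      ((hasDerivAt_id p.1).prodMk (hasDerivAt_const p.1 p.2))
    exact h.unique (F.hasDerivAt_X_fst p)
  have h2 : fderiv ℝ F.X p (0, 1) = F.N p.1 := by
    have h := HasFDerivAt.comp_hasDerivAt p.2 (f := fun t => ((p.1, t) : ℝ × ℝ)) hd
      ((hasDerivAt_const p.2 p.1).prodMk (hasDerivAt_id p.2))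
    exact h.unique (F.hasDerivAt_X_snd p)
  have h3 : v = v.1 • ((1, 0) : ℝ × ℝ) + v.2 • ((0, 1) : ℝ × ℝ) := by
    ext <;> simp
  conv_lhs => rw [h3]
  rw [map_add, map_smul, map_smul, h1, h2, smul_smul]

lemma frame_indep (s : ℝ) {u v : ℝ} (h : u • F.T s + v • F.N s = 0) : u = 0 ∧ v = 0 := by
  have h0 : u * F.T s 0 + v * F.N s 0 = 0 := by simpa using congrArg (fun w : E2 => w 0) h
  have h1 : u * F.T s 1 + v * F.N s 1 = 0 := by simpa using congrArg (fun w : E2 => w 1) h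
  have hT := F.T_unit s
  have hσ := F.σ_sq
  rw [F.N_zero] at h0
  rw [F.N_one] at h1
  constructor
  · linear_combination (-u) * hT + F.T s 0 * h0 + F.T s 1 * h1
  · linear_combination (-v) * hT - v * (F.T s 0 ^ 2 + F.T s 1 ^ 2) * hσ
      - F.σ * F.T s 1 * h0 + F.σ * F.T s 0 * h1

lemma injective_fderiv_X {p : ℝ × ℝ} (h : F.g p ≠ 0) : Function.Injective (fderiv ℝ F.X p) := by
  rw [injective_iff_map_eq_zero]
  intro v hv
  rw [F.fderiv_X] at hv
  obtain ⟨h1, h2⟩ := F.frame_indep _ hv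
  ext
  · simpa [h] using h1
  · exact h2

lemma exists_transfer {R : ℝ} (hg : ∀ p ∈ rect F.ℓ 0 R, 1 / 2 ≤ F.g p) {r₀ r₁ : ℝ} (h₀ : 0 ≤ r₀)
    (h₁ : r₁ ≤ R) : ∃ C : ℝ, 0 ≤ C ∧ ∀ φ : E2 → ℝ, ContDiff ℝ ∞ φ →
      ∫ x in F.X '' rect F.ℓ r₀ r₁, eng φ x ≤ C * ∫ p in rect F.ℓ r₀ r₁, den (F.pull φ) p ∧
      ∫ p in rect F.ℓ r₀ r₁, den (F.pull φ) p ≤ C * ∫ x in F.X '' rect F.ℓ r₀ r₁, eng φ x := by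
  have hsub := rect_subset (ℓ := F.ℓ) h₀ h₁
  have hK := isCompact_rect F.ℓ r₀ r₁
  obtain ⟨C, hC, h⟩ := exists_integral_comp F.contDiff_X hK fun p hp =>
    F.injective_fderiv_X (by linarith [hg p (hsub hp)])
  obtain ⟨G, hG, h'⟩ := F.exists_den_le R
  refine ⟨4 * C + G * C, by positivity, fun φ hφ => ?_⟩
  obtain ⟨h1, h2⟩ := h (eng φ) (continuous_eng hφ) (eng_nonneg φ)
  have i1 : IntegrableOn (fun p => eng φ (F.X p)) (rect F.ℓ r₀ r₁) :=
    ((continuous_eng hφ).comp F.contDiff_X.continuous).integrableOn_rect _ _ _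
  have i2 : IntegrableOn (den (F.pull φ)) (rect F.ℓ r₀ r₁) :=
    (continuous_den (F.contDiff_pull hφ)).integrableOn_rect _ _ _
  have n1 : 0 ≤ ∫ p in rect F.ℓ r₀ r₁, den (F.pull φ) p := integral_nonneg fun p => den_nonneg _ p
  have n2 := setIntegral_eng_nonneg (F.X '' rect F.ℓ r₀ r₁) φ
  have e1 : ∫ p in rect F.ℓ r₀ r₁, eng φ (F.X p)
      ≤ 4 * ∫ p in rect F.ℓ r₀ r₁, den (F.pull φ) p := by
    rw [← integral_const_mul]
    exact setIntegral_mono_on i1 (i2.const_mul 4) hK.measurableSet fun p hp =>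
      F.eng_le_den hφ (hg p (hsub hp))
  have e2 : ∫ p in rect F.ℓ r₀ r₁, den (F.pull φ) p
      ≤ G * ∫ p in rect F.ℓ r₀ r₁, eng φ (F.X p) := by
    rw [← integral_const_mul]
    exact setIntegral_mono_on i2 (i1.const_mul G) hK.measurableSet fun p hp => h' φ hφ p (hsub hp)
  have e3 := mul_le_mul_of_nonneg_left e1 hC
  have e4 := mul_le_mul_of_nonneg_left h1 hG
  have n3 : 0 ≤ G * C * ∫ p in rect F.ℓ r₀ r₁, den (F.pull φ) p := by positivity
  have n4 : 0 ≤ 4 * C * ∫ x in F.X '' rect F.ℓ r₀ r₁, eng φ x := by positivity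
  constructor
  · linarith
  · linarith

/-- The Cauchy data of a function along the curve. -/
def cauchy (φ : E2 → ℝ) : ℝ :=
  ∫ s in (0 : ℝ)..F.ℓ, (φ (F.q s) ^ 2 + fderiv ℝ φ (F.q s) (F.N s) ^ 2)

lemma cauchy_nonneg (φ : E2 → ℝ) : 0 ≤ F.cauchy φ :=
  intervalIntegral.integral_nonneg F.ℓ_pos.le fun s _ => by positivity

lemma X_zero (s : ℝ) : F.X (s, 0) = F.q s := by simp [X]

variable {Ω : Set E2}

lemma ctrl_data (hΩ : IsCompact (closure Ω)) {R : ℝ} (hR : 0 < R)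
    (hg : ∀ p ∈ rect F.ℓ 0 R, 1 / 2 ≤ F.g p) (hX : F.X '' rect F.ℓ 0 R ⊆ closure Ω) :
    Ctrl Ω F.cauchy (F.X '' rect F.ℓ 0 (R / 4)) := by
  obtain ⟨B, hB, hsol⟩ := F.exists_stripSol hg
  obtain ⟨γ, τ₀, hco⟩ := exists_stripCoef F.ℓ_pos hR F.contDiff_a F.per_a F.a_pos B
  obtain ⟨δ, hδ, C, hC, hest⟩ := hco.data F.ℓ_pos hR hB F.a_pos
  obtain ⟨C₁, hC₁, htr₁⟩ := F.exists_transfer hg le_rfl (by linarith : R / 4 ≤ R)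
  obtain ⟨C₂, hC₂, htr₂⟩ := F.exists_transfer hg le_rfl le_rfl
  refine Ctrl.of_le F.cauchy_nonneg ⟨C₁ * (C₂ + 1), by positivity, fun A => ?_⟩
  obtain ⟨B', hB', htau⟩ := exists_tau (τ₀ := τ₀) 3 hδ hC (by norm_num) A
  refine ⟨B', hB', fun lam hl φ hφ => ?_⟩
  obtain ⟨τ, hτ, hτ1, hτ2⟩ := htau lam hl
  have hs := hsol lam φ hφ.smooth fun p hp => hφ.eq _ (hX ⟨p, hp, rfl⟩)
  have h1 := hest lam τ hτ _ hs
  have h2 : ∫ s in (0 : ℝ)..F.ℓ, (F.pull φ (s, 0) ^ 2 + pdR (F.pull φ) (s, 0) ^ 2)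
      = F.cauchy φ := by
    simp only [F.pdR_pull hφ.smooth, pull, F.X_zero, cauchy]
  rw [h2] at h1
  have h3 := (htr₁ φ hφ.smooth).1
  have h4 := (htr₂ φ hφ.smooth).2
  have h5 := setIntegral_eng_mono hφ.smooth hΩ hX
  have n1 := F.cauchy_nonneg φ
  have n2 := setIntegral_eng_nonneg (closure Ω) φ
  set M := ∫ x in closure Ω, eng φ x
  have n3 : 0 ≤ ∫ p in rect F.ℓ 0 R, den (F.pull φ) p := integral_nonneg fun p => den_nonneg _ p
  have h6 : ∫ p in rect F.ℓ 0 R, den (F.pull φ) p ≤ (C₂ + 1) * M := by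
    have := mul_le_mul_of_nonneg_left h5 hC₂
    linarith
  refine h3.trans ?_
  rw [mul_assoc]
  refine mul_le_mul_of_nonneg_left (h1.trans ?_) hC₁
  have e1 := mul_le_mul hτ1 h6 n3 (exp_pos _).le
  have e2 := mul_le_mul_of_nonneg_right hτ2 n1
  have e3 : 0 ≤ C₂ * (exp (B' * (1 + lam)) * F.cauchy φ) := by positivity
  linarith

lemma ctrl_annulus (hΩ : IsCompact (closure Ω)) {D : (E2 → ℝ) → ℝ} (hD : ∀ φ, 0 ≤ D φ)
    {r₂ r₃ R : ℝ} (h₂ : 0 < r₂) (h₃ : r₂ < r₃) (hR : r₃ < R)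
    (hg : ∀ p ∈ rect F.ℓ 0 R, 1 / 2 ≤ F.g p) (hX : F.X '' rect F.ℓ 0 R ⊆ closure Ω)
    (hc : Ctrl Ω D (F.X '' rect F.ℓ 0 r₂)) :
    Ctrl Ω D (F.X '' rect F.ℓ r₂ r₃) := by
  obtain ⟨B, hB, hsol⟩ := F.exists_stripSol hg
  have hR0 : 0 < R := by linarith
  obtain ⟨γ, τ₀, hco⟩ := exists_stripCoef F.ℓ_pos hR0 F.contDiff_a F.per_a F.a_pos B
  obtain ⟨δ, hδ, C, hC, hest⟩ := hco.annulus hB h₂ h₃ hR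
  obtain ⟨C₁, hC₁, htr₁⟩ := F.exists_transfer hg h₂.le hR.le
  obtain ⟨C₂, hC₂, htr₂⟩ := F.exists_transfer hg le_rfl le_rfl
  obtain ⟨C₃, hC₃, htr₃⟩ := F.exists_transfer hg le_rfl (by linarith : r₂ ≤ R)
  refine Ctrl.of_le hD ⟨C₁ * (C₂ + C₃), by positivity, fun A => ?_⟩
  obtain ⟨B', hB', htau⟩ := exists_tau (τ₀ := τ₀) 2 hδ hC (by norm_num) A
  obtain ⟨B'', hB'', hcs⟩ := hc (A + B')
  refine ⟨B' + B'', by positivity, fun lam hl φ hφ => ?_⟩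
  obtain ⟨τ, hτ, hτ1, hτ2⟩ := htau lam hl
  have hs := hsol lam φ hφ.smooth fun p hp => hφ.eq _ (hX ⟨p, hp, rfl⟩)
  have h1 := hest lam τ hτ _ hs
  have h3 := (htr₁ φ hφ.smooth).1
  have h4 := (htr₂ φ hφ.smooth).2
  have h5 := setIntegral_eng_mono hφ.smooth hΩ hX
  have h7 := (htr₃ φ hφ.smooth).2
  have h8 := hcs lam hl φ hφ
  have n1 := hD φ
  have n2 := setIntegral_eng_nonneg (closure Ω) φ
  set M := ∫ x in closure Ω, eng φ x
  have n3 : 0 ≤ ∫ p in rect F.ℓ 0 R, den (F.pull φ) p := integral_nonneg fun p => den_nonneg _ p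
  have n4 : 0 ≤ ∫ p in rect F.ℓ 0 r₂, den (F.pull φ) p := integral_nonneg fun p => den_nonneg _ p
  have h6 : ∫ p in rect F.ℓ 0 R, den (F.pull φ) p ≤ C₂ * M :=
    h4.trans (mul_le_mul_of_nonneg_left h5 hC₂)
  have h9 := h7.trans (mul_le_mul_of_nonneg_left h8 hC₃)
  refine h3.trans ?_
  rw [mul_assoc]
  refine mul_le_mul_of_nonneg_left (h1.trans ?_) hC₁
  have e1 := mul_le_mul hτ1 h6 n3 (exp_pos _).le
  have e2 := mul_le_mul hτ2 h9 n4 (exp_pos _).le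
  have e4 : exp (B' * (1 + lam)) * exp (-((A + B') * (1 + lam))) = exp (-(A * (1 + lam))) := by
    rw [← exp_add]; ring_nf
  have e5 : exp (B' * (1 + lam)) * exp (B'' * (1 + lam)) = exp ((B' + B'') * (1 + lam)) := by
    rw [← exp_add]; ring_nf
  have e6 : exp (B' * (1 + lam)) * (C₃ * (exp (-((A + B') * (1 + lam))) * M
      + exp (B'' * (1 + lam)) * D φ)) = C₃ * (exp (-(A * (1 + lam))) * M
      + exp ((B' + B'') * (1 + lam)) * D φ) := by
    rw [← e4, ← e5]; ring
  rw [e6] at e2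
  have e3 : 0 ≤ C₂ * (exp ((B' + B'') * (1 + lam)) * D φ) := by positivity
  linarith

lemma exists_neumann_bound {R : ℝ} (hR : 0 < R) (hg : ∀ p ∈ rect F.ℓ 0 R, 1 / 2 ≤ F.g p)
    (hX : F.X '' rect F.ℓ 0 R ⊆ closure Ω) :
    ∃ C : ℝ, 0 ≤ C ∧ ∀ lam : ℝ, 0 ≤ lam → ∀ φ, IsSol Ω lam φ →
      (∀ s, fderiv ℝ φ (F.q s) (F.N s) = 0) →
      ∫ p in rect F.ℓ 0 (R / 4), den (F.pull φ) p
        ≤ exp (C * (1 + lam)) * ∫ x in F.X '' rect F.ℓ (R / 4) R, eng φ x := by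
  obtain ⟨B, hB, hsol⟩ := F.exists_stripSol hg
  obtain ⟨γ, τ₀, hco⟩ := exists_stripCoef F.ℓ_pos hR F.contDiff_a F.per_a F.a_pos B
  obtain ⟨C, hC, hest⟩ := hco.neumann hR hB F.contDiff_a
  obtain ⟨C₂, hC₂, htr₂⟩ := F.exists_transfer hg (by linarith : 0 ≤ R / 4) le_rfl
  have h0 : 0 ≤ log (C * C₂ + 1) := log_nonneg (by nlinarith [mul_nonneg hC hC₂])
  refine ⟨log (C * C₂ + 1) + C, by positivity, fun lam hl φ hφ hN => ?_⟩
  have hs := hsol lam φ hφ.smooth fun p hp => hφ.eq _ (hX ⟨p, hp, rfl⟩)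
  have h1 := hest lam _ hs fun s => by rw [F.pdR_pull hφ.smooth, F.X_zero]; exact hN s
  have h2 := (htr₂ φ hφ.smooth).2
  rw [abs_of_nonneg hl] at h1
  have n1 := setIntegral_eng_nonneg (F.X '' rect F.ℓ (R / 4) R) φ
  calc _ ≤ _ := h1
    _ ≤ C * exp (C * (1 + lam)) * (C₂ * ∫ x in F.X '' rect F.ℓ (R / 4) R, eng φ x) := by
        gcongr
    _ = C * C₂ * exp (C * (1 + lam)) * ∫ x in F.X '' rect F.ℓ (R / 4) R, eng φ x := by ring
    _ ≤ exp (log (C * C₂ + 1) * (1 + lam)) * exp (C * (1 + lam))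
        * ∫ x in F.X '' rect F.ℓ (R / 4) R, eng φ x := by
        have := exp_log_absorb (mul_nonneg hC hC₂) hl
        gcongr
    _ = _ := by rw [← exp_add, ← add_mul]

end Frame

lemma norm_sq_E2 (v : E2) : ‖v‖ ^ 2 = v 0 ^ 2 + v 1 ^ 2 := by
  rw [EuclideanSpace.norm_sq_eq]
  simp

lemma inner_E2 (u v : E2) : ⟪u, v⟫ = u 0 * v 0 + u 1 * v 1 := by
  rw [PiLp.inner_apply]
  simp [mul_comm]

lemma contDiff_coord (i : Fin 2) : ContDiff ℝ ∞ fun v : E2 => v i :=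
  (PiLp.proj (𝕜 := ℝ) 2 (fun _ : Fin 2 => ℝ) i).contDiff

lemma hasDerivAt_coord {f : ℝ → E2} {f' : E2} {s : ℝ} (h : HasDerivAt f f' s) (i : Fin 2) :
    HasDerivAt (fun t => f t i) (f' i) s :=
  (PiLp.proj (𝕜 := ℝ) 2 (fun _ : Fin 2 => ℝ) i).hasFDerivAt.comp_hasDerivAt s h

lemma contDiff_deriv_E2 {f : ℝ → E2} (hf : ContDiff ℝ ∞ f) : ContDiff ℝ ∞ (deriv f) :=
  (contDiff_infty_iff_deriv.1 hf).2

/-- The rotation by a right angle. -/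
def rot (v : E2) : E2 := (-v 1) • ee 0 + v 0 • ee 1

lemma rot_zero (v : E2) : rot v 0 = -v 1 := by simp [rot, ee]

lemma rot_one (v : E2) : rot v 1 = v 0 := by simp [rot, ee]

lemma ext_E2 {u v : E2} (h0 : u 0 = v 0) (h1 : u 1 = v 1) : u = v := by
  ext i
  fin_cases i
  · exact h0
  · exact h1

lemma hasDerivAt_rot {f : ℝ → E2} {f' : E2} {s : ℝ} (h : HasDerivAt f f' s) :
    HasDerivAt (fun t => rot (f t)) (rot f') s :=
  ((hasDerivAt_coord h 1).neg.smul_const (ee 0)).add ((hasDerivAt_coord h 0).smul_const (ee 1))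

lemma contDiff_rot {f : ℝ → E2} (h : ContDiff ℝ ∞ f) : ContDiff ℝ ∞ fun t => rot (f t) :=
  (((contDiff_coord 1).comp h).neg.smul contDiff_const).add
    (((contDiff_coord 0).comp h).smul contDiff_const)

namespace Frame

/-- The frame of a smooth periodic unit speed curve with the normal on a prescribed side. -/
def ofCurve (ℓ : ℝ) (hℓ : 0 < ℓ) (q T : ℝ → E2) (hq : ContDiff ℝ ∞ q)
    (hd : ∀ s, HasDerivAt q (T s) s) (hper : ∀ s, q (s + ℓ) = q s) (hT : ∀ s, ‖T s‖ = 1)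
    (σ : ℝ) (hσ : σ ^ 2 = 1) : Frame :=
  have hTe : deriv q = T := funext fun s => (hd s).deriv
  have hTs : ContDiff ℝ ∞ T := hTe ▸ contDiff_deriv_E2 hq
  have hTu : ∀ s, T s 0 ^ 2 + T s 1 ^ 2 = 1 := fun s => by rw [← norm_sq_E2, hT, one_pow]
  have hTp : ∀ s, T (s + ℓ) = T s := fun s => by
    have h1 := (hd (s + ℓ)).comp_add_const s ℓ
    have h2 : (fun t => q (t + ℓ)) = q := funext hper
    rw [h2] at h1
    exact h1.unique (hd s)
  have hT' : ∀ s, HasDerivAt T (deriv T s) s := fun s =>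
    (hTs.differentiable (by simp) s).hasDerivAt
  have horth : ∀ s, T s 0 * deriv T s 0 + T s 1 * deriv T s 1 = 0 := fun s => by
    have h1 := ((hasDerivAt_coord (hT' s) 0).fun_pow 2).fun_add
      ((hasDerivAt_coord (hT' s) 1).fun_pow 2)
    have h2 : (fun t => T t 0 ^ 2 + T t 1 ^ 2) = fun _ => (1 : ℝ) := funext hTu
    rw [h2] at h1
    have h3 := h1.unique (hasDerivAt_const s 1)
    simp only [Nat.cast_ofNat, Nat.add_one_sub_one, pow_one] at h3
    linarith
  have key : ∀ s, deriv T s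
      = (σ * (T s 0 * deriv T s 1 - T s 1 * deriv T s 0)) • σ • rot (T s) := fun s => by
    have h1 := hTu s
    have h2 := horth s
    apply ext_E2
    · simp only [PiLp.smul_apply, smul_eq_mul, rot_zero]
      linear_combination (-deriv T s 0) * h1 + T s 0 * h2 +
        (T s 0 * deriv T s 1 - T s 1 * deriv T s 0) * T s 1 * hσ
    · simp only [PiLp.smul_apply, smul_eq_mul, rot_one]
      linear_combination (-deriv T s 1) * h1 + T s 1 * h2 -
        (T s 0 * deriv T s 1 - T s 1 * deriv T s 0) * T s 0 * hσ
  { ℓ := ℓ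
    q := q
    T := T
    N := fun s => σ • rot (T s)
    κ := fun s => σ * (T s 0 * deriv T s 1 - T s 1 * deriv T s 0)
    σ := σ
    ℓ_pos := hℓ
    q_smooth := hq
    T_smooth := hTs
    N_smooth := (contDiff_rot hTs).const_smul σ
    κ_smooth := by
      have h := contDiff_deriv_E2 hTs
      exact contDiff_const.mul ((((contDiff_coord 0).comp hTs).mul ((contDiff_coord 1).comp h)).sub
        (((contDiff_coord 1).comp hTs).mul ((contDiff_coord 0).comp h)))
    q_deriv := hd
    T_deriv := fun s => by
      rw [← key s]
      exact hT' s
    N_deriv := fun s => by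
      have h := (hasDerivAt_rot (hT' s)).const_smul σ
      have e : σ • rot (deriv T s)
          = -(σ * (T s 0 * deriv T s 1 - T s 1 * deriv T s 0)) • T s := by
        have h1 := hTu s
        have h2 := horth s
        apply ext_E2
        · simp only [PiLp.smul_apply, smul_eq_mul, rot_zero]
          linear_combination (σ * deriv T s 1) * h1 - σ * T s 1 * h2
        · simp only [PiLp.smul_apply, smul_eq_mul, rot_one]
          linear_combination (-σ * deriv T s 0) * h1 + σ * T s 0 * h2
      rw [← e]
      exact h
    q_per := hper
    N_per := fun s => by simp only [hTp]
    κ_per := fun s => by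
      have e : deriv T (s + ℓ) = deriv T s := by
        have h1 := (hT' (s + ℓ)).comp_add_const s ℓ
        have h2 : (fun t => T (t + ℓ)) = T := funext hTp
        rw [h2] at h1
        exact h1.unique (hT' s)
      simp only [hTp, e]
    T_unit := hTu
    σ_sq := hσ
    N_zero := fun s => by simp [rot_zero]
    N_one := fun s => by simp [rot_one] }

variable (F : Frame)

lemma norm_N (s : ℝ) : ‖F.N s‖ = 1 := by
  have h : ‖F.N s‖ ^ 2 = 1 := by
    rw [norm_sq_E2, F.N_zero, F.N_one, neg_sq, mul_pow, mul_pow, F.σ_sq, one_mul, one_mul,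
      add_comm, F.T_unit]
  exact (pow_eq_one_iff_of_nonneg (norm_nonneg _) two_ne_zero).1 h

/-- A unit vector orthogonal to the tangent is a normal. -/
lemma eq_or_eq_neg_N {s : ℝ} {v : E2} (hv : ‖v‖ = 1) (ho : ⟪v, F.T s⟫ = 0) :
    v = F.N s ∨ v = -F.N s := by
  have h1 : v 0 ^ 2 + v 1 ^ 2 = 1 := by rw [← norm_sq_E2, hv, one_pow]
  rw [inner_E2] at ho
  have hT := F.T_unit s
  have hσ := F.σ_sq
  set m := v 0 * F.N s 0 + v 1 * F.N s 1 with hm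
  have e0 : v 0 = m * F.N s 0 := by
    rw [hm, F.N_zero, F.N_one]
    linear_combination (-v 0) * hT + F.T s 0 * ho
      + (-v 0 * F.T s 1 ^ 2 + v 1 * F.T s 0 * F.T s 1) * hσ
  have e1 : v 1 = m * F.N s 1 := by
    rw [hm, F.N_zero, F.N_one]
    linear_combination (-v 1) * hT + F.T s 1 * ho
      + (-v 1 * F.T s 0 ^ 2 + v 0 * F.T s 0 * F.T s 1) * hσ
  have hNn : F.N s 0 ^ 2 + F.N s 1 ^ 2 = 1 := by rw [← norm_sq_E2, norm_N, one_pow]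
  have h2 : m ^ 2 = 1 := by
    rw [e0, e1] at h1
    linear_combination h1 - m ^ 2 * hNn
  rcases sq_eq_one_iff.1 h2 with h | h
  · left
    apply ext_E2
    · rw [e0, h, one_mul]
    · rw [e1, h, one_mul]
  · right
    apply ext_E2
    · rw [e0, h]; simp
    · rw [e1, h]; simp

lemma exists_g_ge : ∃ R₀ > 0, ∀ R ≤ R₀, ∀ p ∈ rect F.ℓ (-R) R, 1 / 2 ≤ F.g p := by
  obtain ⟨k, hk⟩ := isCompact_Icc (a := (0 : ℝ)) (b := F.ℓ) |>.exists_bound_of_continuousOn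
    F.κ_smooth.continuous.continuousOn
  have hk' : 0 < 2 * (|k| + 1) := by positivity
  refine ⟨1 / (2 * (|k| + 1)), by positivity, fun R hR p hp => ?_⟩
  obtain ⟨h1, h2⟩ := mem_rect.1 hp
  have h3 := hk p.1 h1
  rw [Real.norm_eq_abs] at h3
  have h4 : |p.2| ≤ R := abs_le.2 h2
  have h5 : |F.κ p.1 * p.2| ≤ (|k| + 1) * (1 / (2 * (|k| + 1))) := by
    rw [abs_mul]
    have := le_abs_self k
    exact mul_le_mul (by linarith) (h4.trans hR) (abs_nonneg _) (by positivity)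
  have h6 : (|k| + 1) * (1 / (2 * (|k| + 1))) = 1 / 2 := by field_simp
  rw [h6] at h5
  have := (abs_le.1 h5).2
  rw [g]
  linarith

/-- Fermi coordinates are a local homeomorphism. -/
lemma exists_localHomeo {p : ℝ × ℝ} (hp : F.g p ≠ 0) :
    ∃ e : OpenPartialHomeomorph (ℝ × ℝ) E2, p ∈ e.source ∧ ⇑e = F.X := by
  have hs := (F.contDiff_X.contDiffAt (x := p)).hasStrictFDerivAt (by simp)
  have hinj : Function.Injective (fderiv ℝ F.X p : ℝ × ℝ →ₗ[ℝ] E2) := F.injective_fderiv_X hp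
  set L := (LinearMap.linearEquivOfInjective (fderiv ℝ F.X p : ℝ × ℝ →ₗ[ℝ] E2) hinj
    (by simp)).toContinuousLinearEquiv with hL
  have e1 : (L : ℝ × ℝ →L[ℝ] E2) = fderiv ℝ F.X p := by
    ext v <;> rfl
  rw [← e1] at hs
  exact ⟨hs.toOpenPartialHomeomorph F.X, hs.mem_toOpenPartialHomeomorph_source, rfl⟩

lemma trace_le {r₁ : ℝ} (h : 0 < r₁) {φ : E2 → ℝ} (hφ : ContDiff ℝ ∞ φ) :
    r₁ * ∫ s in (0 : ℝ)..F.ℓ, φ (F.q s) ^ 2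
      ≤ (1 + r₁) * ∫ p in rect F.ℓ 0 r₁, den (F.pull φ) p := by
  have hf := F.contDiff_pull hφ
  set f := F.pull φ with hfd
  have hG : ContDiff ℝ ∞ fun p : ℝ × ℝ => (p.2 - r₁) * f p ^ 2 :=
    (contDiff_snd.sub contDiff_const).mul (hf.pow 2)
  have hdiv := integral_div_rect F.ℓ_pos.le h.le (F := fun _ => 0) contDiff_const hG
    (fun s r => rfl)
  have h1 : ∀ p : ℝ × ℝ, pdR (fun p : ℝ × ℝ => (p.2 - r₁) * f p ^ 2) p
      = f p ^ 2 + (p.2 - r₁) * (2 * f p * pdR f p) := by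
    intro p
    refine pdR_eq_of_hasDerivAt (hG.differentiable (by simp) p) ?_
    have h2 := ((hasDerivAt_id p.2).sub_const r₁).fun_mul
      ((hasDerivAt_pdR (hf.differentiable (by simp) p)).fun_pow 2)
    have e : f p ^ 2 + (p.2 - r₁) * (2 * f p * pdR f p)
        = 1 * f (p.1, p.2) ^ 2
          + (id p.2 - r₁) * (((2 : ℕ) : ℝ) * f (p.1, p.2) ^ (2 - 1) * pdR f p) := by
      simp
    rw [e]
    exact h2
  have h2 : ∀ p : ℝ × ℝ, pdS (fun _ : ℝ × ℝ => (0 : ℝ)) p = 0 := fun p => by simp [pdS]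
  simp only [h1, h2, zero_add, sub_self, zero_mul, intervalIntegral.integral_zero, zero_sub]
    at hdiv
  rw [intervalIntegral.integral_const_mul] at hdiv
  have h3 : ∀ s, f (s, 0) = φ (F.q s) := fun s => by rw [hfd, pull, F.X_zero]
  simp only [h3] at hdiv
  have h4 : r₁ * ∫ s in (0 : ℝ)..F.ℓ, φ (F.q s) ^ 2
      = ∫ p in rect F.ℓ 0 r₁, (f p ^ 2 + (p.2 - r₁) * (2 * f p * pdR f p)) := by
    rw [hdiv]; ring
  rw [h4, ← integral_const_mul]
  have c1 := hf.continuous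
  have c2 := (contDiff_pdR hf).continuous
  refine setIntegral_mono_on (Continuous.integrableOn_rect (by fun_prop) _ _ _)
    (((continuous_den hf).integrableOn_rect _ _ _).const_mul _)
    (measurableSet_rect _ _ _) fun p hp => ?_
  obtain ⟨-, h5, h6⟩ := mem_rect.1 hp
  have h7 : 2 * (f p * pdR f p) ≤ den f p ∧ -(2 * (f p * pdR f p)) ≤ den f p := by
    constructor <;> simp only [den] <;>
      nlinarith [sq_nonneg (f p - pdR f p), sq_nonneg (f p + pdR f p), sq_nonneg (pdS f p)]
  have h8 : f p ^ 2 ≤ den f p := by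
    simp only [den]
    nlinarith [sq_nonneg (pdR f p), sq_nonneg (pdS f p)]
  have h9 := den_nonneg f p
  have h10 : (p.2 - r₁) * (2 * f p * pdR f p) ≤ r₁ * den f p := by
    have := mul_le_mul_of_nonneg_left h7.2 (by linarith : 0 ≤ r₁ - p.2)
    nlinarith [mul_nonneg h5 h9]
  linarith

end Frame

/-- The unit vector of angle `t`. -/
def uvec (t : ℝ) : E2 := cos t • ee 0 + sin t • ee 1

lemma uvec_zero (t : ℝ) : uvec t 0 = cos t := by simp [uvec, ee]

lemma uvec_one (t : ℝ) : uvec t 1 = sin t := by simp [uvec, ee]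

lemma norm_uvec (t : ℝ) : ‖uvec t‖ = 1 := by
  have h : ‖uvec t‖ ^ 2 = 1 := by rw [norm_sq_E2, uvec_zero, uvec_one, cos_sq_add_sin_sq]
  exact (pow_eq_one_iff_of_nonneg (norm_nonneg _) two_ne_zero).1 h

lemma contDiff_uvec : ContDiff ℝ ∞ uvec :=
  (contDiff_cos.smul contDiff_const).add (contDiff_sin.smul contDiff_const)

lemma hasDerivAt_uvec (t : ℝ) : HasDerivAt uvec (rot (uvec t)) t := by
  have h := ((hasDerivAt_cos t).smul_const (ee 0)).add ((hasDerivAt_sin t).smul_const (ee 1))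
  have e : rot (uvec t) = (-sin t) • ee 0 + cos t • ee 1 := by
    rw [rot, uvec_zero, uvec_one]
  rw [e]
  exact h

lemma rot_rot (v : E2) : rot (rot v) = -v :=
  ext_E2 (by simp [rot_zero, rot_one]) (by simp [rot_zero, rot_one])

lemma norm_rot (v : E2) : ‖rot v‖ = ‖v‖ := by
  have h : ‖rot v‖ ^ 2 = ‖v‖ ^ 2 := by
    rw [norm_sq_E2, norm_sq_E2, rot_zero, rot_one]; ring
  exact (sq_eq_sq₀ (norm_nonneg _) (norm_nonneg _)).1 h

lemma exists_eq_uvec (v : E2) : ∃ t, 0 ≤ t ∧ t ≤ 2 * π ∧ v = ‖v‖ • uvec t := by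
  set z : ℂ := ⟨v 0, v 1⟩ with hz
  have hn : ‖z‖ = ‖v‖ := by
    have h : ‖z‖ ^ 2 = ‖v‖ ^ 2 := by
      rw [norm_sq_E2, ← Complex.normSq_eq_norm_sq, Complex.normSq_apply]; ring
    exact (sq_eq_sq₀ (norm_nonneg _) (norm_nonneg _)).1 h
  have h0 : v 0 = ‖v‖ * cos z.arg := by
    rw [← hn, Complex.norm_mul_cos_arg]
  have h1 : v 1 = ‖v‖ * sin z.arg := by
    rw [← hn, Complex.norm_mul_sin_arg]
  have h2 := Complex.neg_pi_lt_arg z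
  have h3 := Complex.arg_le_pi z
  rcases le_or_gt 0 z.arg with h | h
  · refine ⟨z.arg, h, by linarith [pi_pos], ext_E2 ?_ ?_⟩
    · simpa [uvec_zero] using h0
    · simpa [uvec_one] using h1
  · refine ⟨z.arg + 2 * π, by linarith, by linarith, ext_E2 ?_ ?_⟩
    · simpa [uvec_zero] using h0
    · simpa [uvec_one] using h1

namespace Frame

/-- The frame of the circle of centre `y` and radius `ρ` with the outward normal. -/
def circle (y : E2) {ρ : ℝ} (hρ : 0 < ρ) : Frame :=
  ofCurve (2 * π * ρ) (by positivity) (fun s => y + ρ • uvec (s / ρ)) (fun s => rot (uvec (s / ρ)))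
    (contDiff_const.add ((contDiff_uvec.comp (contDiff_id.div_const ρ)).const_smul ρ))
    (fun s => by
      have h := (((hasDerivAt_uvec (s / ρ)).scomp s
        ((hasDerivAt_id s).div_const ρ)).const_smul ρ).const_add y
      have e : ρ • (1 / ρ) • rot (uvec (s / ρ)) = rot (uvec (s / ρ)) := by
        rw [smul_smul, mul_one_div_cancel hρ.ne', one_smul]
      rw [e] at h
      exact h)
    (fun s => by
      have e : (s + 2 * π * ρ) / ρ = s / ρ + 2 * π := by field_simp
      rw [e]
      simp only [uvec, cos_add_two_pi, sin_add_two_pi])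
    (fun s => by rw [norm_rot, norm_uvec]) (-1) (by norm_num)

variable (y : E2) {ρ : ℝ} (hρ : 0 < ρ)

lemma circle_X (p : ℝ × ℝ) : (circle y hρ).X p = y + (ρ + p.2) • uvec (p.1 / ρ) := by
  change (y + ρ • uvec (p.1 / ρ)) + p.2 • (-1 : ℝ) • rot (rot (uvec (p.1 / ρ))) = _
  rw [rot_rot]
  module

lemma circle_g (p : ℝ × ℝ) : (circle y hρ).g p = 1 + p.2 / ρ := by
  have h : deriv (fun s => rot (uvec (s / ρ))) p.1 = (1 / ρ) • -uvec (p.1 / ρ) := by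
    have h := (hasDerivAt_rot (hasDerivAt_uvec (p.1 / ρ))).scomp p.1
        ((hasDerivAt_id p.1).div_const ρ)
    rw [rot_rot] at h
    exact h.deriv
  have h2 : (circle y hρ).κ p.1 = -1 * (rot (uvec (p.1 / ρ)) 0
      * deriv (fun s => rot (uvec (s / ρ))) p.1 1 - rot (uvec (p.1 / ρ)) 1
      * deriv (fun s => rot (uvec (s / ρ))) p.1 0) := rfl
  rw [g, h2, h]
  simp only [rot_zero, rot_one, PiLp.smul_apply, PiLp.neg_apply, smul_eq_mul, uvec_zero, uvec_one]
  have h3 := cos_sq_add_sin_sq (p.1 / ρ)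
  field_simp
  linear_combination p.2 * h3

lemma circle_mem_X_image {x : E2} {r₀ r₁ : ℝ} (h : ρ + r₀ ≤ dist x y) (h' : dist x y ≤ ρ + r₁) :
    x ∈ (circle y hρ).X '' rect (circle y hρ).ℓ r₀ r₁ := by
  obtain ⟨t, h0, h1, h2⟩ := exists_eq_uvec (x - y)
  rw [dist_eq_norm] at h h'
  refine ⟨(ρ * t, ‖x - y‖ - ρ), mem_rect.2 ⟨⟨by positivity, ?_⟩, by linarith, by linarith⟩, ?_⟩
  · change ρ * t ≤ 2 * π * ρ
    nlinarith
  · rw [circle_X]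
    simp only
    rw [mul_div_cancel_left₀ _ hρ.ne', add_sub_cancel, ← h2, add_sub_cancel]

lemma circle_X_image_subset {r₀ r₁ : ℝ} (h : 0 ≤ r₀) :
    (circle y hρ).X '' rect (circle y hρ).ℓ r₀ r₁ ⊆ Metric.closedBall y (ρ + r₁) := by
  rintro _ ⟨p, hp, rfl⟩
  obtain ⟨-, h1, h2⟩ := mem_rect.1 hp
  rw [circle_X, Metric.mem_closedBall, dist_eq_norm, add_sub_cancel_left, norm_smul, norm_uvec,
    mul_one, Real.norm_eq_abs, abs_of_nonneg (by linarith)]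
  linarith

end Frame

lemma Ctrl.ball_of_ball {Ω : Set E2} (hΩ : IsCompact (closure Ω)) {D : (E2 → ℝ) → ℝ}
    (hD : ∀ φ, 0 ≤ D φ) {y : E2} {ρ d : ℝ} (hρ : 0 < ρ) (hρd : ρ ≤ d)
    (hsub : Metric.closedBall y (3 * d) ⊆ closure Ω) (h : Ctrl Ω D (Metric.closedBall y ρ)) :
    Ctrl Ω D (Metric.closedBall y (2 * d)) := by
  have hρ' : 0 < ρ / 2 := by positivity
  set F := Frame.circle y hρ' with hF
  have h1 : Ctrl Ω D (F.X '' rect F.ℓ 0 (ρ / 4)) :=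
    h.mono (isCompact_closedBall y ρ) ((Frame.circle_X_image_subset y hρ' le_rfl).trans
      (Metric.closedBall_subset_closedBall (by linarith)))
  have h2 : Ctrl Ω D (F.X '' rect F.ℓ (ρ / 4) (2 * d - ρ / 2)) := by
    refine F.ctrl_annulus hΩ hD (by positivity) (by linarith)
      (by linarith : 2 * d - ρ / 2 < 3 * d - ρ / 2) (fun p hp => ?_) ?_ h1
    · rw [hF, Frame.circle_g]
      have : 0 ≤ p.2 / (ρ / 2) := div_nonneg (mem_rect.1 hp).2.1 hρ'.le
      linarith
    · exact (Frame.circle_X_image_subset y hρ' le_rfl).trans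
        ((Metric.closedBall_subset_closedBall (by linarith)).trans hsub)
  have hK : IsCompact (F.X '' rect F.ℓ (ρ / 4) (2 * d - ρ / 2)) :=
    (isCompact_rect _ _ _).image F.contDiff_X.continuous
  refine (h.union hD (isCompact_closedBall y ρ) hK h2).mono ((isCompact_closedBall y ρ).union hK)
    fun x hx => ?_
  rcases le_or_gt (dist x y) ρ with hle | hlt
  · exact Or.inl hle
  · exact Or.inr (Frame.circle_mem_X_image y hρ' (by linarith)
      (by linarith [Metric.mem_closedBall.1 hx]))

lemma Ctrl.of_connected {Ω : Set E2} (hΩ : IsPlaneDomain Ω) {D : (E2 → ℝ) → ℝ}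
    (hD : ∀ φ, 0 ≤ D φ) (h : ∃ x ∈ Ω, ∃ ρ > 0, Ctrl Ω D (Metric.closedBall x ρ)) :
    ∀ x ∈ Ω, ∃ ρ > 0, Ctrl Ω D (Metric.closedBall x ρ) := by
  have hc : IsCompact (closure Ω) := hΩ.isBounded.isCompact_closure
  set U := {x | ∃ ρ > 0, Ctrl Ω D (Metric.closedBall x ρ)} with hU
  have hUo : IsOpen U := by
    rw [Metric.isOpen_iff]
    rintro x ⟨ρ, hρ, hx⟩
    refine ⟨ρ / 2, by positivity, fun z hz => ⟨ρ / 2, by positivity,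
      hx.mono (isCompact_closedBall x ρ) (Metric.closedBall_subset_closedBall' ?_)⟩⟩
    rw [Metric.mem_ball] at hz
    linarith
  have hsub : Ω ⊆ U := by
    refine hΩ.isConnected.isPreconnected.subset_of_closure_inter_subset hUo ?_ ?_
    · obtain ⟨x, hx, h⟩ := h
      exact ⟨x, hx, h⟩
    · rintro x ⟨hxU, hxΩ⟩
      obtain ⟨ε, hε, hball⟩ := Metric.isOpen_iff.1 hΩ.isOpen x hxΩ
      have hd : 0 < ε / 5 := by positivity
      obtain ⟨z, ⟨ρ, hρ, hz⟩, hdist⟩ := Metric.mem_closure_iff.1 hxU (ε / 5) hd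
      have h1 : Ctrl Ω D (Metric.closedBall z (min ρ (ε / 5))) :=
        hz.mono (isCompact_closedBall z ρ) (Metric.closedBall_subset_closedBall (min_le_left _ _))
      have h2 := h1.ball_of_ball hc hD (lt_min hρ hd) (min_le_right _ _) (fun w hw => by
        apply subset_closure
        apply hball
        rw [Metric.mem_ball]
        rw [Metric.mem_closedBall] at hw
        have := dist_triangle w z x
        rw [dist_comm z x] at this
        linarith)
      refine ⟨ε / 5, hd, h2.mono (isCompact_closedBall _ _)
        (Metric.closedBall_subset_closedBall' (by linarith))⟩
  exact fun x hx => hsub hx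

namespace Frame
variable (F : Frame)

lemma image_rect_mem_nhds {r₀ r₁ : ℝ} {p : ℝ × ℝ} (hp : F.g p ≠ 0) (h1 : 0 < p.1) (h2 : p.1 < F.ℓ)
    (h3 : r₀ < p.2) (h4 : p.2 < r₁) : F.X '' rect F.ℓ r₀ r₁ ∈ nhds (F.X p) := by
  obtain ⟨e, he, heX⟩ := F.exists_localHomeo hp
  rw [← heX, ← e.map_nhds_eq he]
  refine Filter.image_mem_map ?_
  rw [rect, ← Set.Icc_prod_Icc]
  exact prod_mem_nhds (Icc_mem_nhds h1 h2) (Icc_mem_nhds h3 h4)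

lemma dist_X (s r : ℝ) : dist (F.X (s, r)) (F.q s) = |r| := by
  rw [X, dist_eq_norm, add_sub_cancel_left, norm_smul, norm_N, mul_one, Real.norm_eq_abs]

lemma exists_ctrl_ball {Ω : Set E2} (hΩ : IsPlaneDomain Ω) (hq : ∀ s, F.q s ∈ Ω) :
    ∃ x ∈ Ω, ∃ ρ > 0, Ctrl Ω F.cauchy (Metric.closedBall x ρ) := by
  obtain ⟨R₀, hR₀, hg⟩ := F.exists_g_ge
  have hK : IsCompact (F.q '' Set.Icc 0 F.ℓ) := isCompact_Icc.image F.q_smooth.continuous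
  obtain ⟨ε, hε, hsub⟩ := hK.exists_cthickening_subset_open hΩ.isOpen (by
    rintro _ ⟨s, -, rfl⟩
    exact hq s)
  set R := min R₀ ε with hR
  have hR0 : 0 < R := lt_min hR₀ hε
  have hX : F.X '' rect F.ℓ 0 R ⊆ Ω := by
    rintro _ ⟨p, hp, rfl⟩
    obtain ⟨h1, h2, h3⟩ := mem_rect.1 hp
    refine hsub (Metric.mem_cthickening_of_dist_le _ (F.q p.1) _ _ ⟨p.1, h1, rfl⟩ ?_)
    have := F.dist_X p.1 p.2
    rw [this, abs_of_nonneg h2]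
    exact h3.trans (min_le_right _ _)
  have hg' : ∀ p ∈ rect F.ℓ 0 R, 1 / 2 ≤ F.g p := fun p hp =>
    hg R (min_le_left _ _) p (rect_subset (by linarith) le_rfl hp)
  have hc := F.ctrl_data hΩ.isBounded.isCompact_closure hR0 hg' (hX.trans subset_closure)
  have hℓ := F.ℓ_pos
  have hp : ((F.ℓ / 2, R / 8) : ℝ × ℝ) ∈ rect F.ℓ 0 R :=
    mem_rect.2 ⟨⟨by positivity, by simp only; linarith⟩, by positivity, by simp only; linarith⟩
  have hn : F.X '' rect F.ℓ 0 (R / 4) ∈ nhds (F.X (F.ℓ / 2, R / 8)) :=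
    F.image_rect_mem_nhds (by linarith [hg' _ hp]) (by simp only; positivity)
      (by simp only; linarith) (by simp only; positivity) (by simp only; linarith)
  obtain ⟨ρ, hρ, hball⟩ := Metric.nhds_basis_closedBall.mem_iff.1 hn
  exact ⟨_, hX ⟨_, hp, rfl⟩, ρ, hρ,
    hc.mono ((isCompact_rect _ _ _).image F.contDiff_X.continuous) hball⟩

lemma ctrl_of_isCompact {Ω : Set E2} (hΩ : IsPlaneDomain Ω) (hq : ∀ s, F.q s ∈ Ω) {K : Set E2}
    (hK : IsCompact K) (hKΩ : K ⊆ Ω) : Ctrl Ω F.cauchy K :=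
  Ctrl.of_locally F.cauchy_nonneg hK fun x hx =>
    Ctrl.of_connected hΩ F.cauchy_nonneg (F.exists_ctrl_ball hΩ hq) x (hKΩ hx)

end Frame

namespace Frame
variable (F : Frame)

/-- The frame of the same curve with the opposite normal. -/
def flip : Frame where
  ℓ := F.ℓ
  q := F.q
  T := F.T
  N := fun s => -F.N s
  κ := fun s => -F.κ s
  σ := -F.σ
  ℓ_pos := F.ℓ_pos
  q_smooth := F.q_smooth
  T_smooth := F.T_smooth
  N_smooth := F.N_smooth.neg
  κ_smooth := F.κ_smooth.neg
  q_deriv := F.q_deriv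
  T_deriv := fun s => by
    rw [neg_smul_neg]
    exact F.T_deriv s
  N_deriv := fun s => by
    have h := (F.N_deriv s).neg
    rw [← neg_smul] at h
    exact h
  q_per := F.q_per
  N_per := fun s => by rw [F.N_per]
  κ_per := fun s => by rw [F.κ_per]
  T_unit := F.T_unit
  σ_sq := by rw [neg_sq, F.σ_sq]
  N_zero := fun s => by simp [F.N_zero]
  N_one := fun s => by simp [F.N_one]

lemma flip_X (s r : ℝ) : F.flip.X (s, r) = F.X (s, -r) := by
  change F.q s + r • -F.N s = F.q s + (-r) • F.N s
  rw [smul_neg, neg_smul]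

lemma flip_g (s r : ℝ) : F.flip.g (s, r) = F.g (s, -r) := by
  change 1 - -F.κ s * r = 1 - F.κ s * -r
  ring

/-- One-sided tubular neighbourhoods of width `R` of the boundary inside `Ω`. -/
structure IsCollar (Ω : Set E2) (R : ℝ) : Prop where
  pos : 0 < R
  half_le : ∀ p ∈ rect F.ℓ 0 R, 1 / 2 ≤ F.g p
  frontier_subset : frontier Ω ⊆ Set.range F.q
  subset_closure : F.X '' rect F.ℓ 0 R ⊆ closure Ω
  mem : ∀ p ∈ rect F.ℓ 0 R, 0 < p.2 → F.X p ∈ Ω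

variable {F}

lemma eq_of_q_eq (hinj : Set.InjOn F.q (Set.Ico 0 F.ℓ)) {s t : ℝ} (h : F.q s = F.q t)
    (hst : |s - t| ≤ F.ℓ / 2) : s = t := by
  have hper : Function.Periodic F.q F.ℓ := F.q_per
  have hℓ := F.ℓ_pos
  have hm : ∀ x, F.q (toIcoMod hℓ 0 x) = F.q x := fun x => by
    rw [toIcoMod, hper.sub_zsmul_eq]
  have h1 : toIcoMod hℓ 0 s = toIcoMod hℓ 0 t :=
    hinj (toIcoMod_mem_Ico' hℓ s) (toIcoMod_mem_Ico' hℓ t) (by rw [hm, hm, h])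
  rw [toIcoMod_inj, AddCommGroup.modEq_iff_zsmul'] at h1
  obtain ⟨m, hm⟩ := h1
  rw [zsmul_eq_mul] at hm
  have h2 : |(m : ℝ)| < 1 := by
    have : |(m : ℝ)| * F.ℓ ≤ F.ℓ / 2 := by
      rw [← abs_of_pos hℓ, ← abs_mul, ← hm, abs_sub_comm, abs_of_pos hℓ]
      exact hst
    nlinarith
  have h3 : m = 0 := by
    have : |m| < 1 := by exact_mod_cast h2
    exact Int.abs_lt_one_iff.1 this
  rw [h3] at hm
  simp only [Int.cast_zero, zero_mul] at hm
  linarith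

lemma g_zero (s : ℝ) : F.g (s, 0) = 1 := by simp [g]

lemma eventually_not_mem_range (hinj : Set.InjOn F.q (Set.Ico 0 F.ℓ)) (s₀ : ℝ) :
    ∀ᶠ p in nhds ((s₀, 0) : ℝ × ℝ), F.X p ∈ Set.range F.q → p.2 = 0 := by
  have hℓ := F.ℓ_pos
  obtain ⟨e, he, heX⟩ := F.exists_localHomeo (p := (s₀, 0)) (by rw [g_zero]; exact one_ne_zero)
  have hsrc : ∀ᶠ t in nhds s₀, ((t, 0) : ℝ × ℝ) ∈ e.source :=
    (Continuous.prodMk_left (0 : ℝ)).continuousAt.preimage_mem_nhds (e.open_source.mem_nhds he)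
  obtain ⟨ε, hε, hball⟩ := Metric.eventually_nhds_iff.1 hsrc
  set Z := Set.Icc (s₀ - F.ℓ / 2) (s₀ + F.ℓ / 2) \ Metric.ball s₀ ε with hZ
  have hZc : IsCompact Z := isCompact_Icc.diff Metric.isOpen_ball
  have hZcl : IsClosed (F.q '' Z) := (hZc.image F.q_smooth.continuous).isClosed
  have hZn : F.X (s₀, 0) ∉ F.q '' Z := by
    rw [F.X_zero]
    rintro ⟨t, ⟨⟨h1, h2⟩, h3⟩, h4⟩
    have : t = s₀ := eq_of_q_eq hinj h4 (abs_le.2 ⟨by linarith, by linarith⟩)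
    rw [this] at h3
    exact h3 (Metric.mem_ball_self hε)
  have hZe : ∀ᶠ p in nhds ((s₀, 0) : ℝ × ℝ), F.X p ∉ F.q '' Z :=
    F.contDiff_X.continuous.continuousAt.preimage_mem_nhds (hZcl.isOpen_compl.mem_nhds hZn)
  filter_upwards [hZe, e.open_source.mem_nhds he] with p hp1 hp2
  rintro ⟨t', ht'⟩
  obtain ⟨t, ht, htt⟩ := Function.Periodic.exists_mem_Ico (f := F.q) F.q_per hℓ t' (s₀ - F.ℓ / 2)
  rw [htt] at ht'
  have h1 : dist t s₀ < ε := by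
    by_contra hcon
    exact hp1 ⟨t, ⟨⟨ht.1, by linarith [ht.2]⟩, hcon⟩, ht'⟩
  have h2 : (t, 0) = p := e.injOn (hball h1) hp2 (by rw [heX, F.X_zero, ht'])
  rw [← h2]

lemma exists_not_mem_range (hinj : Set.InjOn F.q (Set.Ico 0 F.ℓ)) :
    ∃ R > 0, ∀ s ∈ Set.Icc 0 F.ℓ, ∀ r, 0 < |r| → |r| ≤ R → F.X (s, r) ∉ Set.range F.q := by
  have h := isCompact_Icc (a := (0 : ℝ)) (b := F.ℓ) |>.eventually_forall_of_forall_eventually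
    (x₀ := (0 : ℝ)) (P := fun r s => F.X (s, r) ∈ Set.range F.q → r = 0) fun s _ =>
      (continuous_swap.tendsto ((0 : ℝ), s)).eventually (eventually_not_mem_range hinj s)
  obtain ⟨ε, hε, hball⟩ := Metric.eventually_nhds_iff.1 h
  refine ⟨ε / 2, by positivity, fun s hs r h0 h1 hmem => ?_⟩
  have h2 : r = 0 := hball (by rw [Real.dist_eq, sub_zero]; linarith) s hs hmem
  rw [h2, abs_zero] at h0
  exact lt_irrefl _ h0

lemma image_collar_subset_or {Ω : Set E2} (hΩ : IsOpen Ω) {R : ℝ}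
    (h : ∀ s ∈ Set.Icc 0 F.ℓ, ∀ r ∈ Set.Ioc 0 R, F.X (s, r) ∉ frontier Ω) :
    (∀ s ∈ Set.Icc 0 F.ℓ, ∀ r ∈ Set.Ioc 0 R, F.X (s, r) ∈ Ω) ∨
      ∀ s ∈ Set.Icc 0 F.ℓ, ∀ r ∈ Set.Ioc 0 R, F.X (s, r) ∉ Ω := by
  by_contra! hcon
  obtain ⟨⟨s, hs, r, hr, h1⟩, s', hs', r', hr', h2⟩ := hcon
  have hpre : IsPreconnected (F.X '' (Set.Icc 0 F.ℓ ×ˢ Set.Ioc 0 R)) :=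
    (isPreconnected_Icc.prod isPreconnected_Ioc).image _ F.contDiff_X.continuous.continuousOn
  have hne : (F.X '' (Set.Icc 0 F.ℓ ×ˢ Set.Ioc 0 R) ∩ Ω).Nonempty :=
    ⟨F.X (s', r'), ⟨(s', r'), ⟨hs', hr'⟩, rfl⟩, h2⟩
  refine h1 (hpre.subset_left_of_subset_union hΩ isClosed_closure.isOpen_compl
    (Set.disjoint_compl_right_iff_subset.2 subset_closure) ?_ hne ⟨(s, r), ⟨hs, hr⟩, rfl⟩)
  rintro _ ⟨⟨t, u⟩, ⟨ht, hu⟩, rfl⟩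
  by_cases hmem : F.X (t, u) ∈ Ω
  · exact Or.inl hmem
  · refine Or.inr fun hcl => h t ht u hu ?_
    rw [hΩ.frontier_eq]
    exact ⟨hcl, hmem⟩

/-- A bounded domain with smooth boundary is the union of a compact subset and of collars of its
boundary. -/
lemma exists_collar {Ω : Set E2} (hΩ : IsPlaneDomain Ω) (hinj : Set.InjOn F.q (Set.Ico 0 F.ℓ))
    (hr : Set.range F.q = frontier Ω) (hin : ∃ δ > 0, ∀ t ∈ Set.Ioo (0 : ℝ) δ, F.X (0, t) ∈ Ω) :
    ∃ R, F.IsCollar Ω R ∧ ∃ G, (G = F ∨ G = F.flip) ∧ G.IsCollar Ω R ∧ ∃ K, IsCompact K ∧ K ⊆ Ω ∧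
      closure Ω ⊆ K ∪ (F.X '' rect F.ℓ 0 (R / 4) ∪ G.X '' rect G.ℓ 0 (R / 4)) := by
  have hℓ := F.ℓ_pos
  obtain ⟨R₁, hR₁, hg⟩ := F.exists_g_ge
  obtain ⟨R₂, hR₂, hnm⟩ := exists_not_mem_range hinj
  obtain ⟨δ, hδ, hin⟩ := hin
  set R := min R₁ R₂ with hR
  have hR0 : 0 < R := lt_min hR₁ hR₂
  have hfr : ∀ s, F.q s ∈ frontier Ω := fun s => hr ▸ Set.mem_range_self s
  have hF1 : ∀ s ∈ Set.Icc 0 F.ℓ, ∀ r ∈ Set.Ioc 0 R, F.X (s, r) ∉ frontier Ω := by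
    intro s hs r h
    rw [← hr]
    refine hnm s hs r (abs_pos.2 h.1.ne') ?_
    rw [abs_of_pos h.1]
    exact h.2.trans (min_le_right _ _)
  have hF2 : ∀ s ∈ Set.Icc 0 F.ℓ, ∀ r ∈ Set.Ioc 0 R, F.flip.X (s, r) ∉ frontier Ω := by
    intro s hs r h
    rw [← hr, flip_X]
    refine hnm s hs (-r) (by rw [abs_neg]; exact abs_pos.2 h.1.ne') ?_
    rw [abs_neg, abs_of_pos h.1]
    exact h.2.trans (min_le_right _ _)
  have hcollar : ∀ G : Frame, G.ℓ = F.ℓ → G.q = F.q → (∀ p ∈ rect G.ℓ 0 R, 1 / 2 ≤ G.g p) →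
      (∀ s ∈ Set.Icc 0 G.ℓ, ∀ r ∈ Set.Ioc 0 R, G.X (s, r) ∈ Ω) → G.IsCollar Ω R := by
    intro G _ hGq hGg hG
    have hm : ∀ p ∈ rect G.ℓ 0 R, 0 < p.2 → G.X p ∈ Ω := fun p hp h0 =>
      hG p.1 (mem_rect.1 hp).1 p.2 ⟨h0, (mem_rect.1 hp).2.2⟩
    refine ⟨hR0, hGg, by rw [hGq, hr], ?_, hm⟩
    rintro _ ⟨p, hp, rfl⟩
    rcases (mem_rect.1 hp).2.1.eq_or_lt with h0 | h0
    · have e : p = (p.1, 0) := Prod.ext rfl h0.symm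
      rw [e, G.X_zero, hGq]
      exact frontier_subset_closure (hfr _)
    · exact _root_.subset_closure (hm p hp h0)
  have hFc : F.IsCollar Ω R := by
    refine hcollar F rfl rfl (fun p hp => hg R (min_le_left _ _) p
      (rect_subset (by linarith) le_rfl hp)) ?_
    rcases image_collar_subset_or hΩ.isOpen hF1 with h | h
    · exact h
    · refine absurd (hin (min (δ / 2) R) ⟨lt_min (by positivity) hR0, ?_⟩)
        (h 0 ⟨le_rfl, hℓ.le⟩ _ ⟨lt_min (by positivity) hR0, min_le_right _ _⟩)
      exact (min_le_left _ _).trans_lt (by linarith)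
  set O := interior (F.X '' (Set.univ ×ˢ Set.Ioo (-(R / 4)) (R / 4))) with hO
  have hOf : frontier Ω ⊆ O := by
    rw [← hr]
    rintro _ ⟨s, rfl⟩
    obtain ⟨e, he, heX⟩ := F.exists_localHomeo (p := (s, 0)) (by rw [g_zero]; exact one_ne_zero)
    rw [hO, mem_interior_iff_mem_nhds, ← F.X_zero, ← heX, ← e.map_nhds_eq he]
    exact Filter.image_mem_map (prod_mem_nhds Filter.univ_mem
      (Ioo_mem_nhds (by linarith) (by linarith)))
  have hKc : IsCompact (closure Ω \ O) := hΩ.isBounded.isCompact_closure.diff isOpen_interior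
  have hKΩ : closure Ω \ O ⊆ Ω := by
    rintro x ⟨h1, h2⟩
    by_contra h3
    refine h2 (hOf ?_)
    rw [hΩ.isOpen.frontier_eq]
    exact ⟨h1, h3⟩
  have hOx : ∀ x ∈ O, ∃ s ∈ Set.Icc 0 F.ℓ, ∃ r, |r| < R / 4 ∧ F.X (s, r) = x := by
    intro x hx
    obtain ⟨⟨s', r⟩, ⟨-, hr'⟩, rfl⟩ := interior_subset hx
    obtain ⟨s, hs, hss⟩ := Function.Periodic.exists_mem_Ico (f := fun t => F.X (t, r))
      (fun t => F.per_X t r) hℓ s' 0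
    exact ⟨s, ⟨hs.1, by linarith [hs.2]⟩, r, abs_lt.2 hr', hss.symm⟩
  have hside : ∀ G : Frame, (G = F ∨ G = F.flip) →
      ((∀ s ∈ Set.Icc 0 F.ℓ, ∀ r ∈ Set.Ioc 0 R, F.flip.X (s, r) ∈ Ω) → G = F.flip) →
      closure Ω ⊆ (closure Ω \ O) ∪
        (F.X '' rect F.ℓ 0 (R / 4) ∪ G.X '' rect G.ℓ 0 (R / 4)) := by
    intro G _ hGf x hx
    by_cases hxO : x ∈ O
    · right
      obtain ⟨s, hs, r, hr', rfl⟩ := hOx x hxO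
      rcases le_or_gt 0 r with h0 | h0
      · left
        refine ⟨(s, r), mem_rect.2 ⟨hs, h0, ?_⟩, rfl⟩
        rw [abs_of_nonneg h0] at hr'
        exact hr'.le
      · right
        rw [abs_of_neg h0] at hr'
        have e : F.X (s, r) = F.flip.X (s, -r) := by rw [flip_X, neg_neg]
        have hmem : -r ∈ Set.Ioc 0 R := ⟨by linarith, by linarith⟩
        have hxΩ : F.flip.X (s, -r) ∈ Ω := by
          by_contra hcon
          refine hF2 s hs (-r) hmem ?_
          rw [hΩ.isOpen.frontier_eq, ← e]
          exact ⟨hx, e ▸ hcon⟩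
        have hgood : ∀ s ∈ Set.Icc 0 F.ℓ, ∀ r ∈ Set.Ioc 0 R, F.flip.X (s, r) ∈ Ω := by
          rcases image_collar_subset_or (F := F.flip) hΩ.isOpen hF2 with h | h
          · exact h
          · exact absurd hxΩ (h s hs _ hmem)
        rw [hGf hgood, e]
        exact ⟨(s, -r), mem_rect.2 ⟨hs, by simp only; linarith, by simp only; linarith⟩, rfl⟩
    · exact Or.inl ⟨hx, hxO⟩
  by_cases hgood : ∀ s ∈ Set.Icc 0 F.ℓ, ∀ r ∈ Set.Ioc 0 R, F.flip.X (s, r) ∈ Ω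
  · refine ⟨R, hFc, F.flip, Or.inr rfl, hcollar F.flip rfl rfl ?_ hgood, _, hKc, hKΩ,
      hside F.flip (Or.inr rfl) fun _ => rfl⟩
    rintro ⟨s, r⟩ hp
    obtain ⟨h1, h2, h3⟩ := mem_rect.1 hp
    rw [flip_g]
    exact hg R (min_le_left _ _) _ (mem_rect.2 ⟨h1, by simp only at h3 ⊢; linarith,
      by simp only at h2 ⊢; linarith⟩)
  · exact ⟨R, hFc, F, Or.inl rfl, hFc, _, hKc, hKΩ, hside F (Or.inl rfl) fun h => absurd h hgood⟩

end Frame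

lemma setIntegral_eng_union_le {φ : E2 → ℝ} (hφ : ContDiff ℝ ∞ φ) {S T : Set E2}
    (hS : IsCompact S) (hT : IsCompact T) :
    ∫ x in S ∪ T, eng φ x ≤ (∫ x in S, eng φ x) + ∫ x in T, eng φ x := by
  have h1 : S ∪ T = S ∪ (T \ S) := by simp
  rw [h1, setIntegral_union Set.disjoint_sdiff_right (hT.measurableSet.diff hS.measurableSet)
    (integrableOn_eng hφ hS) ((integrableOn_eng hφ hT).mono_set Set.sdiff_subset)]
  have := setIntegral_eng_mono hφ hT (Set.sdiff_subset (s := T) (t := S))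
  linarith

namespace Frame
variable {F : Frame} {Ω : Set E2} {R : ℝ}

lemma IsCollar.exists_energy (h : F.IsCollar Ω R) :
    ∃ C : ℝ, 0 ≤ C ∧ ∀ lam : ℝ, 0 ≤ lam → ∀ φ, IsSol Ω lam φ →
      (∀ s, fderiv ℝ φ (F.q s) (F.N s) = 0) →
      ∫ x in F.X '' rect F.ℓ 0 (R / 4), eng φ x
        ≤ exp (C * (1 + lam)) * ∫ x in F.X '' rect F.ℓ (R / 4) R, eng φ x := by
  have hR := h.pos
  obtain ⟨C, hC, hn⟩ := F.exists_neumann_bound hR h.half_le h.subset_closure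
  obtain ⟨C₂, hC₂, ht⟩ := F.exists_transfer h.half_le le_rfl (by linarith : R / 4 ≤ R)
  refine ⟨log (C₂ + 1) + C, add_nonneg (log_nonneg (by linarith)) hC, fun lam hl φ hφ hN => ?_⟩
  have h1 := hn lam hl φ hφ hN
  have h2 := (ht φ hφ.smooth).1
  have h3 := exp_log_absorb hC₂ hl
  have h4 := setIntegral_eng_nonneg (F.X '' rect F.ℓ (R / 4) R) φ
  rw [add_mul, exp_add, mul_assoc]
  refine h2.trans ((mul_le_mul_of_nonneg_left h1 hC₂).trans
    (mul_le_mul_of_nonneg_right h3 (by positivity)))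

lemma IsCollar.exists_trace (h : F.IsCollar Ω R) (hΩ : IsCompact (closure Ω)) :
    ∃ C : ℝ, 0 ≤ C ∧ ∀ φ, ContDiff ℝ ∞ φ →
      ∫ s in (0 : ℝ)..F.ℓ, φ (F.q s) ^ 2 ≤ C * ∫ x in closure Ω, eng φ x := by
  have hR := h.pos
  obtain ⟨C, hC, ht⟩ := F.exists_transfer h.half_le le_rfl le_rfl
  refine ⟨(1 + R) / R * C, by positivity, fun φ hφ => ?_⟩
  have h1 := F.trace_le hR hφ
  have h2 := (ht φ hφ).2
  have h3 := setIntegral_eng_mono hφ hΩ h.subset_closure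
  have h4 : ∫ s in (0 : ℝ)..F.ℓ, φ (F.q s) ^ 2
      ≤ (1 + R) / R * ∫ p in rect F.ℓ 0 R, den (F.pull φ) p := by
    rw [div_mul_eq_mul_div, le_div_iff₀ hR]
    linarith
  refine h4.trans ?_
  rw [mul_assoc]
  exact mul_le_mul_of_nonneg_left (h2.trans (mul_le_mul_of_nonneg_left h3 hC)) (by positivity)

/-- The total energy of a Neumann solution is controlled by the energy on a compact subset. -/
lemma exists_energy_compact (hΩ : IsPlaneDomain Ω) (hinj : Set.InjOn F.q (Set.Ico 0 F.ℓ))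
    (hr : Set.range F.q = frontier Ω) (hin : ∃ δ > 0, ∀ t ∈ Set.Ioo (0 : ℝ) δ, F.X (0, t) ∈ Ω) :
    ∃ K, IsCompact K ∧ K ⊆ Ω ∧ ∃ C : ℝ, 0 ≤ C ∧ ∀ lam : ℝ, 0 ≤ lam → ∀ φ, IsSol Ω lam φ →
      (∀ s, fderiv ℝ φ (F.q s) (F.N s) = 0) →
      ∫ x in closure Ω, eng φ x ≤ exp (C * (1 + lam)) * ∫ x in K, eng φ x := by
  obtain ⟨R, hF, G, hGF, hG, K, hK, hKΩ, hcov⟩ := exists_collar hΩ hinj hr hin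
  have hR := hF.pos
  obtain ⟨C₁, hC₁, h₁⟩ := hF.exists_energy
  obtain ⟨C₂, hC₂, h₂⟩ := hG.exists_energy
  have hc : ∀ H : Frame, ∀ r₀ r₁, IsCompact (H.X '' rect H.ℓ r₀ r₁) := fun H r₀ r₁ =>
    (isCompact_rect _ _ _).image H.contDiff_X.continuous
  have hsub : ∀ H : Frame, H.IsCollar Ω R → H.X '' rect H.ℓ (R / 4) R ⊆ Ω := by
    rintro H hH _ ⟨p, hp, rfl⟩
    exact hH.mem p (rect_subset (by linarith) le_rfl hp)
      (by linarith [(mem_rect.1 hp).2.1])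
  set K' := K ∪ (F.X '' rect F.ℓ (R / 4) R ∪ G.X '' rect G.ℓ (R / 4) R) with hK'
  have hK'c : IsCompact K' := hK.union ((hc F _ _).union (hc G _ _))
  refine ⟨K', hK'c, Set.union_subset hKΩ (Set.union_subset (hsub F hF) (hsub G hG)),
    log (3 + 1) + (C₁ + C₂), add_nonneg (log_nonneg (by norm_num)) (by positivity),
    fun lam hl φ hφ hN => ?_⟩
  have hNG : ∀ s, fderiv ℝ φ (G.q s) (G.N s) = 0 := by
    rcases hGF with rfl | rfl
    · exact hN
    · intro s
      change fderiv ℝ φ (F.q s) (-F.N s) = 0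
      rw [map_neg, hN, neg_zero]
  have e0 := setIntegral_eng_mono hφ.smooth
    (hK.union ((hc F 0 (R / 4)).union (hc G 0 (R / 4)))) hcov
  have e1 := setIntegral_eng_union_le hφ.smooth hK ((hc F 0 (R / 4)).union (hc G 0 (R / 4)))
  have e2 := setIntegral_eng_union_le hφ.smooth (hc F 0 (R / 4)) (hc G 0 (R / 4))
  have e3 := h₁ lam hl φ hφ hN
  have e4 := h₂ lam hl φ hφ hNG
  have m0 := setIntegral_eng_mono hφ.smooth hK'c (Set.subset_union_left : K ⊆ K')
  have m1 : ∫ x in F.X '' rect F.ℓ (R / 4) R, eng φ x ≤ ∫ x in K', eng φ x :=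
    setIntegral_eng_mono hφ.smooth hK'c
      (Set.subset_union_left.trans Set.subset_union_right)
  have m2 : ∫ x in G.X '' rect G.ℓ (R / 4) R, eng φ x ≤ ∫ x in K', eng φ x :=
    setIntegral_eng_mono hφ.smooth hK'c
      (Set.subset_union_right.trans Set.subset_union_right)
  have hE := setIntegral_eng_nonneg K' φ
  set E := ∫ x in K', eng φ x
  have x0 : (1 : ℝ) ≤ exp ((C₁ + C₂) * (1 + lam)) := one_le_exp (by positivity)
  have x1 : exp (C₁ * (1 + lam)) ≤ exp ((C₁ + C₂) * (1 + lam)) :=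
    exp_le_exp.2 (by nlinarith)
  have x2 : exp (C₂ * (1 + lam)) ≤ exp ((C₁ + C₂) * (1 + lam)) :=
    exp_le_exp.2 (by nlinarith)
  have n0 : E ≤ exp ((C₁ + C₂) * (1 + lam)) * E := le_mul_of_one_le_left hE x0
  have n1 : exp (C₁ * (1 + lam)) * ∫ x in F.X '' rect F.ℓ (R / 4) R, eng φ x
      ≤ exp ((C₁ + C₂) * (1 + lam)) * E :=
    mul_le_mul x1 m1 (setIntegral_eng_nonneg _ _) (exp_pos _).le
  have n2 : exp (C₂ * (1 + lam)) * ∫ x in G.X '' rect G.ℓ (R / 4) R, eng φ x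
      ≤ exp ((C₁ + C₂) * (1 + lam)) * E :=
    mul_le_mul x2 m2 (setIntegral_eng_nonneg _ _) (exp_pos _).le
  have h3 := mul_le_mul_of_nonneg_right (exp_log_absorb (by norm_num : (0 : ℝ) ≤ 3) hl)
    (by positivity : 0 ≤ exp ((C₁ + C₂) * (1 + lam)) * E)
  rw [add_mul, exp_add, mul_assoc]
  linarith

/-- The boundary trace of a Neumann solution is controlled by its Cauchy data on an interior
curve. -/
lemma exists_trace_le_cauchy (hΩ : IsPlaneDomain Ω) (hinj : Set.InjOn F.q (Set.Ico 0 F.ℓ))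
    (hr : Set.range F.q = frontier Ω) (hin : ∃ δ > 0, ∀ t ∈ Set.Ioo (0 : ℝ) δ, F.X (0, t) ∈ Ω)
    (H : Frame) (hH : ∀ s, H.q s ∈ Ω) :
    ∃ C : ℝ, 0 ≤ C ∧ ∀ lam : ℝ, 0 ≤ lam → ∀ φ, IsSol Ω lam φ →
      (∀ s, fderiv ℝ φ (F.q s) (F.N s) = 0) →
      ∫ s in (0 : ℝ)..F.ℓ, φ (F.q s) ^ 2 ≤ exp (C * (1 + lam)) * H.cauchy φ := by
  obtain ⟨K, hK, hKΩ, C, hC, hE⟩ := exists_energy_compact hΩ hinj hr hin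
  obtain ⟨R, hF, -⟩ := exists_collar hΩ hinj hr hin
  obtain ⟨C', hC', htr⟩ := hF.exists_trace hΩ.isBounded.isCompact_closure
  obtain ⟨B, hB, hctrl⟩ := H.ctrl_of_isCompact hΩ hH hK hKΩ (C + log 2)
  refine ⟨log (C' * 2 + 1) + (C + B), add_nonneg (log_nonneg (by linarith)) (by positivity),
    fun lam hl φ hφ hN => ?_⟩
  have h1 := hE lam hl φ hφ hN
  have h2 := hctrl lam hl φ hφ
  have h3 := htr φ hφ.smooth
  have hcau := H.cauchy_nonneg φ
  have hT := setIntegral_eng_nonneg (closure Ω) φ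
  set T := ∫ x in closure Ω, eng φ x
  have h4 : exp (C * (1 + lam)) * exp (-((C + log 2) * (1 + lam))) ≤ 1 / 2 := by
    have e : exp (-log 2) = 1 / 2 := by rw [exp_neg, exp_log two_pos, one_div]
    rw [← exp_add, ← e]
    have := log_nonneg (one_le_two : (1 : ℝ) ≤ 2)
    exact exp_le_exp.2 (by nlinarith)
  have h5 : T ≤ 1 / 2 * T + exp (C * (1 + lam)) * (exp (B * (1 + lam)) * H.cauchy φ) := by
    refine h1.trans ((mul_le_mul_of_nonneg_left h2 (exp_pos _).le).trans ?_)
    rw [mul_add, ← mul_assoc]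
    have := mul_le_mul_of_nonneg_right h4 hT
    linarith
  have h6 : T ≤ 2 * (exp ((C + B) * (1 + lam)) * H.cauchy φ) := by
    rw [add_mul, exp_add]
    linarith
  have h7 := mul_le_mul_of_nonneg_right (exp_log_absorb (by positivity : 0 ≤ C' * 2) hl)
    (by positivity : 0 ≤ exp ((C + B) * (1 + lam)) * H.cauchy φ)
  have h8 := mul_le_mul_of_nonneg_left h6 hC'
  rw [add_mul, exp_add, mul_assoc]
  linarith

end Frame

lemma IsLocalMin.second_deriv_nonneg {f f₁ : ℝ → ℝ} {x d₂ : ℝ} (hx : IsLocalMin f x)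
    (hf : ∀ t, HasDerivAt f (f₁ t) t) (h2 : HasDerivAt f₁ d₂ x) : f₁ x = 0 ∧ 0 ≤ d₂ := by
  have e : deriv f = f₁ := funext fun t => (hf t).deriv
  have h0 : f₁ x = 0 := by rw [← e]; exact hx.deriv_eq_zero
  refine ⟨h0, ?_⟩
  by_contra! hneg
  have hmax : IsLocalMax f x :=
    isLocalMax_of_deriv_deriv_neg (by rw [e, h2.deriv]; exact hneg) (by rw [e, h0])
      (hf x).continuousAt
  have hconst : f =ᶠ[nhds x] fun _ => f x := by
    filter_upwards [hx, hmax] with t h1 h2 using le_antisymm h2 h1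
  have h3 : f₁ =ᶠ[nhds x] fun _ => 0 := by
    have := hconst.deriv
    rw [e] at this
    filter_upwards [this] with t ht
    rw [ht, deriv_const]
  have h4 := (h2.congr_of_eventuallyEq h3.symm).unique (hasDerivAt_const x (0 : ℝ))
  linarith

lemma deriv_nonneg_of_min_left {f : ℝ → ℝ} {d R : ℝ} (hR : 0 < R) (hf : HasDerivAt f d 0)
    (h : ∀ r ∈ Set.Icc 0 R, f 0 ≤ f r) : 0 ≤ d := by
  have h1 : Filter.Tendsto (slope f 0) (nhdsWithin 0 (Set.Ioi 0)) (nhds d) :=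
    (hasDerivAt_iff_tendsto_slope.1 hf).mono_left (nhdsWithin_mono _ fun r hr => ne_of_gt hr)
  refine ge_of_tendsto h1 ?_
  filter_upwards [Ioo_mem_nhdsGT hR] with r hr
  rw [slope_def_field, sub_zero]
  exact div_nonneg (by linarith [h r ⟨hr.1.le, hr.2.le⟩]) hr.1.le

lemma lap_nonneg_of_isLocalMin {φ : E2 → ℝ} (hφ : ContDiff ℝ ∞ φ) {x : E2} (h : IsLocalMin φ x) :
    0 ≤ lap φ x := by
  have key : ∀ v : E2, 0 ≤ fderiv ℝ (fderiv ℝ φ) x v v := by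
    intro v
    have hline : ∀ t : ℝ, HasDerivAt (fun t : ℝ => x + t • v) v t := fun t => by
      have := ((hasDerivAt_id t).smul_const v).const_add x
      rwa [one_smul] at this
    have h1 : ∀ t : ℝ, HasDerivAt (fun t : ℝ => φ (x + t • v)) (fderiv ℝ φ (x + t • v) v) t :=
      fun t => HasFDerivAt.comp_hasDerivAt t (f := fun t : ℝ => x + t • v)
        (hφ.differentiable (by simp) _).hasFDerivAt (hline t)
    have h2 : HasDerivAt (fun t : ℝ => fderiv ℝ φ (x + t • v) v)
        (fderiv ℝ (fderiv ℝ φ) x v v) 0 := by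
      have h3 := (HasFDerivAt.comp_hasDerivAt (0 : ℝ) (f := fun t : ℝ => x + t • v)
        (Frame.hasFDerivAt_fderiv hφ (x + (0 : ℝ) • v)) (hline 0)).clm_apply
        (hasDerivAt_const (0 : ℝ) v)
      simpa using h3
    have hmin : IsLocalMin (fun t : ℝ => φ (x + t • v)) 0 := by
      have hc : Filter.Tendsto (fun t : ℝ => x + t • v) (nhds 0) (nhds x) := by
        have := (hline 0).continuousAt.tendsto
        simpa using this
      have h0 := hc.eventually h
      simpa [IsLocalMin, IsMinFilter] using h0
    exact (hmin.second_deriv_nonneg h1 h2).2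
  rw [Frame.lap_eq hφ]
  exact add_nonneg (key _) (key _)

namespace Frame
variable {F : Frame} {Ω : Set E2} {R : ℝ}

/-- A quantitative minimum principle in a collar, with a Neumann condition on the boundary. -/
lemma IsCollar.exists_min_principle (h : F.IsCollar Ω R) :
    ∃ C : ℝ, 0 < C ∧ ∀ φ, ContDiff ℝ ∞ φ → (∀ s, fderiv ℝ φ (F.q s) (F.N s) = 0) →
      ∀ A > 0, (∀ x ∈ closure Ω, lap φ x < A) →
      ∀ m, (∀ s ∈ Set.Icc 0 F.ℓ, m ≤ φ (F.X (s, R))) →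
      ∀ p ∈ rect F.ℓ 0 R, m - C * A ≤ φ (F.X p) := by
  have hR := h.pos
  have hℓ := F.ℓ_pos
  have c1 : ContinuousOn (fun p : ℝ × ℝ => F.κ p.1 / F.g p) (rect F.ℓ 0 R) :=
    (F.κ_smooth.continuous.comp continuous_fst).continuousOn.div
      F.contDiff_g.continuous.continuousOn fun p hp => by
        have := h.half_le p hp
        linarith
  obtain ⟨k, hk⟩ := (isCompact_rect F.ℓ 0 R).exists_bound_of_continuousOn c1
  set γ := |k| + 1 with hγ
  have hγ1 : 1 ≤ γ := by linarith [abs_nonneg k]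
  refine ⟨exp (γ * R), exp_pos _, fun φ hφ hN A hA hlap m hm p hp => ?_⟩
  set f := F.pull φ with hf
  have hfs : ContDiff ℝ ∞ f := F.contDiff_pull hφ
  set u : ℝ × ℝ → ℝ := fun p => f p - A * exp (γ * p.2) with hu
  have huc : Continuous u := hfs.continuous.sub (by fun_prop)
  obtain ⟨p₀, hp₀, hmin⟩ := (isCompact_rect F.ℓ 0 R).exists_isMinOn ⟨p, hp⟩ huc.continuousOn
  have hmin' : ∀ s, ∀ r ∈ Set.Icc 0 R, u p₀ ≤ u (s, r) := by
    intro s r hr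
    obtain ⟨t, ht, hst⟩ := Function.Periodic.exists_mem_Ico (f := fun t => u (t, r))
      (fun t => by simp only [hu, hf]; rw [F.per_pull φ]) hℓ s 0
    rw [hst]
    exact hmin (mem_rect.2 ⟨⟨ht.1, by simp only; linarith [ht.2]⟩, hr.1, hr.2⟩)
  have hexp : ∀ r : ℝ, HasDerivAt (fun r => A * exp (γ * r)) (A * (exp (γ * r) * γ)) r := by
    intro r
    have := (((hasDerivAt_id r).const_mul γ).exp).const_mul A
    simpa using this
  have huR : ∀ t, HasDerivAt (fun t => u (p₀.1, t))
      (pdR f (p₀.1, t) - A * (exp (γ * t) * γ)) t := fun t =>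
    (hasDerivAt_pdR (hfs.differentiable (by simp) (p₀.1, t))).sub (hexp t)
  have hle : u p₀ ≤ u p := hmin hp
  obtain ⟨hp1, hp2, hp3⟩ := mem_rect.1 hp₀
  suffices hgoal : m - exp (γ * R) * A ≤ u p₀ by
    have : 0 < A * exp (γ * p.2) := by positivity
    simp only [hu] at hle hgoal
    have e : f p = φ (F.X p) := rfl
    rw [← e]
    linarith
  rcases hp3.eq_or_lt with h3 | h3
  · have := hm p₀.1 hp1
    simp only [hu]
    rw [h3, mul_comm A]
    have e : f p₀ = φ (F.X (p₀.1, R)) := by rw [← h3]; rfl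
    rw [e]
    linarith
  exfalso
  rcases hp2.eq_or_lt with h2 | h2
  · have h4 := deriv_nonneg_of_min_left hR (huR 0) fun r hr => by
      have e : ((p₀.1, 0) : ℝ × ℝ) = p₀ := Prod.ext rfl h2
      rw [e]
      exact hmin' _ r hr
    rw [hf, F.pdR_pull hφ, F.X_zero] at h4
    simp only at h4
    rw [hN, mul_zero, exp_zero, one_mul] at h4
    have : 0 < A * γ := by positivity
    linarith
  · have hloc : IsLocalMin (fun t => u (p₀.1, t)) p₀.2 := by
      filter_upwards [Icc_mem_nhds h2 h3] with t ht using hmin' _ t ht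
    have hlocS : IsLocalMin (fun t => f (t, p₀.2)) p₀.1 := by
      filter_upwards with t
      have := hmin' t p₀.2 ⟨hp2, hp3⟩
      simp only [hu] at this
      linarith
    have hS := hlocS.second_deriv_nonneg
      (fun t => hasDerivAt_pdS (hfs.differentiable (by simp) (t, p₀.2)))
      (hasDerivAt_pdS ((contDiff_pdS hfs).differentiable (by simp) p₀))
    have hexp2 : HasDerivAt (fun r => A * (exp (γ * r) * γ)) (A * (exp (γ * p₀.2) * γ * γ)) p₀.2 := by
      have := ((((hasDerivAt_id p₀.2).const_mul γ).exp).mul_const γ).const_mul A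
      simpa using this
    have hRR := hloc.second_deriv_nonneg huR
      ((hasDerivAt_pdR ((contDiff_pdR hfs).differentiable (by simp) p₀)).sub hexp2)
    obtain ⟨hS0, hS1⟩ := hS
    obtain ⟨hR0, hR1⟩ := hRR
    have hop := F.opL_pull hφ (h.half_le p₀ hp₀) 0
    rw [← hf, opL] at hop
    have hS0' : pdS f p₀ = 0 := hS0
    have hR0' : pdR f p₀ = A * (exp (γ * p₀.2) * γ) := by
      have : pdR f (p₀.1, p₀.2) - A * (exp (γ * p₀.2) * γ) = 0 := hR0
      linarith
    rw [hS0', hR0'] at hop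
    have hl := hlap _ (h.subset_closure ⟨p₀, hp₀, rfl⟩)
    have ha := mul_nonneg (F.a_pos p₀).le hS1
    have hkb : |F.κ p₀.1 / F.g p₀| ≤ γ - 1 := by
      have := (hk p₀ hp₀).trans (le_abs_self k)
      rw [Real.norm_eq_abs] at this
      linarith
    have hE : 1 ≤ exp (γ * p₀.2) := one_le_exp (by positivity)
    set E := exp (γ * p₀.2)
    have hkb2 : F.κ p₀.1 / F.g p₀ * (A * (E * γ)) ≤ (γ - 1) * (A * (E * γ)) :=
      mul_le_mul_of_nonneg_right ((le_abs_self _).trans hkb) (by positivity)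
    have hEγ : 1 ≤ E * γ := one_le_mul_of_one_le_of_one_le hE hγ1
    have hfin : A ≤ A * (E * γ) := le_mul_of_one_le_right hA.le hEγ
    nlinarith

end Frame

lemma integral_rect_eq {ℓ r₀ r₁ : ℝ} (hℓ : 0 ≤ ℓ) (hr : r₀ ≤ r₁) {f : ℝ × ℝ → ℝ}
    (hf : Continuous f) :
    ∫ p in rect ℓ r₀ r₁, f p = ∫ r in r₀..r₁, ∫ s in (0 : ℝ)..ℓ, f (s, r) := by
  have hint := hf.integrableOn_rect ℓ r₀ r₁
  rw [rect, ← Set.Icc_prod_Icc] at hint ⊢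
  rw [Measure.volume_eq_prod] at hint ⊢
  rw [IntegrableOn, ← Measure.prod_restrict] at hint
  rw [← Measure.prod_restrict, integral_prod_symm _ hint, intervalIntegral.integral_of_le hr,
    integral_Icc_eq_integral_Ioc]
  refine integral_congr_ae (Filter.Eventually.of_forall fun r => ?_)
  simp only
  rw [intervalIntegral.integral_of_le hℓ, integral_Icc_eq_integral_Ioc]

namespace Frame
variable (F : Frame)

/-- The Laplacian in divergence form in Fermi coordinates. -/
lemma pdS_add_pdR_eq_lap {φ : E2 → ℝ} (hφ : ContDiff ℝ ∞ φ) (p : ℝ × ℝ) :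
    pdS (fun p => fderiv ℝ φ (F.X p) (F.T p.1)) p
      + pdR (fun p => F.g p * fderiv ℝ φ (F.X p) (F.N p.1)) p = F.g p * lap φ (F.X p) := by
  have hd : ContDiff ℝ ∞ fun p => fderiv ℝ φ (F.X p) :=
    (hφ.fderiv_right (m := ∞) (by simp)).comp F.contDiff_X
  have h1 : ContDiff ℝ ∞ fun p => fderiv ℝ φ (F.X p) (F.T p.1) :=
    hd.clm_apply (F.T_smooth.comp contDiff_fst)
  have h2 : ContDiff ℝ ∞ fun p => F.g p * fderiv ℝ φ (F.X p) (F.N p.1) :=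
    F.contDiff_g.mul (hd.clm_apply (F.N_smooth.comp contDiff_fst))
  have d1 := (HasFDerivAt.comp_hasDerivAt p.1 (f := fun t => F.X (t, p.2))
    (hasFDerivAt_fderiv hφ (F.X p)) (F.hasDerivAt_X_fst p)).clm_apply (F.T_deriv p.1)
  have d2 := (HasFDerivAt.comp_hasDerivAt p.2 (f := fun t => F.X (p.1, t))
    (hasFDerivAt_fderiv hφ (F.X p)) (F.hasDerivAt_X_snd p)).clm_apply
    (hasDerivAt_const p.2 (F.N p.1))
  have hg : HasDerivAt (fun t => F.g (p.1, t)) (-(F.κ p.1)) p.2 := by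
    have := ((hasDerivAt_id p.2).const_mul (F.κ p.1)).const_sub 1
    rw [mul_one] at this
    exact this
  rw [pdS_eq_of_hasDerivAt (h1.differentiable (by simp) p) d1,
    pdR_eq_of_hasDerivAt (h2.differentiable (by simp) p) (hg.fun_mul d2), lap_eq hφ,
    ← F.trace_bilin (fderiv ℝ (fderiv ℝ φ) (F.X p)) p.1]
  simp
  ring

end Frame

/-- The class of nonnegative functions with bounded Laplacian. -/
structure IsNonnegBddLap (Ω : Set E2) (A : ℝ) (w : E2 → ℝ) : Prop where
  smooth : ContDiff ℝ ∞ w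
  nonneg : ∀ x ∈ closure Ω, 0 ≤ w x
  lap_le : ∀ x ∈ closure Ω, |lap w x| ≤ A

section MeanValue
variable {w : E2 → ℝ} (hw : ContDiff ℝ ∞ w) (y : E2) {A r : ℝ}
include hw

/-- Polar coordinates are the frame of the unit circle, shifted by one. -/
lemma abs_circle_flux_le (hr : 0 < r) (hA : ∀ x ∈ Metric.closedBall y r, |lap w x| ≤ A) :
    |∫ s in (0 : ℝ)..2 * π, fderiv ℝ w ((Frame.circle y one_pos).X (s, r - 1))
      ((Frame.circle y one_pos).N s)| ≤ 2 * π * r * A := by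
  set F := Frame.circle y one_pos with hF
  have hgF : ∀ p, F.g p = 1 + p.2 := fun p => by rw [hF, Frame.circle_g, div_one]
  have hℓ : F.ℓ = 2 * π := mul_one _
  have hpi := pi_pos
  have hd : ContDiff ℝ ∞ fun p => fderiv ℝ w (F.X p) :=
    (hw.fderiv_right (m := ∞) (by simp)).comp F.contDiff_X
  have h1 : ContDiff ℝ ∞ fun p => fderiv ℝ w (F.X p) (F.T p.1) :=
    hd.clm_apply (F.T_smooth.comp contDiff_fst)
  have h2 : ContDiff ℝ ∞ fun p => F.g p * fderiv ℝ w (F.X p) (F.N p.1) :=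
    F.contDiff_g.mul (hd.clm_apply (F.N_smooth.comp contDiff_fst))
  have hTp : ∀ s, F.T (s + F.ℓ) = F.T s := fun s => by
    have h1 := (F.q_deriv (s + F.ℓ)).comp_add_const s F.ℓ
    simp only [F.q_per] at h1
    exact h1.unique (F.q_deriv s)
  have hdiv := integral_div_rect_of_le F.ℓ_pos.le (by linarith : (-1 : ℝ) ≤ r - 1) h1 h2
    (fun s t => by simp only [F.per_X, hTp])
  simp only [F.pdS_add_pdR_eq_lap hw] at hdiv
  simp only [hgF, add_neg_cancel, zero_mul,
    intervalIntegral.integral_zero, sub_zero, add_sub_cancel, intervalIntegral.integral_const_mul,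
    hℓ] at hdiv
  have hbound : ‖∫ p in rect (2 * π) (-1) (r - 1), (1 + p.2) * lap w (F.X p)‖
      ≤ (r * A) * volume.real (rect (2 * π) (-1) (r - 1)) := by
    refine norm_setIntegral_le_of_norm_le_const (isCompact_rect _ _ _).measure_lt_top
      fun p hp => ?_
    obtain ⟨h3, h4, h5⟩ := mem_rect.1 hp
    have hmem : F.X p ∈ Metric.closedBall y r := by
      rw [hF, Frame.circle_X, Metric.mem_closedBall, dist_eq_norm, add_sub_cancel_left, norm_smul,
        norm_uvec, mul_one, Real.norm_eq_abs, abs_of_nonneg (by linarith)]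
      linarith
    rw [norm_mul, Real.norm_eq_abs, Real.norm_eq_abs, abs_of_nonneg (by linarith)]
    exact mul_le_mul (by linarith) (hA _ hmem) (abs_nonneg _) hr.le
  have hvol : volume.real (rect (2 * π) (-1) (r - 1)) = 2 * π * r := by
    rw [rect, ← Set.Icc_prod_Icc, Measure.volume_eq_prod, measureReal_prod_prod,
      Real.volume_real_Icc_of_le (by positivity), Real.volume_real_Icc_of_le (by linarith)]
    ring
  rw [hdiv, hvol, Real.norm_eq_abs, abs_mul, abs_of_pos hr] at hbound
  have : r * |∫ s in (0 : ℝ)..2 * π, fderiv ℝ w (F.X (s, r - 1)) (F.N s)|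
      ≤ r * (2 * π * r * A) := by linarith
  exact le_of_mul_le_mul_left this hr

lemma abs_circle_integral_sub_le (hr : 0 ≤ r) (hA : ∀ x ∈ Metric.closedBall y r, |lap w x| ≤ A) :
    |(∫ s in (0 : ℝ)..2 * π, w ((Frame.circle y one_pos).X (s, r - 1))) - 2 * π * w y|
      ≤ 2 * π * r ^ 2 * A := by
  set F := Frame.circle y one_pos with hF
  have hpi := pi_pos
  have hA0 : 0 ≤ A := (abs_nonneg _).trans (hA y (Metric.mem_closedBall_self hr))
  have hp := F.contDiff_pull hw
  have hdiv := integral_div_rect_of_le (ℓ := 2 * π) (F := fun _ => 0) (by positivity)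
    (by linarith : (-1 : ℝ) ≤ r - 1) contDiff_const hp (fun _ _ => rfl)
  have h0 : ∀ p : ℝ × ℝ, pdS (fun _ : ℝ × ℝ => (0 : ℝ)) p = 0 := fun p => by simp [pdS]
  have hy : ∀ s : ℝ, F.pull w (s, -1) = w y := fun s => by
    rw [Frame.pull, hF, Frame.circle_X]
    simp
  simp only [h0, zero_add, hy, intervalIntegral.integral_const, sub_zero, smul_eq_mul] at hdiv
  rw [integral_rect_eq (by positivity) (by linarith) (contDiff_pdR hp).continuous] at hdiv
  simp only [F.pdR_pull hw] at hdiv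
  have hb : ‖∫ t in (-1 : ℝ)..(r - 1), ∫ s in (0 : ℝ)..2 * π, fderiv ℝ w (F.X (s, t)) (F.N s)‖
      ≤ (2 * π * r * A) * |r - 1 - -1| := by
    refine intervalIntegral.norm_integral_le_of_norm_le_const fun t ht => ?_
    rw [Set.uIoc_of_le (by linarith)] at ht
    have h1 : 0 < t + 1 := by linarith [ht.1]
    have h2 := abs_circle_flux_le hw y (r := t + 1) h1 fun x hx =>
      hA x (Metric.closedBall_subset_closedBall (by linarith [ht.2]) hx)
    rw [add_sub_cancel_right] at h2
    refine h2.trans ?_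
    have : t + 1 ≤ r := by linarith [ht.2]
    gcongr
  rw [hdiv, Real.norm_eq_abs] at hb
  refine hb.trans (le_of_eq ?_)
  rw [abs_of_nonneg (by linarith)]
  ring

lemma abs_annulus_integral_sub_le {r₀ r₁ : ℝ} (h₀ : 0 ≤ r₀) (h₁ : r₀ ≤ r₁)
    (hA : ∀ x ∈ Metric.closedBall y r₁, |lap w x| ≤ A) :
    |(∫ p in rect (2 * π) (r₀ - 1) (r₁ - 1), w ((Frame.circle y one_pos).X p))
      - 2 * π * (r₁ - r₀) * w y| ≤ 2 * π * r₁ ^ 2 * A * (r₁ - r₀) := by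
  set F := Frame.circle y one_pos with hF
  have hpi := pi_pos
  have hA0 : 0 ≤ A :=
    (abs_nonneg _).trans (hA y (Metric.mem_closedBall_self (h₀.trans h₁)))
  have hp : Continuous fun p => w (F.X p) := (F.contDiff_pull hw).continuous
  have hc : Continuous fun t : ℝ => ∫ s in (0 : ℝ)..2 * π, w (F.X (s, t)) :=
    intervalIntegral.continuous_parametric_intervalIntegral_of_continuous'
      (f := fun t s => w (F.X (s, t))) (hp.comp continuous_swap) 0 (2 * π)
  rw [integral_rect_eq (by positivity) (by linarith) hp]
  have e : (∫ t in (r₀ - 1)..(r₁ - 1), ∫ s in (0 : ℝ)..2 * π, w (F.X (s, t)))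
      - 2 * π * (r₁ - r₀) * w y
      = ∫ t in (r₀ - 1)..(r₁ - 1), ((∫ s in (0 : ℝ)..2 * π, w (F.X (s, t))) - 2 * π * w y) := by
    rw [intervalIntegral.integral_sub (hc.intervalIntegrable _ _)
      (continuous_const.intervalIntegrable _ _), intervalIntegral.integral_const, smul_eq_mul]
    ring
  rw [e]
  have hb : ‖∫ t in (r₀ - 1)..(r₁ - 1), ((∫ s in (0 : ℝ)..2 * π, w (F.X (s, t))) - 2 * π * w y)‖
      ≤ (2 * π * r₁ ^ 2 * A) * |r₁ - 1 - (r₀ - 1)| := by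
    refine intervalIntegral.norm_integral_le_of_norm_le_const fun t ht => ?_
    rw [Set.uIoc_of_le (by linarith)] at ht
    have h1 : 0 ≤ t + 1 := by linarith [ht.1]
    have h2 := abs_circle_integral_sub_le hw y (r := t + 1) h1 fun x hx =>
      hA x (Metric.closedBall_subset_closedBall (by linarith [ht.2]) hx)
    rw [add_sub_cancel_right] at h2
    refine h2.trans ?_
    have : t + 1 ≤ r₁ := by linarith [ht.2]
    gcongr
  rw [Real.norm_eq_abs] at hb
  refine hb.trans (le_of_eq ?_)
  rw [abs_of_nonneg (by linarith)]
  ring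

end MeanValue

lemma norm_circle_zero_X {p : ℝ × ℝ} (hp : -1 ≤ p.2) :
    ‖(Frame.circle 0 one_pos).X p‖ = 1 + p.2 := by
  rw [Frame.circle_X, zero_add, norm_smul, norm_uvec, mul_one, Real.norm_eq_abs,
    abs_of_nonneg (by linarith)]

lemma circle_X_eq_add (y : E2) (p : ℝ × ℝ) :
    (Frame.circle y one_pos).X p = (Frame.circle 0 one_pos).X p + y := by
  rw [Frame.circle_X, Frame.circle_X, zero_add, add_comm]

/-- Harnack's inequality with a bounded right-hand side. -/
lemma exists_harnack (Ω : Set E2) {d : ℝ} (hd : 0 < d) :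
    ∃ C : ℝ, 0 ≤ C ∧ ∀ x y : E2, dist x y ≤ d / 2 → Metric.closedBall x (3 * d) ⊆ closure Ω →
      Metric.closedBall y (3 * d) ⊆ closure Ω → ∀ A w, 0 ≤ A → IsNonnegBddLap Ω A w →
      w x ≤ C * (w y + A) := by
  set F := Frame.circle 0 one_pos with hF
  have hℓ : F.ℓ = 2 * π := mul_one _
  have hpi := pi_pos
  have hinj : ∀ r₀ r₁ : ℝ, 0 < r₀ → ∀ p ∈ rect (2 * π) (r₀ - 1) (r₁ - 1),
      Function.Injective (fderiv ℝ F.X p) := by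
    intro r₀ r₁ hr p hp
    refine F.injective_fderiv_X ?_
    rw [hF, Frame.circle_g, div_one]
    have := (mem_rect.1 hp).2.1
    have : 0 < 1 + p.2 := by linarith
    exact this.ne'
  obtain ⟨C, hC, hcomp⟩ := exists_integral_comp F.contDiff_X
    (isCompact_rect (2 * π) (d - 1) (2 * d - 1)) (hinj d (2 * d) hd)
  obtain ⟨C', hC', hcomp'⟩ := exists_integral_comp F.contDiff_X
    (isCompact_rect (2 * π) (d / 2 - 1) (3 * d - 1)) (hinj (d / 2) (3 * d) (by positivity))
  refine ⟨C * C' * (5 / 2 + 45 / 2 * d ^ 2) + 4 * d ^ 2, by positivity,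
    fun x y hxy hx hy A w hA hw => ?_⟩
  have hmem : ∀ (z : E2) (r₀ r₁ : ℝ), 0 ≤ r₀ → r₁ ≤ 3 * d → ∀ p ∈ rect (2 * π) (r₀ - 1) (r₁ - 1),
      F.X p + z ∈ Metric.closedBall z (3 * d) := by
    intro z r₀ r₁ h0 h1 p hp
    obtain ⟨-, h2, h3⟩ := mem_rect.1 hp
    rw [Metric.mem_closedBall, dist_eq_norm, add_sub_cancel_right,
      norm_circle_zero_X (by linarith)]
    linarith
  have hann : ∀ (z : E2) (r₀ r₁ : ℝ), 0 ≤ r₀ → r₀ ≤ r₁ → r₁ ≤ 3 * d →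
      Metric.closedBall z (3 * d) ⊆ closure Ω →
      |(∫ p in rect (2 * π) (r₀ - 1) (r₁ - 1), max (w (F.X p + z)) 0)
        - 2 * π * (r₁ - r₀) * w z| ≤ 2 * π * r₁ ^ 2 * A * (r₁ - r₀) := by
    intro z r₀ r₁ h0 h1 h2 hz
    have h := abs_annulus_integral_sub_le hw.smooth z h0 h1 fun u hu =>
      hw.lap_le u (hz (Metric.closedBall_subset_closedBall h2 hu))
    rwa [setIntegral_congr_fun (measurableSet_rect _ _ _) (fun p hp => by
      have h3 := hw.nonneg _ (hz (hmem z r₀ r₁ h0 h2 p hp))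
      change w ((Frame.circle z one_pos).X p) = max (w (F.X p + z)) 0
      rw [circle_X_eq_add, max_eq_left h3])] at h
  have hx1 := abs_le.1 (hann x d (2 * d) hd.le (by linarith) (by linarith) hx)
  have hy1 := abs_le.1 (hann y (d / 2) (3 * d) (by positivity) (by linarith) le_rfl hy)
  have hcont : ∀ z : E2, Continuous fun u => max (w (u + z)) 0 := fun z =>
    (hw.smooth.continuous.comp (continuous_id.add continuous_const)).max continuous_const
  have hx2 := (hcomp (fun u => max (w (u + x)) 0) (hcont x) fun u => le_max_right _ _).1
  have hy2 := (hcomp' (fun u => max (w (u + y)) 0) (hcont y) fun u => le_max_right _ _).2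
  have hshift : ∫ u in F.X '' rect (2 * π) (d - 1) (2 * d - 1), max (w (u + x)) 0
      ≤ ∫ u in F.X '' rect (2 * π) (d / 2 - 1) (3 * d - 1), max (w (u + y)) 0 := by
    have hmp := measurePreserving_add_right (volume : Measure E2) (x - y)
    have e := hmp.setIntegral_image_emb (measurableEmbedding_addRight (x - y))
      (fun u => max (w (u + y)) 0) (F.X '' rect (2 * π) (d - 1) (2 * d - 1))
    simp only [add_assoc, sub_add_cancel] at e
    rw [← e]
    refine setIntegral_mono_set ((hcont y).continuousOn.integrableOn_compact
      ((isCompact_rect _ _ _).image F.contDiff_X.continuous))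
      (Filter.Eventually.of_forall fun u => le_max_right _ _) (LE.le.eventuallyLE ?_)
    rintro _ ⟨_, ⟨p, hp, rfl⟩, rfl⟩
    obtain ⟨-, h2, h3⟩ := mem_rect.1 hp
    have h4 := norm_circle_zero_X (p := p) (by linarith)
    rw [dist_eq_norm] at hxy
    have h5 := norm_add_le (F.X p) (x - y)
    have h6 := norm_sub_norm_le (F.X p) (-(x - y))
    rw [norm_neg, sub_neg_eq_add] at h6
    rw [← hℓ]
    refine Frame.circle_mem_X_image 0 one_pos ?_ ?_
    · rw [dist_zero_right]
      linarith
    · rw [dist_zero_right]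
      linarith
  have hyn := hw.nonneg y (hy (Metric.mem_closedBall_self (by positivity)))
  have h7 : 2 * π * (2 * d - d) * w x ≤ C * (C' * (2 * π * (3 * d - d / 2) * w y
      + 2 * π * (3 * d) ^ 2 * A * (3 * d - d / 2))) + 2 * π * (2 * d) ^ 2 * A * (2 * d - d) := by
    have h8 := mul_le_mul_of_nonneg_left hy1.2 hC'
    have h9 := mul_le_mul_of_nonneg_left (hshift.trans hy2) hC
    have h10 := mul_le_mul_of_nonneg_left h8 hC
    linarith
  have h11 : 2 * π * d * w x ≤ 2 * π * d * (C * C' * (5 / 2 * w y + 45 / 2 * d ^ 2 * A)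
      + 4 * d ^ 2 * A) := by linarith
  have h12 := le_of_mul_le_mul_left h11 (by positivity)
  refine h12.trans ?_
  have h13 : 0 ≤ C * C' := mul_nonneg hC hC'
  have h14 : 0 ≤ C * C' * (5 / 2 * A + 45 / 2 * d ^ 2 * w y) := by positivity
  have h15 : 0 ≤ 4 * d ^ 2 * w y := by positivity
  linarith

lemma exists_harnack_of_isCompact {Ω : Set E2} (hΩ : IsPlaneDomain Ω) {K : Set E2}
    (hK : IsCompact K) (hKΩ : K ⊆ Ω) :
    ∃ C : ℝ, 0 ≤ C ∧ ∀ x ∈ K, ∀ y ∈ K, ∀ A w, 0 ≤ A → IsNonnegBddLap Ω A w →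
      w x ≤ C * (w y + A) := by
  have hloc : ∀ x ∈ Ω, ∃ ρ > 0, ∃ C : ℝ, 0 ≤ C ∧ ∀ y ∈ Metric.ball x ρ, ∀ z ∈ Metric.ball x ρ,
      ∀ A w, 0 ≤ A → IsNonnegBddLap Ω A w → w y ≤ C * (w z + A) := by
    intro x hx
    obtain ⟨ε, hε, hball⟩ := Metric.isOpen_iff.1 hΩ.isOpen x hx
    obtain ⟨C, hC, h⟩ := exists_harnack Ω (d := ε / 4) (by positivity)
    have hsub : ∀ y ∈ Metric.ball x (ε / 16), Metric.closedBall y (3 * (ε / 4)) ⊆ closure Ω := by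
      intro y hy
      refine (Metric.closedBall_subset_ball' ?_).trans (hball.trans subset_closure)
      rw [Metric.mem_ball] at hy
      linarith
    refine ⟨ε / 16, by positivity, C, hC, fun y hy z hz => h y z ?_ (hsub y hy) (hsub z hz)⟩
    rw [Metric.mem_ball] at hy hz
    linarith [dist_triangle_right y z x]
  have hnn : ∀ z ∈ Ω, ∀ A w, IsNonnegBddLap Ω A w → 0 ≤ w z := fun z hz A w hw =>
    hw.nonneg z (subset_closure hz)
  have htrans : ∀ x y z : E2, x ∈ Ω → y ∈ Ω → z ∈ Ω →
      (∃ C : ℝ, 0 ≤ C ∧ ∀ A w, 0 ≤ A → IsNonnegBddLap Ω A w → w x ≤ C * (w y + A)) →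
      (∃ C : ℝ, 0 ≤ C ∧ ∀ A w, 0 ≤ A → IsNonnegBddLap Ω A w → w y ≤ C * (w z + A)) →
      ∃ C : ℝ, 0 ≤ C ∧ ∀ A w, 0 ≤ A → IsNonnegBddLap Ω A w → w x ≤ C * (w z + A) := by
    rintro x y z - - hz ⟨C, hC, h⟩ ⟨C', hC', h'⟩
    refine ⟨C * (C' + 1), by positivity, fun A w hA hw => (h A w hA hw).trans ?_⟩
    rw [mul_assoc]
    refine mul_le_mul_of_nonneg_left ?_ hC
    linarith [h' A w hA hw, hnn z hz A w hw]
  have hpt : ∀ x ∈ Ω, ∀ y ∈ Ω, ∃ C : ℝ, 0 ≤ C ∧ ∀ A w, 0 ≤ A → IsNonnegBddLap Ω A w →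
      w x ≤ C * (w y + A) := by
    intro x hx y hy
    refine hΩ.isConnected.isPreconnected.induction₂' (fun x y => ∃ C : ℝ, 0 ≤ C ∧ ∀ A w, 0 ≤ A →
      IsNonnegBddLap Ω A w → w x ≤ C * (w y + A)) (fun z hz => ?_) htrans hx hy
    obtain ⟨ρ, hρ, C, hC, h⟩ := hloc z hz
    filter_upwards [mem_nhdsWithin_of_mem_nhds (Metric.ball_mem_nhds z hρ)] with u hu
    exact ⟨⟨C, hC, h z (Metric.mem_ball_self hρ) u hu⟩, ⟨C, hC, h u hu z (Metric.mem_ball_self hρ)⟩⟩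
  obtain ⟨b, hb⟩ := hΩ.isConnected.nonempty
  have key : ∃ C : ℝ, 0 ≤ C ∧ ∀ x ∈ K, x ∈ Ω ∧ ∀ A w, 0 ≤ A → IsNonnegBddLap Ω A w →
      w x ≤ C * (w b + A) ∧ w b ≤ C * (w x + A) := by
    refine hK.induction_on (p := fun S => ∃ C : ℝ, 0 ≤ C ∧ ∀ x ∈ S, x ∈ Ω ∧ ∀ A w, 0 ≤ A →
      IsNonnegBddLap Ω A w → w x ≤ C * (w b + A) ∧ w b ≤ C * (w x + A)) ?_ ?_ ?_ ?_
    · exact ⟨0, le_rfl, fun x hx => absurd hx (Set.notMem_empty x)⟩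
    · rintro S T hST ⟨C, hC, h⟩
      exact ⟨C, hC, fun x hx => h x (hST hx)⟩
    · rintro S T ⟨C, hC, h⟩ ⟨C', hC', h'⟩
      refine ⟨C + C', by positivity, ?_⟩
      rintro x (hx | hx)
      · refine ⟨(h x hx).1, fun A w hA hw => ?_⟩
        have h1 := (h x hx).2 A w hA hw
        have h2 := mul_nonneg hC' (add_nonneg (hnn b hb A w hw) hA)
        have h3 := mul_nonneg hC' (add_nonneg (hnn x (h x hx).1 A w hw) hA)
        constructor <;> linarith [h1.1, h1.2]
      · refine ⟨(h' x hx).1, fun A w hA hw => ?_⟩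
        have h1 := (h' x hx).2 A w hA hw
        have h2 := mul_nonneg hC (add_nonneg (hnn b hb A w hw) hA)
        have h3 := mul_nonneg hC (add_nonneg (hnn x (h' x hx).1 A w hw) hA)
        constructor <;> linarith [h1.1, h1.2]
    · intro x hx
      have hxΩ := hKΩ hx
      obtain ⟨ρ, hρ, C, hC, h⟩ := hloc x hxΩ
      obtain ⟨C₁, hC₁, h₁⟩ := hpt x hxΩ b hb
      obtain ⟨C₂, hC₂, h₂⟩ := hpt b hb x hxΩ
      have hmem := Metric.mem_ball_self (x := x) hρ
      refine ⟨Metric.ball x ρ ∩ Ω, mem_nhdsWithin_of_mem_nhds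
        (Filter.inter_mem (Metric.ball_mem_nhds x hρ) (hΩ.isOpen.mem_nhds hxΩ)),
        C * (C₁ + 1) + C₂ * (C + 1), by positivity, fun y hy => ⟨hy.2, fun A w hA hw => ?_⟩⟩
      have hbn := add_nonneg (hnn b hb A w hw) hA
      have hyn := add_nonneg (hnn y hy.2 A w hw) hA
      have a1 := h y hy.1 x hmem A w hA hw
      have a2 := mul_le_mul_of_nonneg_left (h₁ A w hA hw) hC
      have a3 := h₂ A w hA hw
      have a4 := mul_le_mul_of_nonneg_left (h x hmem y hy.1 A w hA hw) hC₂
      have n1 := mul_nonneg (mul_nonneg hC₂ (by positivity : 0 ≤ C + 1)) hbn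
      have n2 := mul_nonneg (mul_nonneg hC (by positivity : 0 ≤ C₁ + 1)) hyn
      have n3 := mul_nonneg hC (hnn b hb A w hw)
      have n4 := mul_nonneg hC₂ (hnn y hy.2 A w hw)
      constructor
      · linarith
      · linarith
  obtain ⟨C, hC, h⟩ := key
  refine ⟨C * (C + 1), by positivity, fun x hx y hy A w hA hw => ?_⟩
  have h1 := ((h x hx).2 A w hA hw).1
  have h2 := mul_le_mul_of_nonneg_left ((h y hy).2 A w hA hw).2 hC
  have h3 := mul_nonneg hC (hnn y (h y hy).1 A w hw)
  linarith

lemma lap_const_sub (M : ℝ) (φ : E2 → ℝ) (x : E2) : lap (fun y => M - φ y) x = -lap φ x := by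
  simp [lap, fderiv_const_sub]

lemma lap_neg (φ : E2 → ℝ) (x : E2) : lap (fun y => -φ y) x = -lap φ x := by
  simp [lap]

namespace Frame
variable {F : Frame} {Ω : Set E2}

/-- A minimum principle for Neumann data, relative to a compact subset of the domain. -/
lemma exists_min_principle_compact (hΩ : IsPlaneDomain Ω) (hinj : Set.InjOn F.q (Set.Ico 0 F.ℓ))
    (hr : Set.range F.q = frontier Ω) (hin : ∃ δ > 0, ∀ t ∈ Set.Ioo (0 : ℝ) δ, F.X (0, t) ∈ Ω) :
    ∃ K, IsCompact K ∧ K ⊆ Ω ∧ K.Nonempty ∧ ∃ C : ℝ, 0 < C ∧ ∀ φ, ContDiff ℝ ∞ φ →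
      (∀ s, fderiv ℝ φ (F.q s) (F.N s) = 0) →
      ∀ A > 0, (∀ x ∈ closure Ω, lap φ x < A) → ∀ m, (∀ x ∈ K, m ≤ φ x) →
      ∀ x ∈ closure Ω, m - C * A ≤ φ x := by
  obtain ⟨R, hF, G, hGF, hG, K, hK, hKΩ, hcov⟩ := exists_collar hΩ hinj hr hin
  have hR := hF.pos
  obtain ⟨C₁, hC₁, h₁⟩ := hF.exists_min_principle
  obtain ⟨C₂, hC₂, h₂⟩ := hG.exists_min_principle
  have hc : ∀ H : Frame, IsCompact (H.X '' rect H.ℓ R R) := fun H =>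
    (isCompact_rect _ _ _).image H.contDiff_X.continuous
  have hsub : ∀ H : Frame, H.IsCollar Ω R → H.X '' rect H.ℓ R R ⊆ Ω := by
    rintro H hH _ ⟨p, hp, rfl⟩
    exact hH.mem p (rect_subset hR.le le_rfl hp) (by linarith [(mem_rect.1 hp).2.1])
  have hmem : ∀ H : Frame, ∀ s ∈ Set.Icc 0 H.ℓ, H.X (s, R) ∈ H.X '' rect H.ℓ R R :=
    fun H s hs => Set.mem_image_of_mem _ (mem_rect.2 ⟨hs, le_rfl, le_rfl⟩)
  refine ⟨K ∪ (F.X '' rect F.ℓ R R ∪ G.X '' rect G.ℓ R R), hK.union ((hc F).union (hc G)),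
    Set.union_subset hKΩ (Set.union_subset (hsub F hF) (hsub G hG)),
    ⟨_, Or.inr (Or.inl (hmem F 0 ⟨le_rfl, F.ℓ_pos.le⟩))⟩, C₁ + C₂, by positivity,
    fun φ hφ hN A hA hl m hm x hx => ?_⟩
  have hNG : ∀ s, fderiv ℝ φ (G.q s) (G.N s) = 0 := by
    rcases hGF with rfl | rfl
    · exact hN
    · intro s
      change fderiv ℝ φ (F.q s) (-F.N s) = 0
      rw [map_neg, hN, neg_zero]
  have a₁ : 0 < C₁ * A := by positivity
  have a₂ : 0 < C₂ * A := by positivity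
  rcases hcov hx with h | ⟨p, hp, rfl⟩ | ⟨p, hp, rfl⟩
  · have := hm x (Or.inl h)
    linarith
  · have := h₁ φ hφ hN A hA hl m (fun s hs => hm _ (Or.inr (Or.inl (hmem F s hs)))) p
      (rect_subset le_rfl (by linarith) hp)
    linarith
  · have := h₂ φ hφ hNG A hA hl m (fun s hs => hm _ (Or.inr (Or.inr (hmem G s hs)))) p
      (rect_subset le_rfl (by linarith) hp)
    linarith

lemma exists_sq_ge (hΩ : IsPlaneDomain Ω) (hinj : Set.InjOn F.q (Set.Ico 0 F.ℓ))
    (hr : Set.range F.q = frontier Ω) (hin : ∃ δ > 0, ∀ t ∈ Set.Ioo (0 : ℝ) δ, F.X (0, t) ∈ Ω) :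
    ∃ C : ℝ, 0 ≤ C ∧ ∀ lam : ℝ, 0 < lam → ∀ φ, IsSol Ω lam φ →
      (∀ s, fderiv ℝ φ (F.q s) (F.N s) = 0) →
      ∀ x₀ ∈ closure Ω, 0 < φ x₀ → (∀ x ∈ closure Ω, |φ x| ≤ φ x₀) → 1 ≤ C * lam ^ 2 := by
  obtain ⟨K, hK, hKΩ, hKne, C, hC, hmin⟩ := exists_min_principle_compact hΩ hinj hr hin
  obtain ⟨C', hC', hhar⟩ := exists_harnack_of_isCompact hΩ hK hKΩ
  refine ⟨C' * (3 * C + 1) + 2 * C, by positivity, fun lam hl φ hφ hN x₀ hx₀ hpos hmax => ?_⟩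
  by_contra! hlt
  set M := φ x₀ with hM
  set A := lam ^ 2 * M with hA
  have hA0 : 0 < A := by positivity
  have hlap : ∀ x ∈ closure Ω, |lap φ x| ≤ A := by
    intro x hx
    rw [hφ.eq x hx, abs_mul, abs_neg, abs_of_nonneg (by positivity)]
    exact mul_le_mul_of_nonneg_left (hmax x hx) (by positivity)
  have hw : IsNonnegBddLap Ω A fun y => M - φ y := by
    refine ⟨contDiff_const.sub hφ.smooth, fun x hx => ?_, fun x hx => ?_⟩
    · have := (le_abs_self _).trans (hmax x hx)
      linarith
    · rw [lap_const_sub, abs_neg]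
      exact hlap x hx
  obtain ⟨y₀, hy₀, hy₀'⟩ : ∃ y ∈ K, M - φ y ≤ 3 * C * A := by
    by_contra! h
    have := hmin (fun y => M - φ y) hw.smooth (fun s => by rw [fderiv_const_sub]; simp [hN]) (2 * A) (by positivity)
      (fun x hx => by linarith [(le_abs_self _).trans (hw.lap_le x hx)]) (3 * C * A)
      (fun x hx => (h x hx).le) x₀ hx₀
    have : 0 < C * A := by positivity
    simp only [← hM] at *
    linarith
  have hKle : ∀ x ∈ K, M - C' * (3 * C + 1) * A ≤ φ x := by
    intro x hx
    have h1 := hhar x hx y₀ hy₀ A _ hA0.le hw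
    have h2 : C' * (M - φ y₀ + A) ≤ C' * (3 * C * A + A) :=
      mul_le_mul_of_nonneg_left (by linarith) hC'
    linarith
  have hφpos : ∀ x ∈ closure Ω, 0 < φ x := by
    intro x hx
    have h1 := hmin φ hφ.smooth hN (2 * A) (by positivity)
      (fun x hx => by linarith [(le_abs_self _).trans (hlap x hx)]) _ hKle x hx
    have h2 := mul_lt_mul_of_pos_right hlt hpos
    rw [hA] at h1
    linarith
  have hlneg : ∀ x ∈ closure Ω, lap φ x < 0 := by
    intro x hx
    rw [hφ.eq x hx, neg_mul, neg_lt_zero]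
    have := hφpos x hx
    positivity
  obtain ⟨y₁, hy₁, hy₁m⟩ := hK.exists_isMinOn hKne hφ.smooth.continuous.continuousOn
  have hglob : ∀ x ∈ closure Ω, φ y₁ ≤ φ x := by
    intro x hx
    refine le_of_forall_pos_le_add fun ε hε => ?_
    have h1 := hmin φ hφ.smooth hN (ε / C) (by positivity)
      (fun x hx => (hlneg x hx).trans (by positivity)) (φ y₁) (fun x hx => hy₁m hx) x hx
    rw [mul_div_cancel₀ _ hC.ne'] at h1
    linarith
  have hloc : IsLocalMin φ y₁ := by
    filter_upwards [hΩ.isOpen.mem_nhds (hKΩ hy₁)] with x hx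
    exact hglob x (subset_closure hx)
  exact absurd (lap_nonneg_of_isLocalMin hφ.smooth hloc)
    (not_le.2 (hlneg y₁ (subset_closure (hKΩ hy₁))))

/-- The positive Neumann frequencies are bounded away from zero. -/
lemma exists_spectral_gap (hΩ : IsPlaneDomain Ω) (hinj : Set.InjOn F.q (Set.Ico 0 F.ℓ))
    (hr : Set.range F.q = frontier Ω) (hin : ∃ δ > 0, ∀ t ∈ Set.Ioo (0 : ℝ) δ, F.X (0, t) ∈ Ω) :
    ∃ lam₁ : ℝ, 0 < lam₁ ∧ ∀ lam : ℝ, 0 < lam → ∀ φ, IsSol Ω lam φ →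
      (∀ s, fderiv ℝ φ (F.q s) (F.N s) = 0) → (∃ x ∈ Ω, φ x ≠ 0) → lam₁ ≤ lam := by
  obtain ⟨C, hC, h⟩ := exists_sq_ge hΩ hinj hr hin
  have key : ∀ lam : ℝ, 0 < lam → ∀ φ, IsSol Ω lam φ →
      (∀ s, fderiv ℝ φ (F.q s) (F.N s) = 0) → (∃ x ∈ Ω, φ x ≠ 0) → 1 ≤ C * lam ^ 2 := by
    rintro lam hl φ hφ hN ⟨x₁, hx₁, hne⟩
    obtain ⟨x₀, hx₀, hmax⟩ := hΩ.isBounded.isCompact_closure.exists_isMaxOn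
      ⟨x₁, subset_closure hx₁⟩ hφ.smooth.continuous.abs.continuousOn
    have hpos : 0 < |φ x₀| := (abs_pos.2 hne).trans_le (hmax (subset_closure hx₁))
    rcases le_total 0 (φ x₀) with h0 | h0
    · rw [abs_of_nonneg h0] at hpos
      exact h lam hl φ hφ hN x₀ hx₀ hpos fun x hx => (hmax hx).trans_eq (abs_of_nonneg h0)
    · rw [abs_of_nonpos h0] at hpos
      refine h lam hl (fun x => -φ x) ⟨hφ.smooth.neg, fun x hx => ?_⟩ (fun s => by simp [hN])
        x₀ hx₀ hpos fun x hx => ?_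
      · rw [lap_neg, hφ.eq x hx]
        ring
      · rw [abs_neg]
        exact (hmax hx).trans_eq (abs_of_nonpos h0)
  refine ⟨1 / (C + 1), by positivity, fun lam hl φ hφ hN hne => ?_⟩
  have h1 := key lam hl φ hφ hN hne
  rw [div_le_iff₀ (by positivity)]
  by_contra! h2
  have h3 : lam < 1 := by nlinarith
  nlinarith [mul_nonneg hC hl.le]

end Frame

lemma lap_eq_of_eventuallyEq {φ ψ : E2 → ℝ} {x : E2} (h : φ =ᶠ[nhds x] ψ) : lap φ x = lap ψ x := by
  unfold lap
  refine Finset.sum_congr rfl fun i _ => ?_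
  have h1 : (fun y => fderiv ℝ φ y (EuclideanSpace.single i 1)) =ᶠ[nhds x]
      fun y => fderiv ℝ ψ y (EuclideanSpace.single i 1) := by
    filter_upwards [h.fderiv (𝕜 := ℝ)] with y hy
    rw [hy]
  rw [h1.fderiv_eq]

lemma continuous_lap {φ : E2 → ℝ} (hφ : ContDiff ℝ ∞ φ) : Continuous (lap φ) := by
  unfold lap
  refine continuous_finsetSum _ fun i _ => ?_
  have h1 : ContDiff ℝ ∞ fun y => fderiv ℝ φ y (EuclideanSpace.single i 1) :=
    (hφ.fderiv_right (by simp)).clm_apply contDiff_const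
  exact (h1.continuous_fderiv (by simp)).clm_apply continuous_const

/-- A function smooth near a closed set agrees near that set with a globally smooth one. -/
lemma exists_contDiff_eventuallyEq {K U : Set E2} (hK : IsClosed K) (hU : IsOpen U) (hKU : K ⊆ U)
    {φ : E2 → ℝ} (hφ : ContDiffOn ℝ ∞ φ U) :
    ∃ ψ : E2 → ℝ, ContDiff ℝ ∞ ψ ∧ ∀ x ∈ K, ψ =ᶠ[nhds x] φ := by
  obtain ⟨f, hf0, hf1, -⟩ := exists_contMDiffMap_zero_one_nhds_of_isClosed
    (modelWithCornersSelf ℝ E2) (n := (⊤ : ℕ∞)) hU.isClosed_compl hK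
    (Set.disjoint_left.2 fun x hx hxK => hx (hKU hxK))
  have hf : ContDiff ℝ ∞ f := f.contMDiff.contDiff
  rw [eventually_nhdsSet_iff_forall] at hf0 hf1
  refine ⟨fun x => f x * φ x, contDiff_iff_contDiffAt.2 fun x => ?_, fun x hx => ?_⟩
  · by_cases hx : x ∈ U
    · exact hf.contDiffAt.mul (hφ.contDiffAt (hU.mem_nhds hx))
    · refine (contDiffAt_const (c := (0 : ℝ))).congr_of_eventuallyEq ?_
      filter_upwards [hf0 x hx] with y hy
      rw [hy, zero_mul]
  · filter_upwards [hf1 x hx] with y hy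
    rw [hy, one_mul]

lemma IsNeumannEigenfunction.exists_isSol {Ω : Set E2} {B : BoundaryParam Ω} {lam : ℝ}
    {φ : E2 → ℝ} (h : IsNeumannEigenfunction B lam φ) :
    ∃ ψ, IsSol Ω lam ψ ∧ ∀ x ∈ closure Ω, ψ x = φ x ∧ fderiv ℝ ψ x = fderiv ℝ φ x := by
  obtain ⟨U, hU, hΩU, hφ⟩ := h.smooth
  obtain ⟨ψ, hψ, he⟩ := exists_contDiff_eventuallyEq isClosed_closure hU hΩU hφ
  refine ⟨ψ, ⟨hψ, ?_⟩, fun x hx => ⟨(he x hx).eq_of_nhds, (he x hx).fderiv_eq⟩⟩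
  have hcl : IsClosed {x | lap ψ x = -lam ^ 2 * ψ x} :=
    isClosed_eq (continuous_lap hψ) (continuous_const.mul hψ.continuous)
  refine fun x hx => closure_minimal (fun y hy => ?_) hcl hx
  have hy' := he y (subset_closure hy)
  rw [Set.mem_ofPred_eq, lap_eq_of_eventuallyEq hy', h.eigen y hy, hy'.eq_of_nhds]

lemma inner_gradient (φ : E2 → ℝ) (x v : E2) : ⟪gradient φ x, v⟫ = fderiv ℝ φ x v := by
  rw [gradient, InnerProductSpace.toDual_symm_apply]

/-- The frame along the boundary whose normal agrees with the given one at the origin. -/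
lemma BoundaryParam.exists_frame {Ω : Set E2} (B : BoundaryParam Ω) (hB : B.IsSmooth) :
    ∃ F : Frame, F.ℓ = B.len ∧ F.q = B.q ∧ F.T = B.qd ∧ B.ν 0 = F.N 0 := by
  set F := Frame.ofCurve B.len B.len_pos B.q B.qd hB B.hasDerivAt B.periodic B.unitSpeed 1
    (one_pow 2) with hF
  rcases F.eq_or_eq_neg_N (B.ν_unit 0) (B.ν_orth 0) with h | h
  · exact ⟨F, rfl, rfl, rfl, h⟩
  · exact ⟨F.flip, rfl, rfl, rfl, h⟩

lemma InteriorCurve.exists_frame {Ω : Set E2} (Γ : InteriorCurve Ω) :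
    ∃ H : Frame, H.ℓ = Γ.len ∧ H.q = Γ.c ∧ H.T = Γ.cd :=
  ⟨Frame.ofCurve Γ.len Γ.len_pos Γ.c Γ.cd
    (contDiff_iff_contDiffAt.2 fun s => (Γ.analytic s trivial).contDiffAt) Γ.hasDerivAt Γ.periodic
    Γ.unitSpeed 1 (one_pow 2), rfl, rfl, rfl⟩

lemma Frame.sqrt_cauchy_le (H : Frame) {φ : E2 → ℝ} (hφ : ContDiff ℝ ∞ φ) :
    √(H.cauchy φ) ≤ √(∫ s in (0 : ℝ)..H.ℓ, φ (H.q s) ^ 2)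
      + √(∫ s in (0 : ℝ)..H.ℓ, fderiv ℝ φ (H.q s) (H.N s) ^ 2) := by
  have hq := H.q_smooth.continuous
  have hN := H.N_smooth.continuous
  have h1 : Continuous fun s => φ (H.q s) ^ 2 := (hφ.continuous.comp hq).pow 2
  have h2 : Continuous fun s => fderiv ℝ φ (H.q s) (H.N s) ^ 2 :=
    (((hφ.continuous_fderiv (by simp)).comp hq).clm_apply hN).pow 2
  rw [Frame.cauchy, intervalIntegral.integral_add (h1.intervalIntegrable _ _)
    (h2.intervalIntegrable _ _)]
  have p1 : 0 ≤ ∫ s in (0 : ℝ)..H.ℓ, φ (H.q s) ^ 2 :=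
    intervalIntegral.integral_nonneg H.ℓ_pos.le fun s _ => by positivity
  have p2 : 0 ≤ ∫ s in (0 : ℝ)..H.ℓ, fderiv ℝ φ (H.q s) (H.N s) ^ 2 :=
    intervalIntegral.integral_nonneg H.ℓ_pos.le fun s _ => by positivity
  refine Real.sqrt_le_iff.2 ⟨by positivity, ?_⟩
  rw [add_sq, sq_sqrt p1, sq_sqrt p2]
  have : 0 ≤ 2 * √(∫ s in (0 : ℝ)..H.ℓ, φ (H.q s) ^ 2)
      * √(∫ s in (0 : ℝ)..H.ℓ, fderiv ℝ φ (H.q s) (H.N s) ^ 2) := by positivity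
  linarith

/-- The Cauchy data of a Neumann eigenfunction along an interior real-analytic curve
control its boundary trace, up to a factor `e^{Cλ}`. -/
theorem boundary_trace_controlled_by_cauchy_data
    (Ω : Set E2) (hΩ : IsPlaneDomain Ω) (B : BoundaryParam Ω) (hB : B.IsSmooth)
    (Γ : InteriorCurve Ω) :
    ∃ C > (0 : ℝ), ∀ lam : ℝ, 0 < lam → ∀ φ : E2 → ℝ,
      IsNeumannEigenfunction B lam φ →
      Real.sqrt (∫ s in (0 : ℝ)..B.len, (φ (B.q s)) ^ 2) ≤
        Real.exp (C * lam) *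
          (Real.sqrt (∫ s in (0 : ℝ)..Γ.len, (φ (Γ.c s)) ^ 2) +
            Real.sqrt (∫ s in (0 : ℝ)..Γ.len, (⟪gradient φ (Γ.c s), Γ.n s⟫ : ℝ) ^ 2)) := by
  obtain ⟨F, hFℓ, hFq, hFT, hFν⟩ := B.exists_frame hB
  obtain ⟨H, hHℓ, hHq, hHT⟩ := Γ.exists_frame
  have hinj : Set.InjOn F.q (Set.Ico 0 F.ℓ) := by rw [hFq, hFℓ]; exact B.injOn
  have hr : Set.range F.q = frontier Ω := by rw [hFq]; exact B.range_eq
  have hin : ∃ δ > 0, ∀ t ∈ Set.Ioo (0 : ℝ) δ, F.X (0, t) ∈ Ω := by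
    obtain ⟨δ, hδ, h⟩ := B.ν_inward 0
    refine ⟨δ, hδ, fun t ht => ?_⟩
    rw [Frame.X, hFq, ← hFν]
    exact h t ht
  have hH : ∀ s, H.q s ∈ Ω := fun s => by rw [hHq]; exact Γ.mem s
  obtain ⟨C, hC, hmain⟩ := Frame.exists_trace_le_cauchy hΩ hinj hr hin H hH
  obtain ⟨lam₁, hlam₁, hgap⟩ := Frame.exists_spectral_gap hΩ hinj hr hin
  refine ⟨C * (1 / lam₁ + 1) + 1, by positivity, fun lam hl φ hφ => ?_⟩
  obtain ⟨ψ, hψ, he⟩ := hφ.exists_isSol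
  have hbd : ∀ s, B.q s ∈ closure Ω := fun s =>
    frontier_subset_closure (B.range_eq ▸ Set.mem_range_self s)
  have hN : ∀ s, fderiv ℝ ψ (F.q s) (F.N s) = 0 := by
    intro s
    have h1 := hφ.neumann s
    rw [inner_gradient, ← (he _ (hbd s)).2, ← hFq] at h1
    rcases F.eq_or_eq_neg_N (B.ν_unit s) (hFT ▸ B.ν_orth s) with h | h
    · rwa [h] at h1
    · rwa [h, map_neg, neg_eq_zero] at h1
  have hne : ∃ x ∈ Ω, ψ x ≠ 0 := by
    obtain ⟨x, hx, h⟩ := hφ.nontrivial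
    exact ⟨x, hx, by rwa [(he x (subset_closure hx)).1]⟩
  have hle := hgap lam hl ψ hψ hN hne
  have htr : ∀ s, φ (B.q s) ^ 2 = ψ (F.q s) ^ 2 := fun s => by rw [hFq, (he _ (hbd s)).1]
  have hd : ∀ s, φ (Γ.c s) ^ 2 = ψ (H.q s) ^ 2 := fun s => by
    rw [hHq, (he _ (subset_closure (Γ.mem s))).1]
  have hn : ∀ s, ⟪gradient φ (Γ.c s), Γ.n s⟫ ^ 2 = fderiv ℝ ψ (H.q s) (H.N s) ^ 2 := by
    intro s
    rw [inner_gradient, ← (he _ (subset_closure (Γ.mem s))).2, ← hHq]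
    rcases H.eq_or_eq_neg_N (Γ.n_unit s) (hHT ▸ Γ.n_orth s) with h | h
    · rw [h]
    · rw [h, map_neg, neg_sq]
  simp only [htr, hd, hn]
  rw [← hFℓ, ← hHℓ]
  have hc := H.cauchy_nonneg ψ
  calc √(∫ s in (0 : ℝ)..F.ℓ, ψ (F.q s) ^ 2)
      ≤ √(exp ((C * (1 / lam₁ + 1) + 1) * lam) ^ 2 * H.cauchy ψ) := by
        refine Real.sqrt_le_sqrt ((hmain lam hl.le ψ hψ hN).trans ?_)
        refine mul_le_mul_of_nonneg_right ?_ hc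
        rw [← exp_nat_mul]
        refine exp_le_exp.2 ?_
        have h1 : 1 ≤ 1 / lam₁ * lam := by
          rw [one_div_mul_eq_div]
          exact (one_le_div hlam₁).2 hle
        have h2 := mul_le_mul_of_nonneg_left h1 hC
        have h3 : 0 ≤ C * (1 / lam₁ * lam) := by positivity
        have h4 : 0 ≤ C * lam := by positivity
        push_cast
        nlinarith
    _ = exp ((C * (1 / lam₁ + 1) + 1) * lam) * √(H.cauchy ψ) := by
        rw [Real.sqrt_mul (by positivity), Real.sqrt_sq (exp_pos _).le]
    _ ≤ _ := mul_le_mul_of_nonneg_left (H.sqrt_cauchy_le hψ.smooth) (exp_pos _).le
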